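/- There exists n₀ such that for every n ≥ n₀ there is no oriented graph G on n vertices in which every vertex v has outdegree exactly 0.20009·n (that is, 100000·|N⁺(v)| = 20009·n for every vertex v) and which contains no directed cycle of length 3, no directed cycle of length 4, and no directed cycle of length 6. -/

import Mathlib

/-- The outdegree of a vertex `v` in the directed graph with edge relation `E`. -/
noncomputable def outDeg {n : ℕ} (E : Fin n → Fin n → Prop) (v : Fin n) : ℕ :=
  {w | E v w}.ncard

/-- The indegree of a vertex `v` in the directed graph with edge relation `E`. -/
noncomputable def inDeg {n : ℕ} (E : Fin n → Fin n → Prop) (v : Fin n) : ℕ :=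
  {w | E w v}.ncard

/-- The semidegree of a vertex: the minimum of its outdegree and indegree. -/
noncomputable def semiDeg {n : ℕ} (E : Fin n → Fin n → Prop) (v : Fin n) : ℕ :=
  min (outDeg E v) (inDeg E v)

/-- `E` is an oriented graph: no loops and no pair of opposite edges. -/
def Oriented {n : ℕ} (E : Fin n → Fin n → Prop) : Prop :=
  (∀ v, ¬ E v v) ∧ (∀ u v, E u v → ¬ E v u)

/-- The graph contains a directed cycle of length exactly `t`:
`t` distinct vertices cyclically joined by edges. -/
def HasDiCycle {n : ℕ} (E : Fin n → Fin n → Prop) (t : ℕ) : Prop :=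
  ∃ v : ZMod t → Fin n, Function.Injective v ∧ ∀ i, E (v i) (v (i + 1))

/-- The graph contains a closed directed walk of length `t` (vertices may repeat). -/
def HasClosedWalk {n : ℕ} (E : Fin n → Fin n → Prop) (t : ℕ) : Prop :=
  ∃ w : ℕ → Fin n, w 0 = w t ∧ ∀ i < t, E (w i) (w (i + 1))

/-- There is a directed path of length `t` from `x` to `y` (all vertices distinct). -/
def HasPath {n : ℕ} (E : Fin n → Fin n → Prop) (x y : Fin n) (t : ℕ) : Prop :=
  ∃ u : Fin (t + 1) → Fin n, Function.Injective u ∧ u 0 = x ∧ u (Fin.last t) = y ∧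
    ∀ i : Fin t, E (u i.castSucc) (u i.succ)

/-- The graph contains an `s`-shortcut: a directed path `v₀ v₁ ⋯ v_s` on distinct
vertices together with the additional edge `v₀ v_s`. -/
def HasShortcut {n : ℕ} (E : Fin n → Fin n → Prop) (s : ℕ) : Prop :=
  ∃ v : Fin (s + 1) → Fin n, Function.Injective v ∧
    (∀ i : Fin s, E (v i.castSucc) (v i.succ)) ∧ E (v 0) (v (Fin.last s))

/-- The graph is homomorphic to the directed cycle `C_k`. -/
def HomToCycle {n : ℕ} (E : Fin n → Fin n → Prop) (k : ℕ) : Prop :=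
  ∃ f : Fin n → ZMod k, ∀ u v, E u v → f v = f u + 1

/-- The relation of an ordered pair of vertices in an oriented graph: no arc, an arc from the first
to the second, or an arc from the second to the first. -/
inductive ArcType
  | o
  | f
  | b

/-- Ternary decision trees branching on relations, with packed coefficient vectors as leaves. -/
inductive FlagTree
  | nil
  | leaf (w : ℕ)
  | node (o f b : FlagTree)

namespace FlagTree

/-- The branch of a tree selected by a relation. -/
noncomputable def sel (t : FlagTree) (d : ArcType) : FlagTree :=
  FlagTree.rec nil (fun _ => nil) (fun o f b _ _ _ => ArcType.rec o f b d) t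

/-- The branch selected by four successive relations. -/
noncomputable def sel4 (t : FlagTree) (d₀ d₁ d₂ d₃ : ArcType) : FlagTree :=
  sel (sel (sel (sel t d₀) d₁) d₂) d₃

/-- The branch selected by five successive relations. -/
noncomputable def sel5 (t : FlagTree) (d₀ d₁ d₂ d₃ d₄ : ArcType) : FlagTree :=
  sel (sel4 t d₀ d₁ d₂ d₃) d₄

/-- The branch selected by six successive relations. -/
noncomputable def sel6 (t : FlagTree) (d₀ d₁ d₂ d₃ d₄ d₅ : ArcType) : FlagTree :=
  sel (sel (sel4 t d₀ d₁ d₂ d₃) d₄) d₅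

end FlagTree

/-- The packed digit, in base `2 ^ 21` with offset `2 ^ 20`, recording at position `11 + i` that
the `i`-th root sends no arc to the new vertex. -/
def rootNoArc (i : ℕ) : ℕ := 1028567 * 2097152 ^ (11 + i)

/-- The packed digit recording at position `11 + i` that the `i`-th root sends an arc to the new
vertex. -/
def rootArc (i : ℕ) : ℕ := 1128567 * 2097152 ^ (11 + i)

/-- A tree of depth one branching on the relation of the root `3` to the new vertex. -/
def flagTree1 (s a₀ a₁ a₂ : ℕ) : FlagTree :=
  .node (.leaf (a₀ + (s + rootNoArc 3))) (.leaf (a₁ + (s + rootArc 3)))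
    (.leaf (a₂ + (s + rootNoArc 3)))

/-- A tree of depth two branching on the relations of the last two roots to the new vertex. -/
def flagTree2
    (s a₀ a₁ a₂ a₃ a₄ a₅ a₆ a₇ a₈ : ℕ) : FlagTree :=
  .node (flagTree1 (s + rootNoArc 2) a₀ a₁ a₂) (flagTree1 (s + rootArc 2) a₃ a₄ a₅) (flagTree1 (s
  + rootNoArc 2) a₆ a₇ a₈)

/-- A tree of depth three branching on the relations of the last three roots to the new vertex. -/
def flagTree3
    (s a₀ a₁ a₂ a₃ a₄ a₅ a₆ a₇ a₈ a₉ a₁₀ a₁₁ a₁₂ a₁₃ a₁₄ a₁₅ a₁₆ a₁₇ a₁₈ a₁₉ a₂₀ a₂₁ a₂₂ a₂₃ a₂₄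
    a₂₅ a₂₆ : ℕ) : FlagTree :=
  .node (flagTree2 (s + rootNoArc 1) a₀ a₁ a₂ a₃ a₄ a₅ a₆ a₇ a₈) (flagTree2 (s + rootArc 1) a₉
  a₁₀ a₁₁ a₁₂ a₁₃ a₁₄ a₁₅ a₁₆ a₁₇) (flagTree2 (s + rootNoArc 1) a₁₈ a₁₉ a₂₀ a₂₁ a₂₂ a₂₃ a₂₄ a₂₅
  a₂₆)

/-- A tree of depth four branching on the relations of the four roots to the new vertex. -/
def flagTree4
    (a₀ a₁ a₂ a₃ a₄ a₅ a₆ a₇ a₈ a₉ a₁₀ a₁₁ a₁₂ a₁₃ a₁₄ a₁₅ a₁₆ a₁₇ a₁₈ a₁₉ a₂₀ a₂₁ a₂₂ a₂₃ a₂₄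
    a₂₅ a₂₆ a₂₇ a₂₈ a₂₉ a₃₀ a₃₁ a₃₂ a₃₃ a₃₄ a₃₅ a₃₆ a₃₇ a₃₈ a₃₉ a₄₀ a₄₁ a₄₂ a₄₃ a₄₄ a₄₅ a₄₆ a₄₇
    a₄₈ a₄₉ a₅₀ a₅₁ a₅₂ a₅₃ a₅₄ a₅₅ a₅₆ a₅₇ a₅₈ a₅₉ a₆₀ a₆₁ a₆₂ a₆₃ a₆₄ a₆₅ a₆₆ a₆₇ a₆₈ a₆₉ a₇₀
    a₇₁ a₇₂ a₇₃ a₇₄ a₇₅ a₇₆ a₇₇ a₇₈ a₇₉ a₈₀ : ℕ) : FlagTree :=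
  .node (flagTree3 (rootNoArc 0) a₀ a₁ a₂ a₃ a₄ a₅ a₆ a₇ a₈ a₉ a₁₀ a₁₁ a₁₂ a₁₃ a₁₄ a₁₅ a₁₆ a₁₇
  a₁₈ a₁₉ a₂₀ a₂₁ a₂₂ a₂₃ a₂₄ a₂₅ a₂₆) (flagTree3 (rootArc 0) a₂₇ a₂₈ a₂₉ a₃₀ a₃₁ a₃₂ a₃₃ a₃₄ a₃₅
  a₃₆ a₃₇ a₃₈ a₃₉ a₄₀ a₄₁ a₄₂ a₄₃ a₄₄ a₄₅ a₄₆ a₄₇ a₄₈ a₄₉ a₅₀ a₅₁ a₅₂ a₅₃) (flagTree3 (rootNoArc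
  0) a₅₄ a₅₅ a₅₆ a₅₇ a₅₈ a₅₉ a₆₀ a₆₁ a₆₂ a₆₃ a₆₄ a₆₅ a₆₆ a₆₇ a₆₈ a₆₉ a₇₀ a₇₁ a₇₂ a₇₃ a₇₄ a₇₅ a₇₆
  a₇₇ a₇₈ a₇₉ a₈₀)

/-- The packed zero vector on the first eleven coordinates. -/
def zeroVec : ℕ := 1725437409450311926507244009382966281595691974875088930760374193487872

/-- The coefficient vectors attached to a base with relations `o f f o o o`. -/
def baseoffooo : FlagTree :=
  flagTree4
    1704296006018316361638667898117070462716182333474956434874712993038336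
    1674362586650439569724377058410370245717200577931186725411508244709376
    1691347491536288500931919512827925651183964635946758132593308094955520
    1761339073000968636172665944991092426921656977479833654426673368530944
    1717576803037717540555941199868906324667571959764383994182908641280000
    2002440015838732898201490486397819527925912558525674231488548703305728
    1724558742164094302542683281058838672235553811543172485863827125043200
    1716966453249073639901077732638279967121485967951984706331209880305664
    1663543425786552051361754769459130487397735301546170660228711742177280
    1684559849063693609130678499125206816128141557508179121740994487255040
    1725437390685700926275762261407815088521216449124097563769393413884248
    1668206728058590475513944524428392708077003168748790581640776708442459
    1844673974370141492740714763383848349570415099119780262403204201835475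
    1725437338056126063649624822666834441052410531110361261677471616464171
    2184615402011960699665638519268565941541011106107871598176074103436589
    1726036529340746575261739198495193714280525921899613330259731415041084
    1725437619845423255475934330770769768066718671595475735768571164233108
    1588585829222732893485379516620476089105299357484251969017141613481367
    1777379576496203192538032491792101643496650921869452840388945796666661
    1536571462263769294424975191507012975661583768607675615384976552282485
    1836676851782001778749343784021364584222241768278336213661451490953376 zeroVec zeroVec
    zeroVec 1725437409450311926507244009382966281595691974869038366396139866957944
    1544168845581186508564728207613702500264522135156799481508825425435848
    1659878902531205093818965861586668097187143456604751596719475918904307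
    1725437409450311926501325391607276254213928395245528020471901622108160
    1725437409450311926506962663181541619254138360165775972047062282794664
    1725437409450311926500213208842735134976613725906112781240495754000038
    1725437409450311926506781402724567962349243957900044732427582754001965
    1725437409450311926507244009382966281595691974752298199913573643193045
    1725437409450311926525329735333013028718492310075542493530628300032723
    1725437409450311926498119971695420256566056617163868692349461984181188
    1725437409450311926500194654622729957498159968018615321192059917824620
    1725437409450311926494121715690266098204256961308480293677406023135850
    1739751667360917841283894625438098313246671712846436097194712177311744
    1684064452601797705614394480985065954481050980165078572620239529312255
    1693121339486618750138298730761925930067345080456076284221442766143488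
    1722006501119282450594174583491300239664392571211794377615419276001280
    1663321193587470497653519105128314485480490230878719370924496285335552
    1881576014998142798756650636993625698788581926192153784184412597911552
    1725437473373962086534430903000207346508863881555438400082805261336576
    1697605453966348895998374846874240486402561144294316795836311387766783
    1573952332363045580685137432016450851960525165096339831264864457719808
    1777290549060617771301953985348090790546843218140509689111778914467015
    1555246164095694227986792494747301396766927754427429300837003736033215
    1760095026436611168159057297952203113342885920753836044441943404521191 zeroVec zeroVec
    zeroVec 1753700816149642312732424648767184277085057006478249084074138065177566
    1720965323038370021932098325766530095664187339192239675405996896728790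
    1562665927129232871994935653110473132550833679344420136936345082869246
    1725437409450311926499878162446872410894535293308754088202815197407963
    1725437409450311926508657341410668358367909942589023911476880638817931
    1725437409450311926515267817505397599802016526371052441569557109274464 zeroVec zeroVec
    zeroVec 1725437409450311926492025445641604219628952603874645645056136153388936
    1725437409450311926499210032120724433425214883155548041575855484379960
    1725437409450311926505316868185890059266293024276106960297511248454669
    1725437627436008529006921427360399688215262166892139147294945592738617
    1725437685447413492008255388536851362469988581037812068908170570979392
    1725437506585322730756220590305715957438943484011736100821920226662680 zeroVec zeroVec
    zeroVec 1725437409450311926505534880270950894638124677508207811172387471225889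
    1725437409450311926495367167708113636445465448345883740271471127251241
    1725437409450311926501306302169386312000519240775150629751449172494849
    1695117414266754656161058438488988269151094434127842673442445977452544
    1535240189886965624917746315797959645157936273829327117465670653050880
    1807727494590038990785026075321616566377348559120315269755875366010881 zeroVec zeroVec
    zeroVec 1690143040553836385688765506553854151435914775281452345101461188771840
    1705467659013951220453467734960747238703144769894718954930027149393920
    1671912418784904867565197662121592210485571848008068716123651998482432

/-- The coefficient vectors attached to a base with relations `f o f o o o`. -/
def basefofooo : FlagTree :=
  flagTree4
    1745675553531776638463041328058391065757488993248979208662867386563390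
    1690067234430920386099072035799559123414988952276531711387560997550910
    1599923258331522293229789425045039257127123831252156365021298622985621
    1944594053664621921482830915988620106632268433605604781161914179779390
    1725437409450339272348695754243993760410601005379952585994550230658986
    2473432770567258986309607344780537743734833122039061237919351827303907
    1725437409450311926500936466611013880146340012318853068288759650334344
    1725437448646869775930201693476962152608109464560689683523032490969870
    1633118030335394584892809067559463511947964601710963674352761596564014
    1714771366591296233242004113919800275944210097602452958345828739578686
    1578987455854003129491014382566207228336401647616287237746548471220188
    1873361744975636474558722380724133186966416130545390124392069511264748
    1834828985625039916662838414655476718834641284595547198829857808028297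
    1725437409450313606789830442172727728699329409454811494657760829608851
    2563300356460792250202650722587323543191469855067382478099840091777414
    1725437611738546364229188310041554654919652775095633876603513154310711
    1725437409450309762837413534778875643559740350746843055986666980225883
    1832543556110863810103399072580677469157623260451661029354450317242933
    1725437507040412606563969844737984444205281746018409019531535703874441
    1833051922139198894236062168295247641547764225165759291523101231178330
    1667920463899540711761476006000486193200402094589648307289506639253791 zeroVec zeroVec
    zeroVec 1725437563242442994348616063741725044895123002590848494117485018104441
    1725437602218606206797021937029891494775012181595454649027395627015633
    1645464293219743538421866397481562121621170208629343522248226822445406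
    1627103780488579030257118599687795502619929032850476822706312694463294
    1725437409450290373917978487037339882039906087775352027213782506800984
    1599694533198064328817504131296783094790964811080839758657236098861859
    1725437409450311926507244009382966281595691974875088951114529294488563
    1661353244917590220127457577526130949168177749674720788756069853680761
    2573578143810584898320818067345755773212563083295989419936538950564903
    1725437409450311926504618944064156844884455522405778948673543976540540
    1745435344577196205614128969152695836745115281794037673000388072061469
    1425197095903354419235473500003520483414768459157620968800676161276593
    1590274048709593190869891369208316232572060651376138585885478241675645
    1725437409450289119037596635428152642319220281589560559829627224162869
    1999966807775548509253764860075670927664688803784015172014471990197689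
    1725437409450283590679659175864243681641565698345298576616392192088445
    1650045263098305550530781692786196001353483024138510446359897044870817
    2796157219615706674749719031762034140768017153875324684573427052217864
    1685321758339929051965485484748223822236149517756509157063143789159274
    1668218412781463068647159946828924853533149713345202135110727031034025
    1828044528411224403675973164144438257005830985254883258466865941321974
    1866533014671259021961088078689594789978899128709327416350373636495661
    1725437409450382506981195827157303442331760522256911133053940587867160
    1605310640252228184637198300906527385891024579537445461184864284845137 zeroVec zeroVec
    zeroVec 1725437409450350564775554742099834329656199992350601986041778778710802
    1792332343896162659233792092874291357570160413703308904930273863453315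
    1403905874275387551522289386579564820353428991210269545487916982112133
    1725437552379133803551306213763621608764290392915115813731028282901404
    1725437409450371128134316348984774653861338032517027822125289086884893
    1522209444604070379679344512758086328293297142260650893535851079289808 zeroVec zeroVec
    zeroVec 1725437409450311926501155192319921068498112194643671200243037982733204
    1930953162317202865568859154640993957144103525818873268799849016336538
    1571095755647706120060610366292310765384628091750195566367185753414934 zeroVec zeroVec
    zeroVec zeroVec zeroVec zeroVec zeroVec zeroVec zeroVec
    1725437409450311926502568345941661557025345030039172370558289158625987
    1725437409450407697012512787087840516021812086363766793026608686971413
    1640746678364174711926151984003359117837131836120241363777320647695925 zeroVec zeroVec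
    zeroVec 1729074094372294529472161245506064293909429246398138440570895592388193
    2018739128984647124091172497553527755436885595365164285871958675991096
    1505311757851412589657818992274866325978919463994348402761367156775713

/-- The coefficient vectors attached to a base with relations `f f o o o o`. -/
def baseffoooo : FlagTree :=
  flagTree4
    1713101061784084253044224435371800298874345770871746429324662154461184
    1696920815471937408764249734387767284736428343507086001131965899603968
    1752644181801060747208234269847369514845080611011041521456388280156160
    1725437409450312515410559762046311754261270133397748934117338427424768
    1725437409450311926504628934798005786603551961643904037443477330471688
    1725437409450311926505549509559801130726913397389096877295292038127311
    1725437409450302077155409708962019923322875302649619022418522168871797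
    1725437409450311926495800515788811483514391190985910205562208857791266
    1686847036572015002402097015184675286850308333527791850336008690197509
    1725437409450311926507244009382966281595688899367803861877255830503424
    1725437409450311926507244009382966281595621006076120806750034536158456
    1725437409450311926507244009382966281595699847393726664193618830549297
    1725437409450311926507244009382966281595657815467129878357926864748544
    1634714161186966824010328757576128559263204394509472242024027752759296
    1952809938171770501805071851887429175258921994988529314366079395430400
    1725437409450311926507244009382966281595687506763501545357540513010923
    1640917713368034692306522808694241598056981600010066858012725304261009
    1922050521481787768275805971679374900440027853934374218205722043338412
    1725437409450311926507244009382966281595699944004038537391613422875787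
    1725437409450311926507244009382966281595731395453219600315501308372190
    1725437409450306154955434097956811731824950648799258558419608091499515
    1725437409450311926507244009382966281595687506607017815380262386674453
    1725437409450449543177719464750471691557292956270584501307567259092591
    1725437409450376327224892502821640335707367514771302745673804530200916
    1725437409450311926507244009382966281595756212357440009777673250275328
    1669901630640725735868601923618976717626562340607415122656471391666176
    1693093371871611839749218169531602376406195292256980188068813137248256
    1715702604489203520010636676971539500211872092270406379779777075609600
    1675075096968931100784445641488232365913829011756388926723082037493760
    1770208297445905889231854048209365388124076721967860783441484360712192
    1630391420714862187397563754254852332047145634796492347418433104641337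
    1725437409450311926500431934551642323328216910103764393473175953877057
    1725437409450311926497779573120709885134367309505929163243628075555849
    1725437409450311926507244009382966281595685127544509424810222561525334
    1725437409450311926497106090615714260315509449544766078149547971759620
    1764518142686690570009117099411588923121338348269220432713113295394535
    1725437409450313124891818568328770315234700774532517636425272641192647
    1725437409450311926507244009382966281595522976683626353210220983867327
    1725437409450311926507244009382966281595635068296974770459484850611192
    1725437409450311926500590180639571096630098030570772550444229564825600
    1667861204989626738602635014022972989214904177135026973100637812686848
    1963281929174593281904596356150044926281041889514348922751591386185728
    1725437409450311926500981603319295706127526158280981796892740198337171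
    1609078845688410751881217847398661324597294281833509314983776375189305
    1828008290526326187905568672857624797951780502830442447963145599321173
    1725437409450348435519665321256696410380575099947630647422103260758442
    1725437409450311926507244009382966281595651587091102465496446212846076
    1725437409450312513539837666262756018960579486119734037488631045679385
    1725437409450311926507244009382966281595639652587798238674675066467693
    1725437409450408987426606062545447771035023170187985694425726344843463
    1725437409450369949197911251304363515681444046915993311509056391609259
    1673418073879707175530441156418458770985619009301816425882681550569472
    1642591191502877468480378811202782975399911300674104492862503115554816
    1682552269677393462300146200978044747889561362168845344669685106343936
    1725437409450311926507244009382966281595645010524848540251901031088128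
    1771967341817791845402886168899498565295003163610298765612731734163456
    1722432718128646490966901168155792046003063407474698661281995468832768 zeroVec zeroVec
    zeroVec 1725437409450311926507244009382966281595771976862247031470354229857984
    1725437409450311926519395239426741647533172540221502374241261394484845
    1634417970366646735489856624837381025008829113333773440607697454999376 zeroVec zeroVec
    zeroVec zeroVec zeroVec zeroVec zeroVec zeroVec zeroVec
    1725437409450354315947501207285794754653177994357631567806807237751104
    1725437409450311926507244009382966281595812557894979188288039481876883
    1725437409450311926507244009382966281595820875181264762020587994372272 zeroVec zeroVec
    zeroVec 1725437409450311926506661157106457485229516988939693210736673680261120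
    1627190914350940157683644550108768714619649495357447068572390987399168
    1648320838371462527929178101137456556692996517175877607980870151438336

/-- The coefficient vectors attached to a base with relations `f o f o f o`. -/
def basefofofo : FlagTree :=
  flagTree4
    1725437409450311926507244009382966281595691974878603035506386400183214
    1725437409450311926507244009382966281595691974878603035506386400183214
    1725437409450311926507244009382966281595691974854954420632609677648573
    1725437487150631120274348509428806183093889748299597110373879613752238
    1725437409450329938193726632614296903955124114271258057669894003025999
    1725437409450311926507244009382966281595691974879368698196548171922628
    1725437526490796971376523526578657445692137094593435432759954846524093
    1725437409450299999905594550901731445407170375659191154101058473622724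
    1725437409450310820910485401301526718872189721645381457932969535613628
    1725437440630246834103642846027940087924534026863491052893150653711278
    1725437379067572072014709980725047810531326804262230890245133364614634
    1725437409450311926507244009382966281595691974854142674978038751414580
    1725437497390153326123871505435937679701395589563410060315197000635882
    1725437409450325582030254391026411682706482241450050620566903131770054
    1725437409450318129447569208497073391711747425308994623254016467957111
    1725437546219727725696861167314543602833832640402327026886457024301364
    1725437409450311926507244009382966281595691974875411690489958271841655
    1725437409450291471657704292827845356500398680288850369117384675915690
    1725437511457148225459105608781736376218648715692287308456085569927006 zeroVec
    1725437465318091828394097767653769354863953640140639316565339516444223 zeroVec zeroVec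
    zeroVec 1725437618324010722366739766400777233542395803870727498433264595508799 zeroVec
    1725437409450332542613028382480591589612754972017368399329571372019216
    1725437409450311926506907535739410851553732483961305317027984167666606
    1725437409450281671318788901936059263106348588731015273375857189573721
    1725437409450318314274912271912380039422546109933309035280599786447695
    1725437409450311926507244009382966281595691974900969725907503093371993
    1725437456978998824125030085158431204053810968925033799526588867447203
    1725437264825887943222154775375392688268019812784736171694457093131776
    1725437409450311926507244009382966281595691974867710044929692785435471
    1725437909249583282840246190010216029866197674146982239175101826240000
    1725437415350008337668148659020458174069997266190201930407296369667039
    1725437352705309223749873269460973321392478948863078502590533975681474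
    1725437409450298855023671931365621441368619819085755475020522179251368
    1725437409450294376514974625533191131453113229894456076783771850878938
    1725437409450311926507244009382966281595691974933399126389414717017256
    1725437367814285068318967488856109575720747895863158077186178693485614
    1725437229185291566260572036596018737043670987521207624571190972001478
    1725437409450311926507244009382966281595691974902482246423886978592730
    1725437811477492859667216885487333048743400052147629515064523048889542
    1725437442875075653253365062692421173517710468369704288810130035646177
    1725437550840485849815323328618114268407662301089691715698940506534841 zeroVec
    1725437409450344993765153498670854604122207251112750079793021993343788 zeroVec zeroVec
    zeroVec 1725437409450311926507244009382966281595691974873502355756562657565484 zeroVec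
    1725437409450354538563430605528927255438371711958181596117541181172622
    1725437409450311926512805280017595054272235586156967349942976479457002 zeroVec
    1725437409450330022750365362031016139547513795880243514431671104404523 zeroVec zeroVec
    zeroVec 1725437409450311926507244009382966281595691974834275299376268508625963 zeroVec
    1725437482348666968127325197328141999888247237351125855836703321715292 zeroVec zeroVec
    zeroVec zeroVec zeroVec zeroVec zeroVec zeroVec zeroVec
    1725437409450311926511513620855696160579877837327397385963847531092457 zeroVec
    1725437409450337151698127974005212223518279255327393973426262283120381 zeroVec zeroVec
    zeroVec 1725437409450311926507244009382966281595691974810921754566677123559165 zeroVec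
    1725437373272261018064407114794017693756202696157857817596186613247232

/-- The coefficient vectors attached to a base with relations `f f o f o o`. -/
def baseffofoo : FlagTree :=
  flagTree4
    1725437409450311926507244009382966281595691974875088921489292148080640
    1725437409450311926507244009382966281595691974875088921489292148080640
    1725437409450311926507244009382966281595691974875088931662019850925593
    1725437409450311926507244009382966281595691974875088921489292148080640
    1725437409450311926502310906139089719511799141707432934919870448929535
    1725437409450311926507244009382966281595691974875088936834090742571694
    1725437409450311926507244009382966281595691974875088931661955271249754
    1725437409450311926499441603058865975415916590051600909297236829016326
    1725437409450311926504726879670917733100460555282218568924713582611185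
    1725437409450312005077572032292307164225788581702464058192225658470400
    1725437409450311926507244009382966281595691974875088933671883907265391
    1725437409450311926507244009382966281595691974875088936834093947033212
    1725437409450311926507244009382966281595691974875088933671873681555857
    1725437409450292580618414707044520237374198313785651883407861007515648
    1725437409450253327634171266126402574889212651492606642049576176977058
    1725437409450311926507244009382966281595691974875088936834082899240385
    1725437409450311926507244009382966281595691974875088954193174642809565
    1725437409450311926507244009382966281595691974875088945128818330321340
    1725437409450332296800144996521367971098595587810514254477255458667149
    1725437409450311926507244009382966281595691974875088936834055634155409
    1725437409450311926507244009382966281595691974875088934784606667778655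
    1725437409450311926507244009382966281595691974875088936834078117714046
    1725437409450366613329032309571047124548450092813149681244072597004417
    1725437409450311926507244009382966281595691974875088945128809614521573
    1725437409450311926507244009382966281595691974875088934784536979442351
    1725437409450311926494559523920003651397771590607352738291038876076383
    1725437409450318553351677343099802281295694636443888588180895338332160
    1725437409450310289251058650293582793980797431711422095831257737854976
    1725437409450283545780530366560134936729249064693831633105982915084364
    1725437409450311926507244009382966281595691974875088930061129715021403
    1725437409450311926507244009382966281595691974875088914360059307228574
    1725437409450311926500312045745455022698377012207218902727296839321833
    1725437409450311926491217445041571058091288481724140547217525903974542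
    1725437409450311926507244009382966281595691974875088930061066823552327
    1725437409450311926507244009382966281595691974875088928103933982805823
    1725437409450311926503607382261951495818755462224931617970936735615265
    1725437409450306333048177616551317732453100203116716087175031106306582
    1725437409450311926507244009382966281595691974875088919417814609032657
    1725437409450311926507244009382966281595691974875088928103971249199316
    1725437409450311926507244009382966281595691974875088919417806323188037
    1725437409450290836355915156175274459207510924285983407868100457005056
    1725437409450217687004110300531183224866692653275476176940550774064281
    1725437409450311926507244009382966281595691974875088928103961887516100
    1725437409450311926507244009382966281595691974875088938333818852465452
    1725437409450311926498980066836237185639379366826230176766860985385473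
    1725437409450329316739846413317081637057074286000785853643674822360158
    1725437409450311926507244009382966281595691974875088928103932649011630
    1725437409450311926507244009382966281595691974875088931578430278839410
    1725437409450311926507244009382966281595691974875088928103957070338029
    1725437409450352143665003583420874923460998472405473792310137246982204
    1725437409450311926507244009382966281595691974875088934793400386827414
    1725437409450311926507244009382966281595691974875088931578362278709869
    1725437409450311926507244009382966281595691974875088934793339009501545
    1725437409450292680889342940524900896948948335395854653502618451574784
    1725437409450311926507244009382966281595691974875088921863126101524480 zeroVec
    1725437409450311926507244009382966281595691974875088943835793457150517 zeroVec zeroVec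
    zeroVec 1725437409450311926507244009382966281595691974875088943835755672776301 zeroVec
    1725437409450311926505722384936580140117498709745909615747284509666849 zeroVec zeroVec
    zeroVec zeroVec zeroVec zeroVec zeroVec zeroVec zeroVec
    1725437409450336239908178489100146837949015299018640770042565709780830 zeroVec
    1725437409450311926507244009382966281595691974875088958749554450090828 zeroVec zeroVec
    zeroVec 1725437409450311926507244009382966281595691974875088958749511557056148 zeroVec
    1725437409450311926505380737520138650970970382541972650708303629778944

/-- The coefficient vectors attached to a base with relations `f o o o f f`. -/
def basefoooff : FlagTree :=
  flagTree4
    1725437409450311926507244009382966281595663656993517421789354549836964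
    1725437409450291198532278308428708002595748824405851000459738316012708
    1725437409450299477974129827289681296507216358220583503020617796440402
    1725437409450311926507244009382966281595663656993517421789354549836964
    1779204277842489650886106543919563196984346945564891107802195709340591
    1844162153556097173682457681467803723942515522038366028049409463315737
    1725437409450311926507244009382966281595759017071281305472635784623523 zeroVec
    1725437302467313137161273746043168720833815788168539160107773378660391
    1725437409450311926507244009382966281595663656993517421789354549836964
    1725437409450311926507244009382966281595648414887921869387976269592106
    1725437409450311926507244009382966281595759036336461424556584492608668
    1725437409450311926507244009382966281595679498725452617367807039921002
    1508146906311544585571968693910642290398512372497301948354901050328060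
    2004572575031494713468202206666082434508498239452846817942728397072169
    1725437409450311926507244009382966281595750409453092582140076465556895 zeroVec
    2563321649914392419026580685032558077182523972443231555502146958883693
    1963973041088708596790112652024844925499031034173591000052958743227489 zeroVec
    1725437409450311926507244009382966281595735360585276389507955220821582
    1725437409450311926507244009382966281595681104071894426737400165168264 zeroVec
    2175334810467502870488725801102517377645373286715069396724151326104123
    1725437409450297644292331540248349554745002599730032451923163378309662 zeroVec
    1954606753619969149415511683868862797755966040604540643789860842201568
    1725437409450311926507244009382966281595663656993517421789354549836964
    1686055548879943502300349131936821211959906868365876110077353530477518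
    1836587951288244752242727867726350193506283786586555299300495821071575
    1636940463359308445725083315544180743925331849361822684043129740323505
    1508701382591316028963749720900302507691162527065212270883698396555496
    1815133754714594310519644348914683108810646182806819418189909032136363
    1995467987361509314445940601751923333832348736225834134327689714156479 zeroVec
    2022120139044141955781801521233632608992909014424843119074830302865864
    1722291170718759353166984640637787106170007346632714220103719015445669
    1516520859843662838876070245727893978696609047201921109902027161320790
    1909483702913426787814929615830504988623502237701496040806640404903970
    1551112575866883846747815054001115535005272634836979221159430329516409
    1267809467504972801117278815630010839279141177125102950524656206952758
    1844300374604252005302868163710008591525515590256814010082037670617277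
    2404846559424707799305974256609026831107282776749352261682706359899068 zeroVec
    2282493351250306950905316344080364803651961445874116445138789627647247
    2013293779834038522430577731362412676029315914380706805041345072177290 zeroVec
    1725437409450309727286348206234843862073353020209986117554149557992956
    2231466234247967767117708020796809849646461248185711125573418626291391 zeroVec
    2150010294857752072432854615837223213810149270454200962526488610934775
    2015404894963479242743652694520598364191037914555265809748041458048099 zeroVec
    2032205398492431114720146968798002084261731469777130941463194911111082
    1725437409450311926507244009382966281595627486079295618349855790844706 zeroVec
    2128873989291538617892588578716464691654763929610975437617865025397317
    2351086244878517565074397046016295982826142989618774129242986616270608 zeroVec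
    2638927761851237285813066845808283288463879664820919712359587792396793
    1725437288278709302048473849488465789231622262539657484290840956197224 zeroVec
    1989198481376637469596639543159086587435371553543825609159109682097761 zeroVec zeroVec
    zeroVec zeroVec zeroVec zeroVec zeroVec zeroVec zeroVec
    1725437409450311926513410968257187145996687199367824354849596315264577 zeroVec
    2036339029530352389255077876592649354670502024418612968273326235464354
    2506069742357257943353519010067655525649252032895408606485720702472789 zeroVec
    2463574530821892471330480881657254443470682254448384792560517868796541
    1983189168533143314239441042835910337529530505111902177001457281100101 zeroVec
    1860320957794823876859632216811708966789697040504642246458455943508860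

/-- The coefficient vectors attached to a base with relations `f o o f o f`. -/
def basefoofof : FlagTree :=
  flagTree4
    1725437409450311926507244009382966238272479007622088410671441582743688
    1725437409450311926497664858087408600285771189052381942876716730933384
    1725437409450311926503401680188240325450444725842582958536403050295646
    1725437409450311926507244009382966238272479007622088410671441582743688
    1804003658320887479300907901815565988887157132104099023412195216076514
    1711736878578544462280134065961668308101414256381258613382051336775516
    1725437409450311926507244009382966196003917567295056788688906371480388 zeroVec
    1725437396659932502939958617972065831805577515152962285730048234266860
    1725437409450311926507244009382966238272479007622088410671441582743688
    1725437409450311926507244009382966151463666404551158042487248628176910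
    1725437409450311926507244009382966281879586036766156790217950274562677
    1725437409450311926507244009382966218963562181455081578372504199618548
    1694951146516821942164238895337726151718138658702532359286079810938324
    2134198842039030040645002058991220316425447605311810840806289564508127
    1725437409450254602718351752197991719470965490538932852003798594483886 zeroVec
    2492528823738953229457315868755714570379940824310746673851168980145516
    1725437409450311926507244009382966294819852089358415883327264422590972
    1749400892318580650099146825588548914732805096457230904170230485938372
    1739128007367224360777973352981843641878683148623802855287215061179664
    1725437409450311926507244009382966281108833697619794863332069427116155
    1531679247825739915043496388136838236025210201830008514946217278553500
    1801801984946474456511571819207088051803524015337503864800158604562829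
    1725437409450285154977475670073549497791679613590174245241892736317387 zeroVec
    1737222519949878064544300107633851231248811737932709274604505951907761
    1725437409450311926507244009382966238272479007622088410671441582743688
    1725437409450311926507244009382966117997796827935688999797137251225735
    1725437409450311926507244009382966478294460310127654540946172804098517
    1725437409450311926507244009382966319483266345413404536850803359498987
    1761128356549096366855690936556394665376760681568151656074614706045251
    1723100792978915813927383953143735179390248977791832000016061371007541
    1725437409450311926507244009382966195841653783584420423832117462402700 zeroVec
    1746773070339488940121257395316551197488975486712485418068946367571114
    1626948982453496258494856527198816981630170149366839653674768596465053
    1725437409450311926482171013947315664071765860169490481779692769598753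
    1725437409450311926483887814515679716853517184633144448332941749204991
    1725437409450311926487833619168126828885229923477733540501881745332076
    1557844295394517014190518839083089469749300924451776534047070583000393
    2086456115803443247620197744677590115260669582899064140707838850830284
    2164477911536095575685058041712525728151596228107596571010378364966666 zeroVec
    2255790187882777094701999249028938113465950522075930829798179303779903
    1725437409450302567284598804253622500189263409239003376649886296399123
    1638750534816066274717199818524050854218224090928461650847539670336473
    1738869563213930351732637007973679619991236277658956124073655601723550
    1619740015395669919684662525642722519318962758162499266345297909923317
    1415909718453458648119841449671677981154287383201888230206433876112148
    1828445898404695706784607146675056235286502594225647055476171637542781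
    1579810281822714582569654284255527553356387238497816213042770920531498 zeroVec
    1609338844973990167558647064873077681537028762689052977467566020613766
    1725437409450311926507244009382966302202607868835003367621090153014152 zeroVec
    1725437409450311926507244009382966442556811550753353003312263484873361
    1725437409450311926507244009382966310680661060091041176118878704329757 zeroVec
    2072653605443639518540175988654215711513826317718674303426351111917859
    1725437409450311926507244009382966364104518246112266309308463595905169 zeroVec
    1823637732972436988423699313003923578834258718086600090385066719456363 zeroVec zeroVec
    zeroVec zeroVec zeroVec zeroVec zeroVec zeroVec zeroVec
    1725437409450301408933477095075911400104087095577890143496537310691170 zeroVec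
    1725437409450311926504363823539085992541719213719790695807831795239080
    1799496516757191286571996258400549932831270839324104141993429772910198 zeroVec
    1926527760750071969795589927834109799835388075065964093372857831996858
    1768556154339518714733568516490771000015917494932998360813053013892989 zeroVec
    1651121454157519358724229384169945980732241645275947857851220159888789

/-- The coefficient vectors attached to a base with relations `f o o f f f`. -/
def basefoofff : FlagTree :=
  flagTree4
    1725437409450311926507244009382966281595691974862517484046352387139403
    1967010699792608434682734528097573713993731791149412493859644167415627
    1924994291653500716845283105974288434983729241470588300488307150678132
    1725437409450311926507244009382966281595691974862517484046352387139403
    1758199396166346592502870535264835434328396048588096636662399944896258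
    1760180592673591870856272601856881879273926976016242604574578855409048
    1725437409450311926507244009382966281595691974878123418440826061035016 zeroVec
    1725437315921496069245700628229703875801462374954678234771246183074328
    1725437409450311926507244009382966281595691974862517484046352387139403
    2034051789175904119713408479571597368805204086471328000158987537351145
    2232718490894965288800904373889293967323284735690205887607030336738363
    1725437409450311926507244009382966281595691974865644225229606737658247
    1705614016048263357317403095640697880062164955910803233261310377468891
    1725437409450311926507244009382966281595691974838130858667785290038170
    1725437409450221465121291461448407786024178679944371181362439940746524 zeroVec
    2679043186855649520600771591341553263495022250536179463749261377719539
    1725437409450311926507244009382966281595691974926269416180722137278547 zeroVec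
    1933226788435161861892447052848760831313396911814481757188707144696896
    1725437409450311926507244009382966281595691974912803287566492999097707 zeroVec
    2106890048405727305169398190437498488908264889598167511087161392825980
    1725437409450311926507244009382966281595691974932209250180269524072966 zeroVec
    1929901223724815704481251860130812425942826802657116096026447455439067
    1725437409450311926507244009382966281595691974862517484046352387139403
    1826150515881156342317338898201388919253160323531275203910522786287554
    1890534172695463171128736377407310372461619829718711289808268500674505
    1725437409450311926507244009382966281595691974852593139613715498248142
    1571976008929978929809829428448485216150497045309608444209740458760186
    1725437409450311926507244009382966281595691974847944518044301954938223
    1725437409450311926474609277265398155935353737058156712064143296802193 zeroVec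
    1983589006550510392760967113840732342383883096002734394906763494170870
    1725437409450311926507244009382966281595691974844854739697539979707253
    1637708935641961014196369365779769939798172644747161711295485390669449
    2061386912615388711139351504453800154165832505826370219766790298349497
    1532830988172416850372311154467318467749900350386341210075166476869171
    1319241332029696642982778694134736311207342246184473808041525457758461
    2092246703350125892600261119681920626764423523039034913765992338380699
    2393398688387722084942994549891665795587793421903715076026237600194766 zeroVec
    2223236995451481654393787477596203670720599100450041171892528171040762
    1725437409450311926507244009382966281595691974922377142625866706026119 zeroVec
    1725437409450254466529783179155134225965470133349982691312664199567817
    2093026603509227143077725805704440581701344522698629295068188697932833 zeroVec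
    2098326725903881709122567727649338355883927003724966122408265787694215
    1795506206236249555808185319478502156205055444209430829332366743250882 zeroVec
    1993208612762642418065985797033631475353041200575066378867953170904556
    1725437409450311926507244009382966281595691974851818395322732273164735 zeroVec
    1725437409450311926507244009382966281595691974830290988333175659286317
    1725437409450311926497635242697784994941452196847019170205737608565663 zeroVec
    1725437409450311926486893954968441529121592668915076174896856332062257
    1725437409450311926509388270635295398071996917227523889040844821279197 zeroVec
    1725437215423528010268086469297493687706635401978089811360723202167348 zeroVec zeroVec
    zeroVec zeroVec zeroVec zeroVec zeroVec zeroVec zeroVec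
    1725437409450311926507244009382966281595691974966861499881826622065779 zeroVec
    1725437409450311926486625989214135985153923975833756493653483652650150
    2319571365449418048742741097006235325123192416322611684602798706570091 zeroVec
    2457513966942874922722374819224529467121517826309614493560544613763266
    1899882031473800226135112688276108800744868111086899748616065136885640 zeroVec
    1959990824191326274662011902246698365948864025269286117566855328529059

/-- The coefficient vectors attached to a base with relations `f o f o o f`. -/
def basefofoof : FlagTree :=
  flagTree4
    1725437409450311926507244009382966281595691974878898180055883381218817
    1725437409450311926507244009382966281595691974878898180055883381218817
    1725437409450311926507244009382966281595691974867359758776979520751108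
    1725437409450311926507244009382966281595691974878898180055883381218817
    1819976500567739604361912171282724077505591205975228489897325024522766
    2499892483848980229041438100184400739415311627299916694815941673842540
    1725437409450311926507244009382966281595691974873161240278456408726517 zeroVec
    1949591331257721255981678221369293682085450219953741912120581721968901
    1725437409450311926507244009382966281595691974878898180055883381218817
    1725437409450311926507244009382966281595691974858376177682910045824615
    1725437409450311926507244009382966281595691974870052976621228267578862
    1725437409450311926507244009382966281595691974883657442569017642428127
    1725437331824533315847856343407676379498085240131908769416493019431762
    2303067015751276112018201095226947129724797095743648687630733338845235
    1725437409450311926507244009382966281595691974872368040064568225912122 zeroVec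
    1725437626142140933790850657758252960147544325136716711948803489294900
    1725437498361534819674960353639526092942781967455830614655066828733616 zeroVec
    1725437409450311926507244009382966281595691974881416167592903090132078 zeroVec zeroVec
    zeroVec 1725437409450311926507244009382966281595691974861890297738620564416434 zeroVec
    1725437458244577628818683591964995889222585902140705579447682962852990
    1725437409450311926507244009382966281595691974878898180055883381218817
    1725437409450311926507244009382966281595691974851320278529774801899084
    1725437409450311926507244009382966281595691974872340379487810381442180
    1725437409450311926507244009382966281595691974874830660422386419016141
    1725437409450311926507244009382966281595691974845804692085607404430885
    2364778316803208763779531730505923595037341815080419986818463878373816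
    1725437451612819645382655364972484363603686333527663147662015546331487 zeroVec
    2060347025416491396325089642533813112025225960132120089294121280335087
    1586959977386653836790805787981127331141821884914051711971724949952853
    1725437409450311926507244009382966281595691974819361292091161312203270
    1725437409450315804140004149537294412921031180382243836067749030692802
    1725437409450277374644279306265246424420494146766874670830556334237182
    1725437409450311926507244009382966281595691974818595744783693272560316
    2280714398840150401673326148686396475376846383147658798605618211849683
    2068618947838425020180957008354914732643640455635247369609797931369976 zeroVec
    2131024688842951550391735186005624571750270332887843641200460111511923
    2268829211647645742572826940791045471276083119040449338504948852217427 zeroVec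
    1725437409450321507223385355285309050685614884540009448313868164043921 zeroVec zeroVec
    zeroVec 1725437409450272692226873560025240966726879697015069835001236408055487 zeroVec
    2155160947018860036252663800659060003636031732087938727441539185902091
    1725437409450311926507244009382966281595691974881849658104987786465742
    1725437409450311926562568946913212169200109710772407040625073028312114
    1725437409450311926507244009382966281595691974894808517965325804818554 zeroVec zeroVec
    zeroVec 1725437620244803853395064080134528797043941727214687313430478802938697 zeroVec
    2139135476654231706393124224945882160599015502497902681720707703961347 zeroVec zeroVec
    zeroVec zeroVec zeroVec zeroVec zeroVec zeroVec zeroVec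
    1725437409450311926481519296969634060699497428570253627143080786276919 zeroVec
    1725437409450302607318051654021715307545947770836066941202430566604958 zeroVec zeroVec
    zeroVec 1958798014058778405856597186818024093512474905558412437536537922484416 zeroVec
    2059433761097070017484412561508768461302490429573511626965043278525493

/-- The coefficient vectors attached to a base with relations `f f o o f o`. -/
def baseffoofo : FlagTree :=
  flagTree4
    1725437409450311926507244009382966271495066866812787691460419247921951
    1725437409450311926507244009382966271495066866812787691460419247921951
    1725437409450311926507244009382966297253718804126855637878483436164586
    1725437409450311926507244009382966271495066866812787691460419247921951
    1725437409450311926507244009382966243180780525310394468346152908488868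
    1725437409450311926507244009382966237379989250469819795966257733429471
    1725437409450311926507244009382966346499448046126003866006851935045366
    1725437409450311926507244009382966268614972169523644986370756116099333
    1725437409450311926507244009382966338264766129546957003188916076952206
    1725437409450311926507244009382966271495066866812787691460419247921951
    1999341455355947235307767516073282607987609821713262885452182994241979
    1753267828028285484298211003167558692922166265250134627100240617855307
    1725437409450311926507244009382966292304797359556103822878947524240260
    1725437409450311926507244009382966141484771248338500936613848027232164
    1725437409450237281328322473098727362634327871399062125765654660347045
    1725437409450311926507244009382966371649605547731319661506548022154832
    1725437409450279075504808792674120849495711952537460333787244030701306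
    1725437409450255275430017395964634178351663152958462659482570269347145
    1725437409450311926507244009382966287031364015262347027692825739258387 zeroVec
    1764253216452961855835637577430311734616616333012189516925255428330785
    1725437409450311926507244009382966285652168189496362082702150081711013 zeroVec
    1725437409450350263215152901790649849886647590726091244012662630255017
    1725437409450316284915582765911118445971308861859713712748872432928759 zeroVec
    1725437409450345669844118914847897475056612386437640210366091387497426
    1725437409450311926507244009382966271495066866812787691460419247921951
    1725437409450311926507244009382966339887413792625386334629048110574309
    1725437409450311926507244009382966313114493673476106077593504966403469
    1476602545782911129750252920753444009949183173775690507240601392494966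
    1725437409450311926507244009382966320619055015688379454151001386282689
    1725437409450311926480457424686260807279554592517150241194233746708184
    1725437356021975868046587352899165208466532947434956663492197632472513
    1725437409450311926520077107011931986554893214553881161951563400523669
    1725437409450311926498195437417172168001655158401798559025659644918011
    1725437409450311926507244009382966275227057545901200341689684838053032
    1725437409450284336723630974346270859125877692360788412464195380966154
    1963650430305747183126459294472456696965867088189717108568280003347063
    1725437409450311926485232638654131815347629271624882126969322127514467
    1725437409450311926507244009382966222695601237012201913495856597729097
    2153857474323408445450896458067345156280201137520533962146150425295911
    1321615781542672072889683269616013147940708855469941874308999925505699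
    1365648282614001956306624374890239066228258965048677979397318822217492
    1633448782534866186358981661089231374049159001627446735593580260091200
    1725437409450311926507244009382966401424082418037893296943106746208889 zeroVec
    1725437409450320949748200811785700173284452147820724367443996405812522
    1725437409450311926507111096941583166576890584613595043268480019190369 zeroVec
    2157877456148803156005513473895135784136345638193595821533376015261704
    1572907295514641681287710718096457511593611841003275130401486005116711 zeroVec
    1819854616050360411726467529680133457596299849440054750517084300432038
    1725437409450311926507244009382966202250896050047002688469705279118235 zeroVec
    1725437409450311926507244009382966211053515320322915160110126630702725 zeroVec zeroVec
    zeroVec 1725437336012929448784619083077106843535229440846034714215936485692386 zeroVec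
    1725437409450311926466978854288268864091795276751207288838539908693913 zeroVec zeroVec
    zeroVec zeroVec zeroVec zeroVec zeroVec zeroVec zeroVec
    1725437409450311926507244009382966186836291889306037613709344583409872 zeroVec
    1868931988866958363556715368143230127174572533326376221727840179045374 zeroVec zeroVec
    zeroVec 1725437409450311926505516682862868829962927680170262572838910971284260 zeroVec
    1724231117648929692888837493022867812438046076750742920046429437110048

/-- The coefficient vectors attached to a base with relations `f f f o f o`. -/
def basefffofo : FlagTree :=
  flagTree4
    1725437409450311926507244009382966281595691974875088937709275175700998
    1725437409450311926507244009382966281595691974875088937709275175700998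
    1725437409450311926507244009382966281595691974875088925394712449252626
    1725437409450311926507244009382966281595691974875088937709275175700998
    1725437409450311926507244009382966281595691974875088924743854025860363
    1725437409450311926507244009382966281595691974875088912279722955583357
    1725437409450311926507244009382966281595691974875088937995188365657222
    1725437409450311926507244009382966281595691974875088931771956694286829
    1725437409450311926507244009382966281595691974875088926529450358611146
    1725437409450311926507244009382966281595691974875088937709275175700998
    1950644306547186816612597267538036876311600797796054681012492657759896
    1538081906058276727753521373226168910448862651949915152804590696553595
    1725437409450311926507244009382966281595691974875088939626854569983063
    1725437409450318400328128677955943863255509060275431740431747857261550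
    1725437409450224725789904412186054415173187863275846121065311460360504
    1725437409450311926507244009382966281595691974875088934555918894330159
    1725437409450260418419203124116061658725359759075528479589022793939751
    1725437409450275383821824973405232917397903456638281292658611458173148
    1725437409450311926485510773548247865751862057561042923443033255966460 zeroVec
    1816562160825667317816473663238405255661438765775164058118508099163905 zeroVec zeroVec
    zeroVec 1725437409450304850687988917661753080165277554306905185171703092720735 zeroVec
    1725437409450348093551666212022707997409590049041969702143877757041052
    1725437409450311926507244009382966281595691974875088937709275175700998
    1725437409450311926507244009382966281595691974875088939917110651379092
    1725437409450311926507244009382966281595691974875088925526605845001263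
    1725437409450311926507244009382966281595691974875088933548703465063625
    1725437409450347189618749529408576700103335753351787181135912762340188
    2109470089302050524527868748222240858120388617345308521944462855741789
    1725437409450311926507244009382966281595691974875088940480095872601702
    1377902330060049629217305154501713654431565193477151086691913701482331
    1734808552968852712071081028518045047510236462147383843260824439283143
    1725437409450311926507244009382966281595691974875088945032021985431555
    1725437409450272640969088135555813819487245244012152145217297400721443
    1725437409450317667379211549958806772434750713728632251685646715885973
    1408172525595752251073997647721268287425819438665480437512583859109143
    1725437409450283840233986753390578770757158254316056734436657059592252
    2112077988664953557624541168683603314241689752184119314322044134340884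
    1725437470256596437198020568660258424208356547658606134886675537428747
    1271446353859083718333351786290533136723443219237267772469186319572626
    1545526159044875111569934831446302893194035327251768948523228380327894
    1725437409450311926507244009382966281595691974875088921309055110094558 zeroVec
    1725437409450342969643845860863549008746861332371005425794634717656576 zeroVec zeroVec
    zeroVec 1388428260301692345304384843056843304789279260108716254382970090038816 zeroVec
    1725437409450335371144837207216863364296232817813092799259795302474362
    1725437409450311926507244009382966281595691974875088924567909740620246 zeroVec
    1725437409450311926507244009382966281595691974875088916611824211778620 zeroVec zeroVec
    zeroVec 1725437409450311926507244009382966281595691974875088939288229628132288 zeroVec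
    1567931444297582904266289574899605629392529127448735852085916969554783 zeroVec zeroVec
    zeroVec zeroVec zeroVec zeroVec zeroVec zeroVec zeroVec
    1725437409450311926507244009382966281595691974875088921726869241393365 zeroVec
    1725437409450311926507244009382966281595691974875088919105604651405365 zeroVec zeroVec
    zeroVec 1725437409450311926486985834038659475288935796110468978751287554278818 zeroVec
    1525834407303728513501185531836178317707989398497080451080884656917050

/-- The coefficient vectors attached to a base with relations `f f f f o o`. -/
def baseffffoo : FlagTree :=
  flagTree4
    1725437409450311926507244009382966281595691974875088930760364718568591
    1725437409450311926507244009382966281595691974875088930760364718568591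
    1725437409450311926507244009382966281595691974875088930760400842038952
    1725437409450311926507244009382966281595691974875088930760364718568591
    1725437409450311926507244009382966281595691974875088930760351084989958
    1725437409450311926507244009382966281595691974875088930760415358465506
    1725437409450311926507244009382966281595691974875088930760344510399372
    1725437409450311926507244009382966281595691974875088930760364206820846
    1725437409450311926507244009382966281595691974875088930760406693094080
    1725437409450311926507244009382966281595691974875088930760364718568591
    1725437409450311926507244009382966281595691974875088930760365876214641
    1725437409450311926507244009382966281595691974875088930760419217249122
    1725437409450311926507244009382966281595691974875088930760359997863987
    1725437409450311926448534889167352974868299910664768673072811430926475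
    2171785403785859819986781777280954169373885783938796508578587415080512
    1725437409450311926507244009382966281595691974875088930760314271579166
    1364201658136343295313123961369452361475601699011292037273690697633122
    1725437409450311926447903867281215352355887015980525815035685516627980
    1725437409450311926507244009382966281595691974875088930760380499634868
    1725437409450311926507244009382966281595691974875088930760387204159687
    1725437409450311926507244009382966281595691974875088930760455183461205 zeroVec zeroVec
    zeroVec 1725437409450311926507244009382966281595691974875088930760370785586975
    1564606085430616891250679006513072688712919620513312041176733913581460
    1672628237938729357623858981339471739676624830493092498353869860930779
    1725437409450311926507244009382966281595691974875088930760364718568591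
    1725437409450294314031070604280969651863019948975511044241740635554396
    1665697366496765541146807853210221671512293749273261813821531675963848
    1725437409450311926507244009382966281595691974875088930760358030723521
    1725437409450311926507244009382966281595691974875088930760354457153796
    1725437409450311926507045621953680153172224873125335450936453553380916
    1725437409450311926507244009382966281595691974875088930760310817509593
    1725437409450311926456339614768953928232882015202957056039221482907911
    1725437409450311926476520361925931436216090781953734373707031891641133
    1725437409450311926507244009382966281595691974875088930760367574865806
    1725437409450311926507244009382966281595691974875088930760378790423613
    1725437409450311926478379887263565713696124596286180884682895633893761
    1616024520424888832293140886922795542145551775602199027964992356823140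
    1725437409450311926468181667281296865611007746177225698372694358040201
    2221390627641896300022859099335328651032280520376527386144725604874640
    1725437357675207537604054399074416171623057458258835635959810766089322
    1401707603885603141683453573316762254034719190728851715122319531608954
    1725437409450311926468740256347029660659456932848518994531708484637560
    1725437409450311926507244009382966281595691974875088930760368751334096
    1725437409450311926507244009382966281595691974875088930760385513770673
    1725437409450311926507244009382966281595691974875088930760445519701650 zeroVec zeroVec
    zeroVec 1725437409450281288943192523777266967639878435478575506031199795414152
    1469573120725599747627920667271136819887551058527775193381248252512970
    1292383347382995123296656593136485349459610100808552802440347141442917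
    1725437409450311926507244009382966281595691974875088930760347974970054 zeroVec
    1725437409450311926507244009382966281595691974875088930760381546179604 zeroVec zeroVec
    zeroVec 1725437409450311926507244009382966281595691974875088930760325613003620 zeroVec
    1725437409450311926507244009382966281595691974875088930760385243437517 zeroVec zeroVec
    zeroVec zeroVec zeroVec zeroVec zeroVec zeroVec zeroVec
    1725437409450311926507244009382966281595691974875088930760362556454943 zeroVec
    1725437409450311926507244009382966281595691974875088930760434688020469 zeroVec zeroVec
    zeroVec 1725437409450311926507244009382966281595691974875088930760350688609835 zeroVec
    1725437409450311926489000037344990761171079302184854577992744372835100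

/-- The coefficient vectors attached to a base with relations `o f f f f o`. -/
def baseoffffo : FlagTree :=
  flagTree4
    1725437409450311926507244009382966281595691974875088930760374193478955
    1725437409450311926507244009382966281595691974875088930760374193478955
    1725437409450311926507244009382966281595691974875088930760374193498483
    1725437409450311926507244009382966281595691974875088930760374193478955
    1725437414752108979761937408183230536907609188811703014057978446763751
    1725437348818216988973447841302117295477040145138412103821148824778495
    1725437409450311926507244009382966281595691974875088930760374193498483
    1725437558336887988142035370858912919775810527783306586442238048319231
    1725437399356732336003484959892542311132468916286306187672100688385215
    1725437409450311926507244009382966281595691974875088930760374193478955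
    1725437409450311926507244009382966281595691974875088930760374193468819
    1725437409450311926507244009382966281595691974875088930760374193498151
    1725437409450311926507244009382966281595691974875088930760374193468819
    1725437336668886580111422332859942249852407789856307275292426302916535
    1725437231689852519808754793412725079455687695574497893413938827071003
    1725437409450311926507244009382966281595691974875088930760374193498151
    1725437409450311926507244009382966281595691974875088930760374193458715
    1725437409450311926507244009382966281595691974875088930760374193508903
    1725437409450311926507244009382966281595691974875088930760374193483517 zeroVec
    1725437409450311926507244009382966281595691974875088930760374193505693 zeroVec zeroVec
    zeroVec 1725437409450311926507244009382966281595691974875088930760374193505693 zeroVec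
    1725437409450311926507244009382966281595691974875088930760374193519426
    1725437409450311926507244009382966281595691974875088930760374193478955
    1725437409450311926507244009382966281595691974875088930760374193468819
    1725437409450311926507244009382966281595691974875088930760374193498151
    1725437409450311926507244009382966281595691974875088930760374193468819
    1725437409450311926488241098384394367004326558620599808953898161407927
    1725437409450311926507244009382966281595691974875088930760374193458715
    1725437409450311926507244009382966281595691974875088930760374193498151
    1725437409450311926507244009382966281595691974875088930760374193458715
    1725437409450311926507244009382966281595691974875088930760374193508903
    1725437409450311926507244009382966281595691974875088930760374193485075
    1725437409450311926507244009382966281595691974875088930760374193464802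
    1725437409450311926507244009382966281595691974875088930760374193503939
    1725437409450311926507244009382966281595691974875088930760374193464802
    1725437382006038501662607740294746694827645917451312253994151602802797
    1725437257516202972337277470334711080605072194065705011068388370251038
    1725437409450311926507244009382966281595691974875088930760374193503939
    1725437520644461342580753730161099071652096786316238862857397563522334
    1725437384206162659908842437694601930218363173937176979065556964501366
    1725437409450311926507244009382966281595691974875088930760374193553684 zeroVec
    1725437409450311926507244009382966281595691974875088930760374193575529 zeroVec zeroVec
    zeroVec 1725437409450311926507244009382966281595691974875088930760374193575529 zeroVec
    1725437364636513362108974453193603116662889050760200412210017550305985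
    1725437409450311926507244009382966281595691974875088930760374193483517 zeroVec
    1725437409450311926507244009382966281595691974875088930760374193505693 zeroVec zeroVec
    zeroVec 1725437409450311926507244009382966281595691974875088930760374193505693 zeroVec
    1725437409450311926507244009382966281595691974875088930760374193519426
    1725437409450311926507244009382966281595691974875088930760374193553684 zeroVec
    1725437409450311926507244009382966281595691974875088930760374193575529 zeroVec zeroVec
    zeroVec 1725437409450311926507244009382966281595691974875088930760374193575529 zeroVec
    1725437409450311926530139024839547348782703336968266825803765975714497
    1725437409450311926507244009382966281595691974875088930760374193455190 zeroVec
    1725437409450311926507244009382966281595691974875088930760374193480016 zeroVec zeroVec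
    zeroVec 1725437409450311926507244009382966281595691974875088930760374193480016 zeroVec
    1725437397296273691355695023910690634877238976214941178762186133086541

/-- The coefficient vectors attached to a base with relations `f o f f o f`. -/
def basefoffof : FlagTree :=
  flagTree4
    1725437409450311926507244009382966281595691974876463204485738861146751
    1725437409450311926507244009382966281595691974876463204485738861146751
    1725437409450311926507244009382966281595691974883537535359169594410097
    1725437409450311926507244009382966281595691974876463204485738861146751
    1725437409450311926507244009382966281595691974855812066556748011381149
    1725437409450311926507244009382966281595691974874544727242694535958695
    1725437409450311926507244009382966281595691974851255758769692009822631 zeroVec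
    1725437409450311926507244009382966281595691974875836055073124258984465
    1725437409450311926507244009382966281595691974876463204485738861146751
    1725437409450311926507244009382966281595691974885096264474656590780452
    1903342780169651438960870657524336788792405445751875859350292926601130
    1725437409450311926507244009382966281595691974877643781588533883427215
    1753088268997873126183529552294963133393716994408860779418671893179986
    1725437409450306250736405402074865379221570424555791013623665379035888
    1725437409450311926507244009382966281595691974867977750757524441653144 zeroVec
    1725437409450311926507244009382966281595691974912047027174244954991418
    1725437409450311926507244009382966281595691974863928655569944446980056 zeroVec
    1725437397348844418398646831803043747329212082940670226815199030018749 zeroVec zeroVec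
    zeroVec 1725437409450311926507244009382966281595691974844919321712041523139481 zeroVec
    1725437409450311926507244009382966281595691974882495360883398154431734
    1725437409450311926507244009382966281595691974876463204485738861146751
    1725437409450311926507244009382966281595691974879414682855830826490978
    1725437409450311926507244009382966281595691974893886163503629921682572
    1725437409450311926507244009382966281595691974899364837178489271452144
    1725437383008020866190851291724703336333397197050502091182483811818226
    1725437409450311926507244009382966281595691974907804211451942130409523
    1725437373729679863572413787679927095154565275725181108805363171334698 zeroVec
    1725437185838762893676745153974201237635288359172330102972426679784110
    1725437409450311926507244009382966281595691974894439560851671756024185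
    1725437409450311926507244009382966281595691974906033322578320259266817
    1725437409450311926507244009382966281595691974931369946726924790288062
    1725437409450311926507244009382966281595691974918530994019254045483002
    1507919714710030145134833269853596974447290314242093876578439186587297
    2195158099090583872257890222661064698763988872097581948061471541842294
    1725437418724729740541064837950345154385019104683576077507885890795284 zeroVec
    2087769138031861975892754054618335286501787752251187414457601164886737
    1725437409450311926507244009382966281595691974853294101071532359895635 zeroVec
    1725437409450239254940133524750028201718623734367615824626587247033683 zeroVec zeroVec
    zeroVec 1725437409450311926507244009382966281595691974840676568402446995418775 zeroVec
    2095942353098843757159373664298884957616440148594199166994716543715342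
    1725437409450311926507244009382966281595691974872220449614842442045225 zeroVec
    1725437409450311926507244009382966281595691974891801673045025110433559 zeroVec zeroVec
    zeroVec 1725437579590369826446302778056559123961589224982760912899789770779610 zeroVec
    1725437331454968951176965513436844277206733879889711793235573649562175 zeroVec zeroVec
    zeroVec zeroVec zeroVec zeroVec zeroVec zeroVec zeroVec
    1725437409450311926507244009382966281595691974850683882928037870712614 zeroVec
    1725437409450311926507244009382966281595691974883270072593783731593223 zeroVec zeroVec
    zeroVec 1725437486100785855030926151677270402062407540142966057089313144899696 zeroVec
    2052167193091497211508434374997697918910623718117479121634652067076040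

/-- The coefficient vectors attached to a base with relations `f o f f f f`. -/
def basefoffff : FlagTree :=
  flagTree4
    1725437409450311926507244009382966281595691974875088930760372566098739
    2138184254076862001679101394351374180812026560259556668623694213415731
    1725437409450311926507244009382966281595691974875088930760376376619255
    1725437409450311926507244009382966281595691974875088930760372566098739
    1822829887684482148524270170390988185934105162554343622132389253229138
    1725437409450311926507244009382966281595691974875088930760383261548355
    1725437409450311926507244009382966281595691974875088930760366821997870 zeroVec
    1725437409450311926507244009382966281595691974875088930760368327736269
    1725437409450311926507244009382966281595691974875088930760372566098739
    2190404341203450475426889341359831699087653682955438325587069212029460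
    1982246369197760589888243584797144302856832613216924839293592951309622
    1725437409450311926507244009382966281595691974875088930760383142038991
    1551438224831398429669149810863398198164955034334130369479539394880464
    1725437409450260326379676011565119481930103733934889033688596926660126
    1725437409450311926507244009382966281595691974875088930760374130558567 zeroVec
    1725437409450311926507244009382966281595691974875088930760364846438724
    1725437409450291348564190390269877973713247329610172175230168441303243 zeroVec
    2100574544103390562618023341450541413799826769451537394507167353017717 zeroVec zeroVec
    zeroVec 1725437409450261034635061475219320866781403146907370623110733836064678 zeroVec
    1725437409450271084902448862794153196351189111654755966511701419871531
    1725437409450311926507244009382966281595691974875088930760372566098739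
    1807194303380816048711713653218328241435759206359093346270846190093403
    1725437409450311926507244009382966281595691974875088930760380552035474
    1725437409450311926507244009382966281595691974875088930760378127747305
    1841075242216059681119684468687184088333353737832488755657202174275889
    2478250807911091727175015945495406465573778685194854817502791581266069
    1725437409450311926507244009382966281595691974875088930760361121917172 zeroVec
    1986858546942225593039774916192955455530089001146658963415007417545518
    1725437409450311926507244009382966281595691974875088930760381827115368
    1469520313172931356801092427265734344308251979372426422513094282434930
    1725437409450311926507244009382966281595691974875088930760379023193863
    1725437409450292092737440092968349476338305191418025255716548823218619
    1428895995524262355191486430092315410357838743901636904617547754639588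
    2528152379116414621609407540925640676987885133056058760438710545626533
    1725437409450256480549191499731238850716946488322560318595955600349282 zeroVec
    2109826900745129535176957889518006682080774886400316146218865215321819
    1725437409450256137832903552183828143625667955685057341358392338276273 zeroVec
    1725437409450239859183370462838530703850080972579034375606347068575734 zeroVec zeroVec
    zeroVec 1725437409450282183148354308316908441382406484609178252316996497535570 zeroVec
    1725437409450238595323522551468275934685955554184400033784854368678769
    1725437409450311926507244009382966281595691974875088930760375508427917 zeroVec
    1725437409450311926507244009382966281595691974875088930760378595424038 zeroVec zeroVec
    zeroVec 2476078741895427735199371386174430762907201473852218492083142166342728 zeroVec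
    1725437409450311926507244009382966281595691974875088930760364531912635 zeroVec zeroVec
    zeroVec zeroVec zeroVec zeroVec zeroVec zeroVec zeroVec
    1725437409450286110916466615470530278766950191627198181399846267689964 zeroVec
    1725437409450311926507244009382966281595691974875088930760383655863659 zeroVec zeroVec
    zeroVec 1936687347725604174787152136840209744060125795130334285478725864689799 zeroVec
    1985751242827236579095266142479176870879269875157313559473270174001888

/-- The coefficient vectors attached to a base with relations `f f f f f f`. -/
def baseffffff : FlagTree :=
  flagTree4
    1881473981621934702971560004532387845382202762638184489810032245866496
    1724038626311491888982750958352212479414846235429465394997232564961280 zeroVec zeroVec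
    1853250125872666334519750095600883945888753174571959832727597632978944 zeroVec
    1957343303227261457646270281188321360314423888626426241641683709067264 zeroVec zeroVec
    zeroVec 1856547921568550981534067643910770855131706403177041307112264663302144 zeroVec
    zeroVec 1553002980682183765790640156443378756250221236931978163189527339859968 zeroVec
    zeroVec zeroVec zeroVec
    2120381490027670839368006867260214966575519308464784529548482651881472 zeroVec zeroVec
    zeroVec zeroVec zeroVec
    1896775614285659074005543157281373688321380334963256828099559626375168 zeroVec
    1939844920600058759956631734815175273557741101458256381238636056674304 zeroVec
    1759038612510810953888048480090787378907439441251326631569952789757952 zeroVec zeroVec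
    1636874708670666065482541759300347753992734391320971420339832360009728
    1725437409450311926452891562749337917405230328586513256976646436552704
    1725437316090977816101141008853270190228069368184756405246788883185664 zeroVec
    1856778212975390114818169607916094821104598803959540201403093902950400 zeroVec
    1725436997152911487909699603549146129602166660891388043436629668397056
    1776280054873152319876271827484126804289675345627200137109602613329920
    1591406193403222693027049354859032676788527409706469086664818875695104
    1725437409450311926420926031393687298684123294585991457967758203944960
    2188311259406537901341268220559618749245315642934352412000884517502976
    2194203695541674070152468692995195972720069646208813803311053826686976 zeroVec
    1725437200982270830297112496728043221123783588001775059095881990012928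
    1725437409450240565942178249865887500460807116850042152900810209492992 zeroVec zeroVec
    zeroVec zeroVec zeroVec
    1805787396984191633779318067154435125385722735906270973140202712727552 zeroVec
    1725437409450184560638219100930995214667802453121676258017885272670208
    2356606899608697395461751452498458556248305197185252021705966034616320 zeroVec zeroVec
    zeroVec zeroVec zeroVec
    2363202065776864964325666965158544190316900741677351814197028079009792 zeroVec zeroVec
    zeroVec zeroVec zeroVec zeroVec zeroVec zeroVec zeroVec zeroVec zeroVec
    2263146944728105141192427676998052802586693493127421000078179984998400 zeroVec zeroVec
    zeroVec zeroVec zeroVec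
    1895052728209867202868271286518424961390350003382202411248161511178240 zeroVec
    1725437409450311926457640551040855410664466642864110270856067978100736

/-- The coefficient vectors attached to a base with relations `f f o o f f`. -/
def baseffooff : FlagTree :=
  flagTree4
    zeroVec zeroVec zeroVec zeroVec zeroVec zeroVec zeroVec zeroVec zeroVec zeroVec zeroVec
    zeroVec zeroVec 1482944339351505343258984620339972029113462963514945225000703119851520
    1973173057068691459771801084724523072172357807653821279927097327878144 zeroVec zeroVec
    zeroVec zeroVec zeroVec zeroVec zeroVec zeroVec zeroVec
    1782080612826979802096344513554137958028712691577793650396423361921024 zeroVec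
    1851361291203874540089195181047350086340000819728564263382989847658496 zeroVec zeroVec
    1765273429278501003581773658323497179970819027446212265672180669349888 zeroVec zeroVec
    zeroVec zeroVec zeroVec zeroVec zeroVec zeroVec zeroVec zeroVec zeroVec
    1851850006057308765322617919712429484188415705172410677883488135282688 zeroVec zeroVec
    1725437409450311926434731084701385695633659565625491699674420320665600 zeroVec zeroVec
    zeroVec zeroVec zeroVec zeroVec
    1713976470208534273961902710358445350720954406716904493361898359619584 zeroVec
    1838236746854577909602536678550193912205369355062611639622977945862144 zeroVec zeroVec
    zeroVec zeroVec zeroVec zeroVec zeroVec zeroVec zeroVec zeroVec zeroVec zeroVec zeroVec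
    zeroVec zeroVec zeroVec zeroVec zeroVec zeroVec zeroVec zeroVec zeroVec zeroVec zeroVec
    1725437409450311926498564737757659751313991405609120369649138663424000 zeroVec
    1665792805761029318756675214042370136130915975244072855802413732331520

/-- The coefficient vectors attached to a base with relations `o f f o o f`. -/
def baseoffoof : FlagTree :=
  flagTree4
    zeroVec zeroVec zeroVec zeroVec
    1838982144495709279821115253248530611974349972272414384273497152028672
    2086568067122810410548784321032915210171728101626362535470176672940032
    1821390100532076415850298258811615145240000089485810962270443044601856 zeroVec
    1964512791445540650810886576428927793276774506612977218618135885643776 zeroVec zeroVec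
    zeroVec zeroVec zeroVec
    1725437311784886025625878004861918645907610206738540570344461207339008
    2112089842806862316262607893054379716504010334902339359150713598902272 zeroVec zeroVec
    zeroVec zeroVec zeroVec zeroVec zeroVec zeroVec zeroVec zeroVec zeroVec zeroVec zeroVec
    zeroVec zeroVec zeroVec zeroVec zeroVec zeroVec zeroVec zeroVec zeroVec zeroVec zeroVec
    zeroVec 1786924937554775346210803457069798649550096203732640627915490388344832
    1725437429216120653522978399606387701598732560879393430947060870283264 zeroVec
    1725437551187269111538495656795091457624799650466274866758273494679552 zeroVec zeroVec
    zeroVec zeroVec zeroVec zeroVec zeroVec zeroVec zeroVec zeroVec zeroVec zeroVec zeroVec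
    zeroVec zeroVec zeroVec zeroVec zeroVec zeroVec zeroVec zeroVec zeroVec zeroVec zeroVec
    zeroVec zeroVec zeroVec zeroVec zeroVec zeroVec zeroVec zeroVec zeroVec
    1725437426737450105762162832986730353109605284820975824814325242003456 zeroVec
    1725437408173706361072977809037862607650832817500272392242501174427648

/-- The coefficient vectors attached to a base with relations `f f f o o o`. -/
def basefffooo : FlagTree :=
  flagTree4
    1756336771622865551825360494567891473566214102759311917215816874983424
    1701594023534662403563892047017182192359940905513976768933548046417920
    1680618801822554237537069113757651725891477198102827116022348129501184 zeroVec zeroVec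
    zeroVec zeroVec zeroVec zeroVec zeroVec zeroVec zeroVec zeroVec zeroVec zeroVec zeroVec
    zeroVec zeroVec zeroVec zeroVec zeroVec zeroVec zeroVec zeroVec zeroVec zeroVec zeroVec
    zeroVec zeroVec zeroVec zeroVec zeroVec zeroVec zeroVec zeroVec zeroVec zeroVec zeroVec
    zeroVec 1781335199262513295759248312514439478249955512230661638718326442033152 zeroVec
    1998546737342584456941830709519557416959191594701891081419932879028224 zeroVec zeroVec
    zeroVec zeroVec zeroVec zeroVec zeroVec zeroVec zeroVec zeroVec
    1535651495827113306429258483743531703753003151076374363641199023095808 zeroVec zeroVec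
    zeroVec zeroVec zeroVec zeroVec zeroVec zeroVec zeroVec zeroVec zeroVec zeroVec zeroVec
    zeroVec zeroVec zeroVec zeroVec zeroVec zeroVec zeroVec zeroVec zeroVec zeroVec zeroVec
    zeroVec zeroVec 1178463467073956432064721478254990186986905659459158816283979810865152
    zeroVec

/-- The coefficient vectors attached to a base with relations `f f f o o f`. -/
def basefffoof : FlagTree :=
  flagTree4
    zeroVec zeroVec zeroVec zeroVec
    2084825407890795742321850619503288709966659826094139974558909476110336
    2208860320318365122395699475711394942351540048424384557334381946994688 zeroVec zeroVec
    2070389466315228312742316664030011340006737842595453178253733149016064 zeroVec zeroVec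
    zeroVec zeroVec zeroVec
    1725437226937301868404114120093553012409583260283002027524106696523776 zeroVec zeroVec
    zeroVec zeroVec zeroVec zeroVec zeroVec zeroVec zeroVec zeroVec zeroVec
    1725437382195920829175199467903448079705905354460674385328094342807552 zeroVec zeroVec
    zeroVec zeroVec zeroVec
    1725437294122691017681605005618966156357038828430537938483784096677888 zeroVec zeroVec
    1725437476922093842461752204758387317976997323257294808873723168292864 zeroVec zeroVec
    zeroVec zeroVec zeroVec
    1798527430877405256487683430533798676326015136554801281130592709115904 zeroVec zeroVec
    zeroVec zeroVec zeroVec zeroVec zeroVec zeroVec zeroVec zeroVec zeroVec zeroVec zeroVec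
    zeroVec zeroVec zeroVec zeroVec zeroVec zeroVec zeroVec zeroVec zeroVec zeroVec zeroVec
    zeroVec zeroVec zeroVec zeroVec zeroVec zeroVec zeroVec zeroVec zeroVec zeroVec zeroVec
    zeroVec zeroVec zeroVec zeroVec

/-- The coefficient vectors attached to a base with relations `o f f f f f`. -/
def baseofffff : FlagTree :=
  flagTree4
    zeroVec zeroVec zeroVec zeroVec zeroVec zeroVec
    1725437385993567379084141330024100680746543536202599429228835223109632 zeroVec
    1808622577341564834320832607866523375766637840707827653850588439904256 zeroVec zeroVec
    zeroVec zeroVec 1725437409450311926472986675044753067795575598179123604936239365488640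
    zeroVec zeroVec zeroVec zeroVec zeroVec zeroVec zeroVec zeroVec zeroVec zeroVec zeroVec
    zeroVec zeroVec zeroVec zeroVec zeroVec zeroVec zeroVec zeroVec zeroVec zeroVec zeroVec
    zeroVec zeroVec 1764982174971855150112312228778184528931437083197995122036367965552640
    1725437432918041401967273380078544513935453829775757554319725224263680 zeroVec zeroVec
    1725437349601285430462936266590632026022196530547180945518037130280960 zeroVec zeroVec
    zeroVec zeroVec zeroVec zeroVec zeroVec zeroVec zeroVec zeroVec zeroVec zeroVec zeroVec
    zeroVec zeroVec zeroVec zeroVec zeroVec zeroVec zeroVec zeroVec zeroVec zeroVec zeroVec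
    zeroVec zeroVec zeroVec zeroVec zeroVec zeroVec zeroVec zeroVec zeroVec zeroVec zeroVec
    1725437353518196913344225063224164626103780374195050742863594666328064 zeroVec zeroVec

/-- The coefficient vectors attached to a base with relations `f o o o o o`. -/
def basefooooo : FlagTree :=
  flagTree4
    1725437399588206464522612310894758292018057500136106197884123361574912
    1725437387824127172663228868151091546613925316538304003250152497217536 zeroVec zeroVec
    zeroVec zeroVec 1725437408281986366008398052214029975201165063178038023659505769775104
    zeroVec zeroVec zeroVec zeroVec zeroVec zeroVec zeroVec zeroVec zeroVec zeroVec zeroVec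
    zeroVec zeroVec zeroVec zeroVec zeroVec zeroVec zeroVec zeroVec zeroVec zeroVec zeroVec
    zeroVec zeroVec zeroVec zeroVec zeroVec zeroVec zeroVec zeroVec zeroVec zeroVec zeroVec
    zeroVec zeroVec zeroVec zeroVec zeroVec zeroVec zeroVec zeroVec zeroVec
    1725437409450311926506917526473259793272899891959577358747926640197632 zeroVec zeroVec
    zeroVec zeroVec zeroVec zeroVec zeroVec zeroVec zeroVec zeroVec zeroVec zeroVec zeroVec
    zeroVec zeroVec zeroVec zeroVec zeroVec zeroVec zeroVec zeroVec zeroVec zeroVec zeroVec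
    zeroVec zeroVec zeroVec zeroVec zeroVec zeroVec zeroVec

/-- The coefficient vectors attached to a base with relations `f f o f f f`. -/
def baseffofff : FlagTree :=
  flagTree4
    zeroVec zeroVec zeroVec zeroVec zeroVec zeroVec zeroVec zeroVec zeroVec zeroVec zeroVec
    zeroVec zeroVec zeroVec zeroVec zeroVec zeroVec zeroVec zeroVec zeroVec zeroVec zeroVec
    zeroVec zeroVec zeroVec zeroVec zeroVec zeroVec zeroVec
    1782095422367995692950723908276780974183257536200584352615193499402240 zeroVec zeroVec
    zeroVec zeroVec zeroVec zeroVec zeroVec zeroVec zeroVec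
    1725437409450311926505557537828072601751236477716438171069845930508288 zeroVec zeroVec
    1725437409450311926504665508020131376825575048985532236609606713868288 zeroVec zeroVec
    zeroVec zeroVec zeroVec zeroVec zeroVec zeroVec
    1725437409450311926480823335313478317012496381865878420356332931514368 zeroVec zeroVec
    zeroVec zeroVec zeroVec zeroVec zeroVec zeroVec zeroVec zeroVec zeroVec zeroVec zeroVec
    zeroVec zeroVec zeroVec zeroVec zeroVec zeroVec zeroVec zeroVec zeroVec zeroVec zeroVec
    zeroVec zeroVec 1725437409450311926496288277687793745303703439487848424906608182558720
    zeroVec zeroVec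

/-- The coefficient vectors attached to a base with relations `o o o o o o`. -/
def baseoooooo : FlagTree :=
  flagTree4
    1725437409450311926507280047387207107082688696595817530512567857840128 zeroVec zeroVec
    zeroVec zeroVec zeroVec zeroVec zeroVec zeroVec zeroVec zeroVec zeroVec zeroVec zeroVec
    zeroVec zeroVec zeroVec zeroVec zeroVec zeroVec zeroVec zeroVec zeroVec zeroVec zeroVec
    zeroVec zeroVec zeroVec zeroVec zeroVec zeroVec zeroVec zeroVec zeroVec zeroVec zeroVec
    zeroVec zeroVec zeroVec zeroVec
    1725437409450311926505429799159575418341881761122172441255139674685440 zeroVec zeroVec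
    zeroVec zeroVec zeroVec zeroVec zeroVec zeroVec zeroVec zeroVec zeroVec zeroVec zeroVec
    zeroVec zeroVec zeroVec zeroVec zeroVec zeroVec zeroVec zeroVec zeroVec zeroVec zeroVec
    zeroVec zeroVec zeroVec zeroVec zeroVec zeroVec zeroVec zeroVec zeroVec zeroVec zeroVec
    zeroVec zeroVec zeroVec zeroVec zeroVec

/-- The coefficient vectors attached to a base with relations `o o o f f f`. -/
def baseooofff : FlagTree :=
  flagTree4
    zeroVec zeroVec 1746646317689624951184579407176947972254414457447240141619074415198208
    zeroVec zeroVec zeroVec zeroVec zeroVec zeroVec zeroVec zeroVec zeroVec zeroVec zeroVec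
    zeroVec zeroVec zeroVec zeroVec zeroVec zeroVec zeroVec zeroVec zeroVec zeroVec zeroVec
    zeroVec zeroVec zeroVec zeroVec zeroVec zeroVec zeroVec zeroVec zeroVec zeroVec zeroVec
    zeroVec zeroVec zeroVec zeroVec zeroVec zeroVec zeroVec zeroVec zeroVec zeroVec zeroVec
    zeroVec zeroVec zeroVec zeroVec zeroVec zeroVec zeroVec zeroVec zeroVec zeroVec zeroVec
    zeroVec zeroVec zeroVec zeroVec zeroVec zeroVec zeroVec zeroVec zeroVec zeroVec zeroVec
    zeroVec zeroVec zeroVec zeroVec zeroVec zeroVec zeroVec zeroVec zeroVec zeroVec zeroVec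
    zeroVec

/-- The coefficient vectors attached to a base with relations `f o f o f f`. -/
def basefofoff : FlagTree :=
  flagTree4
    zeroVec zeroVec zeroVec zeroVec zeroVec zeroVec zeroVec zeroVec zeroVec zeroVec zeroVec
    zeroVec zeroVec zeroVec zeroVec zeroVec zeroVec zeroVec zeroVec zeroVec zeroVec zeroVec
    zeroVec zeroVec zeroVec zeroVec zeroVec zeroVec zeroVec zeroVec zeroVec zeroVec zeroVec
    zeroVec zeroVec zeroVec zeroVec zeroVec zeroVec zeroVec zeroVec zeroVec zeroVec zeroVec
    1725437409450311926390621102728500064284627576310924146550051297034240 zeroVec zeroVec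
    zeroVec zeroVec zeroVec zeroVec zeroVec zeroVec zeroVec zeroVec zeroVec zeroVec zeroVec
    zeroVec zeroVec zeroVec zeroVec zeroVec zeroVec zeroVec zeroVec zeroVec zeroVec zeroVec
    zeroVec zeroVec zeroVec zeroVec zeroVec zeroVec zeroVec zeroVec zeroVec zeroVec zeroVec
    zeroVec

/-- The tree of all four-vertex bases, keyed by the relations of the pairs
`01`, `02`, `12`, `03`, `13`, `23`. -/
def baseTree : FlagTree :=
  .node (.node (.node (.node (.node (.node baseoooooo .nil .nil) .nil .nil) (.node .nil (.node
  .nil baseooofff .nil) .nil) .nil) .nil .nil) (.node .nil (.node (.node (.node baseoffooo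
  baseoffoof .nil) .nil .nil) (.node .nil (.node baseoffffo baseofffff .nil) .nil) .nil) .nil)
  .nil) (.node (.node (.node (.node (.node basefooooo .nil .nil) (.node .nil basefoooff .nil)
  .nil) (.node (.node .nil basefoofof .nil) (.node .nil basefoofff .nil) .nil) .nil) (.node
  (.node (.node basefofooo basefofoof .nil) (.node basefofofo basefofoff .nil) .nil) (.node
  (.node .nil basefoffof .nil) (.node .nil basefoffff .nil) .nil) .nil) .nil) (.node (.node
  (.node (.node baseffoooo .nil .nil) (.node baseffoofo baseffooff .nil) .nil) (.node (.node
  baseffofoo .nil .nil) (.node .nil baseffofff .nil) .nil) .nil) (.node (.node (.node basefffooo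
  basefffoof .nil) (.node basefffofo .nil .nil) .nil) (.node (.node baseffffoo .nil .nil) (.node
  .nil baseffffff .nil) .nil) .nil) .nil) .nil) .nil

/-- The coefficient vectors attached to a non-adjacent pair. -/
def nonArcTree : FlagTree :=
  .node (.node (.node (.node (.node (.leaf
  33373540204754114427864431235523425247810918232719967829915905596867426284024863698865167005895)
  (.leaf
  33373540204754114427864431235523425247810918232719967829915905596867426284024863698865167005895)
  (.leaf
  33373540204754114427864431235523425247810918232719967829915905596867426284024863698865167005895))
  (.node (.leaf
  33373540204754114427864431235523425247810918232719967829915905596867426284024863698865167005895)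
  (.leaf
  33375067981994378928431245396493289481502092065858388492690320634471489140985505446418480886139)
  (.leaf
  33373540204754114427864431235523425247810918232719967829915905596867426284024863698865167005895))
  (.node (.leaf
  33376818558845556291179592008931029865914686359716903779229986039257807882637594328924196686599)
  (.leaf
  33375704550895485930036973914237115761856458554668853490669122290280693216037115898826819829626)
  (.leaf
  33376818558845556291179592008931029865914686359716903779229986039257807882637594328924196686599)))
  (.node (.node (.leaf
  33373540204754114427864431235523425247810918232719967829915905596867426284024863698865167005895)
  (.leaf
  33375067981994373080930738911485695096362269311743926107919447386016434766409889633136773427581)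
  (.leaf
  33373540204754114427864431235523425247810918232719967829915905596867426284024863698865167005895))
  (.node (.leaf
  33385348640470305559653529281870503566361395067066199247821347748206476970353588448579822827543)
  (.leaf
  33387258365370977514717363327376354145996873256208248639680529188473983698975217181676824161585)
  (.leaf
  33385348640470305559653529281870503566361395067066199247821347748206476970353588448579822827543))
  (.node (.leaf
  33379874113887632243837024478870566078108457110194211219895275635166136969455287690246487005003)
  (.leaf
  33399480581289693565061648379672064766593100037693518884501140147755235924334356000322530246805)
  (.leaf
  33379874113887632243837024478870566078108457110194211219895275635166136969455287690246487005003)))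
  (.node (.node (.leaf
  33376818558845560126792547995796808395415064953960356896252482194313524735014639062663562251015)
  (.leaf
  33375704550895484873434159625217659650704188127253797603639824555879302307616752783253333540726)
  (.leaf
  33376818558845560126792547995796808395415064953960356896252482194313524735014639062663562251015))
  (.node (.leaf
  33379874113887635934709868917620019253899900596272099952364078269304326348793970702354159228747)
  (.leaf
  33399480581289692103186521761553206847451455550092196480923145078493404138563208818340295278738)
  (.leaf
  33379874113887635934709868917620019253899900596272099952364078269304326348793970702354159228747))
  (.node (.leaf
  33384807560362464971319602264626109945418701893485560307115331937624333121658917868060661504531)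
  (.leaf
  33377709748061563480895462603053604803240436445751033551156484775021448086423538755771684554891)
  (.leaf
  33384807560362464971319602264626109945418701893485560307115331937624333121658917868060661504531))))
  (.node (.node (.node (.leaf
  33373540204754114427864431235523425247810918232719967829915905596867426284024863698865167005895)
  (.leaf
  33373540204754114427864431235523425247810918232719967829915905596867426284024863698865167005895)
  (.leaf
  33375067981994378928431245396493289481502092065858388492690320634471489140985505446418480886139))
  (.node (.leaf
  33373540204754114427864431235523425247810918232719967829915905596867426284024863698865167005895)
  (.leaf
  33364182554285849803980111106424892824952375025604853596771398906832510731906645205485022656062)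
  (.leaf
  33364182554285849803980111106424892824952375025604853596771398906832510731906645205485022656062))
  (.node (.leaf
  33376818558845556291179592008931029865914686359716903779229986039257807882637594328924196686599)
  .nil (.leaf
  33361763599182055987669199835338044259763270095937293564501882537485615605784772718896966804146)))
  (.node (.node (.leaf
  33373540204754114427864431235523425247810918232719967829915905596867426284024863698865167005895)
  (.leaf
  33344798909943334890667235122367747899353059086205276912037636856043618965435168412680156364261)
  (.leaf
  33344798909943331503748624923826272254573393318983181937734747831082820063149855718263351164393))
  (.node (.leaf
  33385348640470305559653529281870503566361395067066199247821347748206476970353588448579822827543)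
  (.leaf
  33338592286645961954213453330183212800567068004021765116017896527613225580888810354789154056756)
  (.leaf
  33362145537903161691050664811003082288614316670294749292048617675288704093812578202946758560357))
  (.node (.leaf
  33379874113887632243837024478870566078108457110194211219895275635166136969455287690246487005003)
  .nil (.leaf
  33354793104027650057744574339926360628701858890735365581878728403169809284581793500118236888418)))
  (.node (.node (.leaf
  33376818558845560126792547995796808395415064953960356896252482194313524735014639062663562251015)
  (.leaf
  33383980017820863695444440112819436378856841019381775793336316721616085268770799776328544592827)
  (.leaf
  33394133359453837800998458460205302881722384816003836851926739260935892757523130561831153690785))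
  (.node (.leaf
  33379874113887635934709868917620019253899900596272099952364078269304326348793970702354159228747)
  (.leaf
  33404573143775152326147377007076038116979870486455440781505600656519311962081665884595646730564)
  (.leaf
  33355493336965772645630237569005521880108646411380050399341150419709767104067179721565483872489))
  (.node (.leaf
  33384807560362464971319602264626109945418701893485560307115331937624333121658917868060661504531)
  .nil (.leaf
  33393146671093783243505149136889157171127894862642731097872462269597535257517333467189381947323))))
  (.node (.node (.node (.leaf
  33376818558845556291179592008931029865914686359716903779229986039257807882637594328924196686599)
  (.leaf
  33376818558845556291179592008931029865914686359716903779229986039257807882637594328924196686599)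
  (.leaf
  33375704550895485930036973914237115761856458554668853490669122290280693216037115898826819829626))
  (.node (.leaf
  33376818558845556291179592008931029865914686359716903779229986039257807882637594328924196686599)
  (.leaf
  33361763599182055987669199835338044259763270095937293564501882537485615605784772718896966804146)
  .nil) (.node (.leaf
  33407787871301857238441680021084090348512895019369030849546799564421596145112214380625412461486)
  (.leaf
  33406864830405417861194662521872011276871862333872709383764522387085500919039947684746959495459)
  (.leaf
  33406864830405417861194662521872011276871862333872709383764522387085500919039947684746959495459)))
  (.node (.node (.leaf
  33376818558845556291179592008931029865914686359716903779229986039257807882637594328924196686599)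
  (.leaf
  33394133359453827987618895601014570031018029786252028788554715159319197253455443381714362034338)
  (.leaf
  33383980017820864592833131700384319381554735690119452900098279894873513323015422242126807868351))
  (.node (.leaf
  33380797136814384020616508930302133175989743039577630975909020602237645496954556633368516121466)
  (.leaf
  33398398411224066957469575033014582582808375331583025897176830081916833474301095404770302123712)
  .nil) (.node (.leaf
  33369879908132114124376344720564747932303046945036463328797853244583449167995385934897851904640)
  (.leaf
  33385507777607459668013736370086734673487542936588646321335645240212028923005528653271292437017)
  (.leaf
  33400180827416716729732806834643507433732385026414842020061599242606734989184611826887803639498)))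
  (.node (.node (.leaf
  33356002597583806985056408812391344248993842644273775670526567941481715595691317682972321117230)
  (.leaf
  33326274604046999724264187412526281856778235214113737225575806857738434698766528322354124106498)
  (.leaf
  33326274604047018656270777716613739613288003745789702137521822530407334208332290304325637319424))
  (.node (.leaf
  33345817425032670989405220199220323883355756902046958004941167763128231701745939010264901820259)
  (.leaf
  33357848680393562307161193326802652359944925780019983829479341518526898357342696644533690536579)
  .nil) (.node (.leaf
  33392573765819883606793080465250545479673170724451464024851608161014820151204952885618126342366)
  (.leaf
  33391173297105509349972493745765220996242284101332253862849045486490104785973737607189882691700)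
  (.leaf
  33393114846974959277423475967347677731708996853686471679263538565741390393795151854728146538965)))))
  (.node (.node (.node (.node (.leaf
  33373540204754114427864431235523425247810918232719967829915905596867426284024863698865167005895)
  (.leaf
  33373540204754114427864431235523425247810918232719967829915905596867426284024863698865167005895)
  (.leaf
  33375067981994373080930738911485695096362269311743926107919447386016434766409889633136773427581))
  (.node (.leaf
  33373540204754114427864431235523425247810918232719967829915905596867426284024863698865167005895)
  (.leaf
  33344798909943331503748624923826272254573393318983181937734747831082820063149855718263351164393)
  (.leaf
  33344798909943334890667235122367747899353059086205276912037636856043618965435168412680156364261))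
  (.node (.leaf
  33376818558845556291179592008931029865914686359716903779229986039257807882637594328924196686599)
  (.leaf
  33383980017820864592833131700384319381554735690119452900098279894873513323015422242126807868351)
  (.leaf
  33394133359453827987618895601014570031018029786252028788554715159319197253455443381714362034338)))
  (.node (.node (.leaf
  33373540204754114427864431235523425247810918232719967829915905596867426284024863698865167005895)
  (.leaf
  33364182554285851598757494285112239683275437765031937423404842233153731010316393598586901804610)
  (.leaf
  33364182554285851598757494285112239683275437765031937423404842233153731010316393598586901804610))
  (.node (.leaf
  33385348640470305559653529281870503566361395067066199247821347748206476970353588448579822827543)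
  (.leaf
  33338592286645953182962693591202654458337536034209972470724620708827960542922955376664039680570)
  (.leaf
  33362145537903144799879647330946847108505418707071766438567549813947013897528844859209222769251))
  (.node (.leaf
  33379874113887632243837024478870566078108457110194211219895275635166136969455287690246487005003)
  (.leaf
  33404573143775155365689719482374184209599827223900730627497973591576520484005236720977524658506)
  (.leaf
  33355493336965774527251687682110647116126189757951085805479237314113644436498860827339878609131)))
  (.node (.node (.leaf
  33376818558845560126792547995796808395415064953960356896252482194313524735014639062663562251015)
  .nil (.leaf
  33361763599182054395527972821193816287200724358753793941965394185294241209579377772451085689526))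
  (.node (.leaf
  33379874113887635934709868917620019253899900596272099952364078269304326348793970702354159228747)
  .nil (.leaf
  33354793104027662983036535451239495409735124072744116876762369714244140627303998039057354554715))
  (.node (.leaf
  33384807560362464971319602264626109945418701893485560307115331937624333121658917868060661504531)
  .nil (.leaf
  33393146671093769001078172952052110071986965939654017586252997908357488970625837619226830954431))))
  (.node (.node (.node (.leaf
  33385348640470305559653529281870503566361395067066199247821347748206476970353588448579822827543)
  (.leaf
  33385348640470305559653529281870503566361395067066199247821347748206476970353588448579822827543)
  (.leaf
  33387258365370977514717363327376354145996873256208248639680529188473983698975217181676824161585))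
  (.node (.leaf
  33385348640470305559653529281870503566361395067066199247821347748206476970353588448579822827543)
  (.leaf
  33362145537903161691050664811003082288614316670294749292048617675288704093812578202946758560357)
  (.leaf
  33338592286645961954213453330183212800567068004021765116017896527613225580888810354789154056756))
  (.node (.leaf
  33380797136814384020616508930302133175989743039577630975909020602237645496954556633368516121466)
  .nil (.leaf
  33398398411224066957469575033014582582808375331583025897176830081916833474301095404770302123712)))
  (.node (.node (.leaf
  33385348640470305559653529281870503566361395067066199247821347748206476970353588448579822827543)
  (.leaf
  33362145537903144799879647330946847108505418707071766438567549813947013897528844859209222769251)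
  (.leaf
  33338592286645953182962693591202654458337536034209972470724620708827960542922955376664039680570))
  (.node (.leaf
  33354092848506013582229518925037969992973650065762854578914357752762999585103591955920908731347)
  (.leaf
  33267105069511704169751135028434719329575188326795458469889554024499052007459254626907931549649)
  (.leaf
  33267105069511704169751135028434719329575188326795458469889554024499052007459254626907931549649))
  (.node (.leaf
  33383598052646075134311668566930012726533269010449227238565623122608843391386319494456053641639)
  .nil (.leaf
  33335600381996673971356556241894062252449448712609903884874108055134293536859146242780440949238)))
  (.node (.node (.leaf
  33380797136814395831409611141539945188915532762378695364705706398082988620106970515771799655290)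
  .nil (.leaf
  33398398411224079622229335364318779607494343103728578755775474328508369050037263100481845092035))
  (.node (.leaf
  33383598052646083934510450602253297958284075777573305848486458391050000334291357630043742319012)
  .nil (.leaf
  33335600381996677647755389523230998389570073730136608214869217735761909737999170868444170154480))
  (.node (.leaf
  33340088282840008080750797334911361157183878669402219283902058165922761293334758817252850578872)
  .nil (.leaf
  33424084188935530441518183237727011311722999147627050023023629448415229053615342183079581055506))))
  (.node (.node (.node (.leaf
  33379874113887632243837024478870566078108457110194211219895275635166136969455287690246487005003)
  (.leaf
  33379874113887632243837024478870566078108457110194211219895275635166136969455287690246487005003)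
  (.leaf
  33399480581289693565061648379672064766593100037693518884501140147755235924334356000322530246805))
  (.node (.leaf
  33379874113887632243837024478870566078108457110194211219895275635166136969455287690246487005003)
  (.leaf
  33354793104027650057744574339926360628701858890735365581878728403169809284581793500118236888418)
  .nil) (.node (.leaf
  33369879908132114124376344720564747932303046945036463328797853244583449167995385934897851904640)
  (.leaf
  33400180827416716729732806834643507433732385026414842020061599242606734989184611826887803639498)
  (.leaf
  33385507777607459668013736370086734673487542936588646321335645240212028923005528653271292437017)))
  (.node (.node (.leaf
  33379874113887632243837024478870566078108457110194211219895275635166136969455287690246487005003)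
  (.leaf
  33355493336965774527251687682110647116126189757951085805479237314113644436498860827339878609131)
  (.leaf
  33404573143775155365689719482374184209599827223900730627497973591576520484005236720977524658506))
  (.node (.leaf
  33383598052646075134311668566930012726533269010449227238565623122608843391386319494456053641639)
  (.leaf
  33335600381996673971356556241894062252449448712609903884874108055134293536859146242780440949238)
  .nil) (.node (.leaf
  33332799443384150565558816786247098908393430334350477709325390029273569503186664393046634837802)
  (.leaf
  33383693522118916017080501414971713401639207609646534557725190790178738890179927985596908355417)
  (.leaf
  33383693522118916017080501414971713401639207609646534557725190790178738890179927985596908355417)))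
  (.node (.node (.leaf
  33345817425032677415866172869265412111579685998475789090128686533271897261882712941804366274408)
  .nil (.leaf
  33357848680393555511612956209544219168242015499899243653249825455862070584184426177182278062726))
  .nil (.node (.leaf
  33342220775388619706960119665285537468405143461055228495827985524461591015819091366431643630079)
  .nil (.leaf
  33399480588817521808326422291524665790970556723698793328752094346179931451418021030413911173559)))))
  (.node (.node (.node (.node (.leaf
  33376818558845560126792547995796808395415064953960356896252482194313524735014639062663562251015)
  (.leaf
  33376818558845560126792547995796808395415064953960356896252482194313524735014639062663562251015)
  (.leaf
  33375704550895484873434159625217659650704188127253797603639824555879302307616752783253333540726))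
  (.node (.leaf
  33376818558845560126792547995796808395415064953960356896252482194313524735014639062663562251015)
  (.leaf
  33394133359453837800998458460205302881722384816003836851926739260935892757523130561831153690785)
  (.leaf
  33383980017820863695444440112819436378856841019381775793336316721616085268770799776328544592827))
  (.node (.leaf
  33356002597583806985056408812391344248993842644273775670526567941481715595691317682972321117230)
  (.leaf
  33326274604047018656270777716613739613288003745789702137521822530407334208332290304325637319424)
  (.leaf
  33326274604046999724264187412526281856778235214113737225575806857738434698766528322354124106498)))
  (.node (.node (.leaf
  33376818558845560126792547995796808395415064953960356896252482194313524735014639062663562251015)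
  (.leaf
  33361763599182054395527972821193816287200724358753793941965394185294241209579377772451085689526)
  .nil) (.node (.leaf
  33380797136814395831409611141539945188915532762378695364705706398082988620106970515771799655290)
  (.leaf
  33398398411224079622229335364318779607494343103728578755775474328508369050037263100481845092035)
  .nil) (.node (.leaf
  33345817425032677415866172869265412111579685998475789090128686533271897261882712941804366274408)
  (.leaf
  33357848680393555511612956209544219168242015499899243653249825455862070584184426177182278062726)
  .nil)) (.node (.node (.leaf
  33407787871301846035557046309560710845866820327964645677632676144792301807374675182336202478508)
  (.leaf
  33406864830405399233142306465874497880934502383800790383007795286689386802586683575072805855523)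
  (.leaf
  33406864830405399233142306465874497880934502383800790383007795286689386802586683575072805855523))
  (.node (.leaf
  33369879908132126499655881953997371710483631452411042483196651954862326957870570384825120699009)
  (.leaf
  33385507777607460116708082161846851073884257394484524207857421383072807363233753996461104685596)
  (.leaf
  33400180827416704122869091117630239025700572132014086009063971359054240635105496529550051481292))
  (.node (.leaf
  33392573765819901742729057266935831183588812640669546359257144712135075365351288066645236369629)
  (.leaf
  33391141468418441839517728969665916223497857292459117264613847711496697132738576425608417337457)
  (.leaf
  33393114846974947140965122778066851376486360271339048947779914354577975234487519572294447878615))))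
  (.node (.node (.node (.leaf
  33379874113887635934709868917620019253899900596272099952364078269304326348793970702354159228747)
  (.leaf
  33379874113887635934709868917620019253899900596272099952364078269304326348793970702354159228747)
  (.leaf
  33399480581289692103186521761553206847451455550092196480923145078493404138563208818340295278738))
  (.node (.leaf
  33379874113887635934709868917620019253899900596272099952364078269304326348793970702354159228747)
  (.leaf
  33355493336965772645630237569005521880108646411380050399341150419709767104067179721565483872489)
  (.leaf
  33404573143775152326147377007076038116979870486455440781505600656519311962081665884595646730564))
  (.node (.leaf
  33345817425032670989405220199220323883355756902046958004941167763128231701745939010264901820259)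
  .nil (.leaf
  33357848680393562307161193326802652359944925780019983829479341518526898357342696644533690536579)))
  (.node (.node (.leaf
  33379874113887635934709868917620019253899900596272099952364078269304326348793970702354159228747)
  (.leaf
  33354793104027662983036535451239495409735124072744116876762369714244140627303998039057354554715)
  .nil) (.node (.leaf
  33383598052646083934510450602253297958284075777573305848486458391050000334291357630043742319012)
  (.leaf
  33335600381996677647755389523230998389570073730136608214869217735761909737999170868444170154480)
  .nil) .nil) (.node (.node (.leaf
  33369879908132126499655881953997371710483631452411042483196651954862326957870570384825120699009)
  (.leaf
  33400180827416704122869091117630239025700572132014086009063971359054240635105496529550051481292)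
  (.leaf
  33385507777607460116708082161846851073884257394484524207857421383072807363233753996461104685596))
  (.node (.leaf
  33332799443384165473790306091832784810371131654880058360228339970241925652121652301907599865644)
  (.leaf
  33383693522118882234738469885591440655102720093570896786406261550574086999267290854060400492381)
  (.leaf
  33383693522118882234738469885591440655102720093570896786406261550574086999267290854060400492381))
  (.node (.leaf
  33342220775388633384900660834549283140953648510488920997610474826744131703305093218768933321214)
  .nil (.leaf
  33399480588817547774702433765516448687023205517338763006172161440875341254327774256079400053175))))
  (.node (.node (.node (.leaf
  33384807560362464971319602264626109945418701893485560307115331937624333121658917868060661504531)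
  (.leaf
  33384807560362464971319602264626109945418701893485560307115331937624333121658917868060661504531)
  (.leaf
  33377709748061563480895462603053604803240436445751033551156484775021448086423538755771684554891))
  (.node (.leaf
  33384807560362464971319602264626109945418701893485560307115331937624333121658917868060661504531)
  (.leaf
  33393146671093783243505149136889157171127894862642731097872462269597535257517333467189381947323)
  .nil) (.node (.leaf
  33392573765819883606793080465250545479673170724451464024851608161014820151204952885618126342366)
  (.leaf
  33393114846974959277423475967347677731708996853686471679263538565741390393795151854728146538965)
  (.leaf
  33391173297105509349972493745765220996242284101332253862849045486490104785973737607189882691700)))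
  (.node (.node (.leaf
  33384807560362464971319602264626109945418701893485560307115331937624333121658917868060661504531)
  (.leaf
  33393146671093769001078172952052110071986965939654017586252997908357488970625837619226830954431)
  .nil) (.node (.leaf
  33340088282840008080750797334911361157183878669402219283902058165922761293334758817252850578872)
  (.leaf
  33424084188935530441518183237727011311722999147627050023023629448415229053615342183079581055506)
  .nil) (.node (.leaf
  33342220775388619706960119665285537468405143461055228495827985524461591015819091366431643630079)
  (.leaf
  33399480588817521808326422291524665790970556723698793328752094346179931451418021030413911173559)
  .nil)) (.node (.node (.leaf
  33392573765819901742729057266935831183588812640669546359257144712135075365351288066645236369629)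
  (.leaf
  33393114846974947140965122778066851376486360271339048947779914354577975234487519572294447878615)
  (.leaf
  33391141468418441839517728969665916223497857292459117264613847711496697132738576425608417337457))
  (.node (.leaf
  33342220775388633384900660834549283140953648510488920997610474826744131703305093218768933321214)
  (.leaf
  33399480588817547774702433765516448687023205517338763006172161440875341254327774256079400053175)
  .nil) (.node (.leaf
  33361095177310454415380119744953550973454765796061682647777417112345840955066577716284681643445)
  (.leaf
  33461864824547267852998957829633354052887714965787778408948032988224336526674304193861434425386)
  (.leaf
  33461864824547267852998957829633354052887714965787778408948032988224336526674304193861434425386)))))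

/-- The coefficient vectors attached to an arc. -/
def arcTree : FlagTree :=
  .node (.node (.node (.node (.node (.leaf
  33374813350129706640731974024786706887633104411895743302727259735289568132740665134772814604014)
  (.leaf
  33374813350129706640731974024786706887633104411895743302727259735289568132740665134772814604014)
  (.leaf
  33374813350129706640731974024786706887633104411895743302727259735289568132740665134772814604014))
  (.node (.leaf
  33374813350129706640731974024786706887633104411895743302727259735289568132740665134772814604014)
  (.leaf
  33374813360966162236223469660304777588856460265681482738066807752911929693122525391669653693279)
  (.leaf
  33374813350129706640731974024786706887633104411895743302727259735289568132740665134772814604014))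
  (.node (.leaf
  33374813350266297630701001343562016452166010043358142141601906134596715179821208284806025044911)
  (.leaf
  33374813342753635589242405292039730795290171238965192942923365249645953145208107493944506523953)
  (.leaf
  33374813350266297630701001343562016452166010043358142141601906134596715179821208284806025044911)))
  (.node (.node (.leaf
  33374813350129706640731974024786706887633104411895743302727259735289568132740665134772814604014)
  (.leaf
  33374813348065614262989684889669954363232734217804839574749282259416509659881599607745490712140)
  (.leaf
  33374813350129706640731974024786706887633104411895743302727259735289568132740665134772814604014))
  (.node (.leaf
  33374813353362436635163523284005642057319739565251739020409423334796858508948912790959679355577)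
  (.leaf
  33374813361831254842380159450676545830584269057741284776952610814510204661907076500400565690682)
  (.leaf
  33374813353362436635163523284005642057319739565251739020409423334796858508948912790959679355577))
  (.node (.leaf
  33374813340856499034072612811676825384255463811507070220769845507071666631787865458427324004636)
  (.leaf
  33374813344438295831771039429101868553320342849014484913031786329351983682327184644518582490660)
  (.leaf
  33374813340856499034072612811676825384255463811507070220769845507071666631787865458427324004636)))
  (.node (.node (.leaf
  33374813351055508677420754528601920674185752017086016908106418409384198586217039693923497262795)
  (.leaf
  33374813354288233070410459702921342157022471464826911004583494481870668084745602676710693671654)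
  (.leaf
  33374813351055508677420754528601920674185752017086016908106418409384198586217039693923497262795))
  .nil (.node (.leaf
  33374813358552992033251647889213065438742757891618648766259244922147697311458570703535961262821)
  (.leaf
  33374813344149910791961214803188339193139244968881685725543652153440330092259638286514572562664)
  (.leaf
  33374813358552992033251647889213065438742757891618648766259244922147697311458570703535961262821))))
  (.node (.node (.node (.leaf
  33374813350129706640731974024786706887633104411895743302727259735289568132740665134772814604014)
  (.leaf
  33374813350129706640731974024786706887633104411895743302727259735289568132740665134772814604014)
  (.leaf
  33374813360966162236223469660304777588856460265681482738066807752911929693122525391669653693279))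
  (.node (.leaf
  33374813350129706640731974024786706887633104411895743302727259735289568132740665134772814604014)
  (.leaf
  33374813354439997636682014759579556084844556139047555306695552134331143034963862514985765637188)
  (.leaf
  33374813354439997636682014759579556084844556139047555306695552134331143034963862514985765637188))
  (.node (.leaf
  33374813350266297630701001343562016452166010043358142141601906134596715179821208284806025044911)
  .nil (.leaf
  33374813372227577049930088861214890637017371754982029093962600764317594877674475791980948347381)))
  (.node (.node (.leaf
  33374813350129706640731974024786706887633104411895743302727259735289568132740665134772814604014)
  (.leaf
  33374813352011664336595585491155135229995304908015949316126131496452923967057233937981336737841)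
  (.leaf
  33374813364805971200802908096161942103888560214939083901081041920398234773792810640134785555570))
  (.node (.leaf
  33374813353362436635163523284005642057319739565251739020409423334796858508948912790959679355577)
  (.leaf
  33374813367780662729088701492708966853393147189501779715321514328087184720623777172210385315107)
  (.leaf
  33374813341478744835636336987531268838146651324125620395513532376717726363132698077534381759455))
  (.node (.leaf
  33374813340856499034072612811676825384255463811507070220769845507071666631787865458427324004636)
  .nil (.leaf
  33374813392185462116430707220900885371842521957407292666694202293147329239339401093864504763753)))
  (.node (.node (.leaf
  33374813351055508677420754528601920674185752017086016908106418409384198586217039693923497262795)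
  .nil (.leaf
  33374813359949283656735484303891049904980359431389200839646213287232336580602081939307422001339))
  .nil (.node (.leaf
  33374813358552992033251647889213065438742757891618648766259244922147697311458570703535961262821)
  .nil (.leaf
  33374813346851452827206781893669725705333137631821454081371508476349494834734645101906931661826))))
  (.node (.node (.node (.leaf
  33374813350266297630701001343562016452166010043358142141601906134596715179821208284806025044911)
  (.leaf
  33374813350266297630701001343562016452166010043358142141601906134596715179821208284806025044911)
  (.leaf
  33374813342753635589242405292039730795290171238965192942923365249645953145208107493944506523953))
  (.node (.leaf
  33374813350266297630701001343562016452166010043358142141601906134596715179821208284806025044911)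
  (.leaf
  33374813372227577049930088861214890637017371754982029093962600764317594877674475791980948347381)
  .nil) (.node (.leaf
  33374813365549639467481273037364341394742140166366624468246039321466417058539953479240077279768)
  (.leaf
  33374813360404603466668187732513580263740930080751396916788681274443747888393835955980633953316)
  (.leaf
  33374813360404603466668187732513580263740930080751396916788681274443747888393835955980633953316)))
  (.node (.node (.leaf
  33374813350266297630701001343562016452166010043358142141601906134596715179821208284806025044911)
  (.leaf
  33374813327227449835445898535426052620286020017102535974390180825162706249990162608526877246047)
  (.leaf
  33374813346396144082650588641800260981663691213351330392842977174608858195556774575312764708096))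
  (.node (.leaf
  33374813334482105347638414738187353662049784689294827220247201427085736386128869354620404640318)
  (.leaf
  33374813334497287890580558834997325040554871487045467423986004551450764607447185414504317967437)
  .nil) (.node (.leaf
  33374813367234310666835592074327452719538985916077794742468906760156730025376650842619560042585)
  (.leaf
  33374813359463639744084569388424503712598431451780612705103659666386563358388878976471637417541)
  (.leaf
  33374813377736861224554327803389913015151132301920074391742958195797135749733954815969366898067)))
  (.node (.node (.leaf
  33374813353149951746656524407868819008811719013485221190129355664460757210890524876617810982785)
  (.leaf
  33374813366596865489041151030685205420134442059848792845355350438845685372374196307955075263425)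
  (.leaf
  33374813345682821094208467107237627079654586740378605194437858381721449449051536099295294928354))
  .nil (.node (.leaf
  33374813351708143070681019864364799759124802963943587062991397226202285380631554467902268660376)
  (.leaf
  33374813360404600962659971984819864779211106825890993744701321256363908610550567454542933274250)
  (.leaf
  33374813331583310388370624899520316692912677688626430145849226510446902613244373190231559512452)))))
  (.node (.node (.node (.node (.leaf
  33374813350129706640731974024786706887633104411895743302727259735289568132740665134772814604014)
  (.leaf
  33374813350129706640731974024786706887633104411895743302727259735289568132740665134772814604014)
  (.leaf
  33374813348065614262989684889669954363232734217804839574749282259416509659881599607745490712140))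
  (.node (.leaf
  33374813350129706640731974024786706887633104411895743302727259735289568132740665134772814604014)
  (.leaf
  33374813364805971200802908096161942103888560214939083901081041920398234773792810640134785555570)
  (.leaf
  33374813352011664336595585491155135229995304908015949316126131496452923967057233937981336737841))
  (.node (.leaf
  33374813350266297630701001343562016452166010043358142141601906134596715179821208284806025044911)
  (.leaf
  33374813346396144082650588641800260981663691213351330392842977174608858195556774575312764708096)
  (.leaf
  33374813327227449835445898535426052620286020017102535974390180825162706249990162608526877246047)))
  (.node (.node (.leaf
  33374813350129706640731974024786706887633104411895743302727259735289568132740665134772814604014)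
  (.leaf
  33374813351981298389491059043147014385721961460057251145547992556346021631787948229897336406352)
  (.leaf
  33374813351981298389491059043147014385721961460057251145547992556346021631787948229897336406352))
  (.node (.leaf
  33374813353362436635163523284005642057319739565251739020409423334796858508948912790959679355577)
  (.leaf
  33374813350175246120699064020525668800990678138992258729629981712504978745050697337689980620645)
  (.leaf
  33374813373107840793508695360226067642593097453790752777072260573353187894926288475731786776268))
  (.node (.leaf
  33374813340856499034072612811676825384255463811507070220769845507071666631787865458427324004636)
  (.leaf
  33374813345804221848291557817949308615120508846621779805525541543609684539521917250966761058417)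
  (.leaf
  33374813335984620371201197036933181962566209267364312235888657479081335412560151195472972767667)))
  (.node (.node (.leaf
  33374813351055508677420754528601920674185752017086016908106418409384198586217039693923497262795)
  .nil (.leaf
  33374813348961063791690400776736318373167553146955604515988941045897748044429424382935313684123))
  .nil (.node (.leaf
  33374813358552992033251647889213065438742757891618648766259244922147697311458570703535961262821)
  .nil (.leaf
  33374813341903709886870488195626290161813431911796592454868326809012123457248644352852458776416))))
  (.node (.node (.node (.leaf
  33374813353362436635163523284005642057319739565251739020409423334796858508948912790959679355577)
  (.leaf
  33374813353362436635163523284005642057319739565251739020409423334796858508948912790959679355577)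
  (.leaf
  33374813361831254842380159450676545830584269057741284776952610814510204661907076500400565690682))
  (.node (.leaf
  33374813353362436635163523284005642057319739565251739020409423334796858508948912790959679355577)
  (.leaf
  33374813341478744835636336987531268838146651324125620395513532376717726363132698077534381759455)
  (.leaf
  33374813367780662729088701492708966853393147189501779715321514328087184720623777172210385315107))
  (.node (.leaf
  33374813334482105347638414738187353662049784689294827220247201427085736386128869354620404640318)
  .nil (.leaf
  33374813334497287890580558834997325040554871487045467423986004551450764607447185414504317967437)))
  (.node (.node (.leaf
  33374813353362436635163523284005642057319739565251739020409423334796858508948912790959679355577)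
  (.leaf
  33374813373107840793508695360226067642593097453790752777072260573353187894926288475731786776268)
  (.leaf
  33374813350175246120699064020525668800990678138992258729629981712504978745050697337689980620645))
  (.node (.leaf
  33374813381773997951055993564562385751646058457212384883708847359457225890391150356723397588983)
  (.leaf
  33374813374064006924615958129976028351524062339439329124333615874896127216679837468107863992071)
  (.leaf
  33374813374064006924615958129976028351524062339439329124333615874896127216679837468107863992071))
  (.node (.leaf
  33374813351055501208830008319623949588338511882582883069776003112254797352303768073156422534127)
  .nil (.leaf
  33374813374063982188521508430724902591532628720955903231581118642693813086740260041230210052593)))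
  (.node (.node (.leaf
  33374813342101023970852740319695800080447423406239583995736632120154079323290065346046066686262)
  .nil (.leaf
  33374813357445058824620054789691438538524136135299781954016698867815118322738987535422597352585))
  .nil (.node (.leaf
  33374813353878439576342471278590496778683190430298086054745430098898118821978293936731607559814)
  .nil (.leaf
  33374813330384294456540507875679926865122865912724216577042337317480798214735270980879406628740))))
  (.node (.node (.node (.leaf
  33374813340856499034072612811676825384255463811507070220769845507071666631787865458427324004636)
  (.leaf
  33374813340856499034072612811676825384255463811507070220769845507071666631787865458427324004636)
  (.leaf
  33374813344438295831771039429101868553320342849014484913031786329351983682327184644518582490660))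
  (.node (.leaf
  33374813340856499034072612811676825384255463811507070220769845507071666631787865458427324004636)
  (.leaf
  33374813392185462116430707220900885371842521957407292666694202293147329239339401093864504763753)
  .nil) (.node (.leaf
  33374813367234310666835592074327452719538985916077794742468906760156730025376650842619560042585)
  (.leaf
  33374813377736861224554327803389913015151132301920074391742958195797135749733954815969366898067)
  (.leaf
  33374813359463639744084569388424503712598431451780612705103659666386563358388878976471637417541)))
  (.node (.node (.leaf
  33374813340856499034072612811676825384255463811507070220769845507071666631787865458427324004636)
  (.leaf
  33374813335984620371201197036933181962566209267364312235888657479081335412560151195472972767667)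
  (.leaf
  33374813345804221848291557817949308615120508846621779805525541543609684539521917250966761058417))
  (.node (.leaf
  33374813351055501208830008319623949588338511882582883069776003112254797352303768073156422534127)
  (.leaf
  33374813374063982188521508430724902591532628720955903231581118642693813086740260041230210052593)
  .nil) (.node (.leaf
  33374813352193828219795791422557791036716735818629159995789770874352372701768866614568203267819)
  (.leaf
  33374813384915619451302367907895526290815283912314813858511709533912873204016112753375185999969)
  (.leaf
  33374813384915619451302367907895526290815283912314813858511709533912873204016112753375185999969)))
  (.node (.node (.leaf
  33374813329989687891045871944142277582716054407066854883203840904243738746496248282102637834000)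
  .nil (.leaf
  33374813344165092133564053026150765279911114016313798741723895956254200739491929032110029980398))
  .nil (.node (.leaf
  33374813357885222340229304748469903269099660282814662529172809940120067566562004975696380698219)
  .nil (.leaf
  33374813361649150396709886650399571129211458641323671114941134829058141655070879333713362035126)))))
  (.node (.node (.node (.node (.leaf
  33374813351055508677420754528601920674185752017086016908106418409384198586217039693923497262795)
  (.leaf
  33374813351055508677420754528601920674185752017086016908106418409384198586217039693923497262795)
  (.leaf
  33374813354288233070410459702921342157022471464826911004583494481870668084745602676710693671654))
  (.node (.leaf
  33374813351055508677420754528601920674185752017086016908106418409384198586217039693923497262795)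
  (.leaf
  33374813359949283656735484303891049904980359431389200839646213287232336580602081939307422001339)
  .nil) (.node (.leaf
  33374813353149951746656524407868819008811719013485221190129355664460757210890524876617810982785)
  (.leaf
  33374813345682821094208467107237627079654586740378605194437858381721449449051536099295294928354)
  (.leaf
  33374813366596865489041151030685205420134442059848792845355350438845685372374196307955075263425)))
  (.node (.node (.leaf
  33374813351055508677420754528601920674185752017086016908106418409384198586217039693923497262795)
  (.leaf
  33374813348961063791690400776736318373167553146955604515988941045897748044429424382935313684123)
  .nil) (.node (.leaf
  33374813342101023970852740319695800080447423406239583995736632120154079323290065346046066686262)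
  (.leaf
  33374813357445058824620054789691438538524136135299781954016698867815118322738987535422597352585)
  .nil) (.node (.leaf
  33374813329989687891045871944142277582716054407066854883203840904243738746496248282102637834000)
  (.leaf
  33374813344165092133564053026150765279911114016313798741723895956254200739491929032110029980398)
  .nil)) (.node (.node (.leaf
  33374813357718267045952735268759405243185898632837763626697990976421931409273703583602546005424)
  (.leaf
  33374813344802558045382699696983620619505290205786262585069266370526781318540914756737058230744)
  (.leaf
  33374813344802558045382699696983620619505290205786262585069266370526781318540914756737058230744))
  .nil (.node (.leaf
  33374813349886877964834794473216975089198244258333085314098568869068811842512099036713666443940)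
  (.leaf
  33374813333814317482491219196464984040139903551897330016919414446863368470475279376906196087830)
  (.leaf
  33374813325421403855619918429940023119475088329146151360029996603066614779289067576014853340092))))
  .nil (.node (.node (.node (.leaf
  33374813358552992033251647889213065438742757891618648766259244922147697311458570703535961262821)
  (.leaf
  33374813358552992033251647889213065438742757891618648766259244922147697311458570703535961262821)
  (.leaf
  33374813344149910791961214803188339193139244968881685725543652153440330092259638286514572562664))
  (.node (.leaf
  33374813358552992033251647889213065438742757891618648766259244922147697311458570703535961262821)
  (.leaf
  33374813346851452827206781893669725705333137631821454081371508476349494834734645101906931661826)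
  .nil) (.node (.leaf
  33374813351708143070681019864364799759124802963943587062991397226202285380631554467902268660376)
  (.leaf
  33374813331583310388370624899520316692912677688626430145849226510446902613244373190231559512452)
  (.leaf
  33374813360404600962659971984819864779211106825890993744701321256363908610550567454542933274250)))
  (.node (.node (.leaf
  33374813358552992033251647889213065438742757891618648766259244922147697311458570703535961262821)
  (.leaf
  33374813341903709886870488195626290161813431911796592454868326809012123457248644352852458776416)
  .nil) (.node (.leaf
  33374813353878439576342471278590496778683190430298086054745430098898118821978293936731607559814)
  (.leaf
  33374813330384294456540507875679926865122865912724216577042337317480798214735270980879406628740)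
  .nil) (.node (.leaf
  33374813357885222340229304748469903269099660282814662529172809940120067566562004975696380698219)
  (.leaf
  33374813361649150396709886650399571129211458641323671114941134829058141655070879333713362035126)
  .nil)) (.node (.node (.leaf
  33374813349886877964834794473216975089198244258333085314098568869068811842512099036713666443940)
  (.leaf
  33374813325421403855619918429940023119475088329146151360029996603066614779289067576014853340092)
  (.leaf
  33374813333814317482491219196464984040139903551897330016919414446863368470475279376906196087830))
  .nil (.node (.leaf
  33374813295203797370464658374311319363252232582848709859448650258455994409777702277500004999521)
  (.leaf
  33374813301031786207916071488538507668484778485305951113048606222808642623730954992766440885969)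
  (.leaf
  33374813301031786207916071488538507668484778485305951113048606222808642623730954992766440885969)))))

/-- The tree of all two-vertex bases. -/
def pairTree : FlagTree := .node nonArcTree arcTree .nil

/-- The digit of `w` at position `k` in base `2 ^ 21`. -/
def digit (k w : ℕ) : ℕ := w / 2097152 ^ k % 2097152

/-- The digits of `w` at the listed positions, repacked in base `2 ^ 64`. -/
noncomputable def pack (l : List ℕ) (w : ℕ) : ℕ :=
  List.rec 0 (fun k _ r => Nat.add (digit k w) (Nat.mul 18446744073709551616 r)) l

/-- The residue modulo `2 ^ 960` that removes the offset from fifteen packed digits. -/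
def offset : ℕ := 2 ^ 960 - 2 ^ 20 * ((2 ^ 960 - 1) / (2 ^ 64 - 1))

/-- The pairing of coordinates used for four-vertex bases. -/
def dual (k : ℕ) : ℕ := if k < 7 then k else if k < 11 then k + 4 else k - 4

namespace FlagTree

/-- One more than the number stored at a leaf, and zero for other trees. -/
noncomputable def weight (t : FlagTree) : ℕ :=
  FlagTree.rec 0 (fun w => Nat.succ w) (fun _ _ _ _ _ _ => 0) t

/-- The vector stored at a leaf, packed in base `2 ^ 64` modulo `2 ^ 960`. -/
noncomputable def up (t : FlagTree) : ℕ :=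
  FlagTree.rec 0 (fun w => Nat.add (pack [0, 1, 2, 3, 4, 5, 6, 7, 8, 9, 10, 11, 12, 13, 14] w)
    offset)
    (fun _ _ _ _ _ _ => 0) t

/-- The vector stored at a leaf, packed in reverse order. -/
noncomputable def down (t : FlagTree) : ℕ :=
  FlagTree.rec 0 (fun w => Nat.add (pack [14, 13, 12, 11, 10, 9, 8, 7, 6, 5, 4, 3, 2, 1, 0] w)
    offset)
    (fun _ _ _ _ _ _ => 0) t

/-- The vector stored at a leaf, with coordinates exchanged by `dual`, packed in reverse order. -/
noncomputable def downDual (t : FlagTree) : ℕ :=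
  FlagTree.rec 0 (fun w => Nat.add (pack [10, 9, 8, 7, 14, 13, 12, 11, 6, 5, 4, 3, 2, 1, 0] w)
    offset)
    (fun _ _ _ _ _ _ => 0) t

end FlagTree

/-- The packed pairing of two vectors of the flag tree `t`; it is skipped when `t` is trivial. -/
noncomputable def packedFlagPair (t : FlagTree) (z₀ z₁ z₂ z₃ w₀ w₁ w₂ w₃ : ArcType) : ℕ :=
  FlagTree.rec 0 (fun _ => 0)
    (fun _ _ _ _ _ _ => Nat.mul (t.sel4 z₀ z₁ z₂ z₃).up (t.sel4 w₀ w₁ w₂ w₃).downDual) t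

/-- The packed sum over all orderings of a four-vertex base `p q r s` with further vertices
`z` and `w`. -/
noncomputable def packedQuad
    (pq pr ps qp qr qs rp rq rs sp sq sr pz qz rz sz pw qw rw sw : ArcType) : ℕ :=
  (Nat.add (Nat.add (Nat.add (Nat.add (packedFlagPair (baseTree.sel6 pq pr qr ps qs rs) pz qz rz
  sz pw qw rw sw) (Nat.add (packedFlagPair (baseTree.sel6 pq ps qs pr qr sr) pz qz sz rz pw qw sw
  rw) (packedFlagPair (baseTree.sel6 pr pq rq ps rs qs) pz rz qz sz pw rw qw sw))) (Nat.add
  (packedFlagPair (baseTree.sel6 pr ps rs pq rq sq) pz rz sz qz pw rw sw qw) (Nat.add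
  (packedFlagPair (baseTree.sel6 ps pq sq pr sr qr) pz sz qz rz pw sw qw rw) (packedFlagPair
  (baseTree.sel6 ps pr sr pq sq rq) pz sz rz qz pw sw rw qw)))) (Nat.add (Nat.add (packedFlagPair
  (baseTree.sel6 qp qr pr qs ps rs) qz pz rz sz qw pw rw sw) (Nat.add (packedFlagPair
  (baseTree.sel6 qp qs ps qr pr sr) qz pz sz rz qw pw sw rw) (packedFlagPair (baseTree.sel6 qr qp
  rp qs rs ps) qz rz pz sz qw rw pw sw))) (Nat.add (packedFlagPair (baseTree.sel6 qr qs rs qp rp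
  sp) qz rz sz pz qw rw sw pw) (Nat.add (packedFlagPair (baseTree.sel6 qs qp sp qr sr pr) qz sz
  pz rz qw sw pw rw) (packedFlagPair (baseTree.sel6 qs qr sr qp sp rp) qz sz rz pz qw sw rw
  pw))))) (Nat.add (Nat.add (Nat.add (packedFlagPair (baseTree.sel6 rp rq pq rs ps qs) rz pz qz
  sz rw pw qw sw) (Nat.add (packedFlagPair (baseTree.sel6 rp rs ps rq pq sq) rz pz sz qz rw pw sw
  qw) (packedFlagPair (baseTree.sel6 rq rp qp rs qs ps) rz qz pz sz rw qw pw sw))) (Nat.add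
  (packedFlagPair (baseTree.sel6 rq rs qs rp qp sp) rz qz sz pz rw qw sw pw) (Nat.add
  (packedFlagPair (baseTree.sel6 rs rp sp rq sq pq) rz sz pz qz rw sw pw qw) (packedFlagPair
  (baseTree.sel6 rs rq sq rp sp qp) rz sz qz pz rw sw qw pw)))) (Nat.add (Nat.add (packedFlagPair
  (baseTree.sel6 sp sq pq sr pr qr) sz pz qz rz sw pw qw rw) (Nat.add (packedFlagPair
  (baseTree.sel6 sp sr pr sq pq rq) sz pz rz qz sw pw rw qw) (packedFlagPair (baseTree.sel6 sq sp
  qp sr qr pr) sz qz pz rz sw qw pw rw))) (Nat.add (packedFlagPair (baseTree.sel6 sq sr qr sp qp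
  rp) sz qz rz pz sw qw rw pw) (Nat.add (packedFlagPair (baseTree.sel6 sr sp rp sq rq pq) sz rz
  pz qz sw rw pw qw) (packedFlagPair (baseTree.sel6 sr sq rq sp rp qp) sz rz qz pz sw rw qw
  pw))))))

/-- The packed sum over both orderings of a base `p q` and all splittings of the further vertices
`r s t u` into two pairs. -/
noncomputable def packedPair
    (pq qp pr qr ps qs pt qt pu qu rs rt ru st su tu : ArcType) : ℕ :=
  (Nat.add (Nat.add (Nat.mul ((pairTree.sel pq).sel5 pr qr ps qs rs).up ((pairTree.sel pq).sel5
  pt qt pu qu tu).down) (Nat.add (Nat.mul ((pairTree.sel pq).sel5 pr qr pt qt rt).up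
  ((pairTree.sel pq).sel5 ps qs pu qu su).down) (Nat.mul ((pairTree.sel pq).sel5 pr qr pu qu
  ru).up ((pairTree.sel pq).sel5 ps qs pt qt st).down))) (Nat.add (Nat.mul ((pairTree.sel
  qp).sel5 qr pr qs ps rs).up ((pairTree.sel qp).sel5 qt pt qu pu tu).down) (Nat.add (Nat.mul
  ((pairTree.sel qp).sel5 qr pr qt pt rt).up ((pairTree.sel qp).sel5 qs ps qu pu su).down)
  (Nat.mul ((pairTree.sel qp).sel5 qr pr qu pu ru).up ((pairTree.sel qp).sel5 qs ps qt pt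
  st).down))))

/-- The packed sum over all placements of both kinds of bases in six vertices. -/
noncomputable def packedTotal
    (ab ac ad ae ag ba bc bd be bg ca cb cd ce cg da db dc de dg ea eb ec ed eg ga gb gc gd ge :
    ArcType) : ℕ :=
  (Nat.add (Nat.add (Nat.add (Nat.add (packedQuad cd ce cg dc de dg ec ed eg gc gd ge ca da ea ga
  cb db eb gb) (Nat.add (packedQuad bd be bg db de dg eb ed eg gb gd ge ba da ea ga bc dc ec gc)
  (packedQuad bc be bg cb ce cg eb ec eg gb gc ge ba ca ea ga bd cd ed gd))) (Nat.add (Nat.add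
  (packedQuad bc bd bg cb cd cg db dc dg gb gc gd ba ca da ga be ce de ge) (packedQuad bc bd be
  cb cd ce db dc de eb ec ed ba ca da ea bg cg dg eg)) (Nat.add (packedQuad ad ae ag da de dg ea
  ed eg ga gd ge ab db eb gb ac dc ec gc) (packedQuad ac ae ag ca ce cg ea ec eg ga gc ge ab cb
  eb gb ad cd ed gd)))) (Nat.add (Nat.add (Nat.add (packedQuad ac ad ag ca cd cg da dc dg ga gc
  gd ab cb db gb ae ce de ge) (packedQuad ac ad ae ca cd ce da dc de ea ec ed ab cb db eb ag cg
  dg eg)) (Nat.add (packedQuad ab ae ag ba be bg ea eb eg ga gb ge ac bc ec gc ad bd ed gd)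
  (packedQuad ab ad ag ba bd bg da db dg ga gb gd ac bc dc gc ae be de ge))) (Nat.add (Nat.add
  (packedQuad ab ad ae ba bd be da db de ea eb ed ac bc dc ec ag bg dg eg) (packedQuad ab ac ag
  ba bc bg ca cb cg ga gb gc ad bd cd gd ae be ce ge)) (Nat.add (packedQuad ab ac ae ba bc be ca
  cb ce ea eb ec ad bd cd ed ag bg cg eg) (packedQuad ab ac ad ba bc bd ca cb cd da db dc ae be
  ce de ag bg cg dg))))) (Nat.add (Nat.add (Nat.add (packedPair ab ba ac bc ad bd ae be ag bg cd
  ce cg de dg eg) (Nat.add (packedPair ac ca ab cb ad cd ae ce ag cg bd be bg de dg eg)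
  (packedPair ad da ab db ac dc ae de ag dg bc be bg ce cg eg))) (Nat.add (Nat.add (packedPair ae
  ea ab eb ac ec ad ed ag eg bc bd bg cd cg dg) (packedPair ag ga ab gb ac gc ad gd ae ge bc bd
  be cd ce de)) (Nat.add (packedPair bc cb ba ca bd cd be ce bg cg ad ae ag de dg eg) (packedPair
  bd db ba da bc dc be de bg dg ac ae ag ce cg eg)))) (Nat.add (Nat.add (Nat.add (packedPair be
  eb ba ea bc ec bd ed bg eg ac ad ag cd cg dg) (packedPair bg gb ba ga bc gc bd gd be ge ac ad
  ae cd ce de)) (Nat.add (packedPair cd dc ca da cb db ce de cg dg ab ae ag be bg eg) (packedPair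
  ce ec ca ea cb eb cd ed cg eg ab ad ag bd bg dg))) (Nat.add (Nat.add (packedPair cg gc ca ga cb
  gb cd gd ce ge ab ad ae bd be de) (packedPair de ed da ea db eb dc ec dg eg ab ac ag bc bg cg))
  (Nat.add (packedPair dg gd da ga db gb dc gc de ge ab ac ae bc be ce) (packedPair eg ge ea ga
  eb gb ec gc ed gd ab ac ad bc bd cd))))))

/-- The test that a packed sum encodes a negative leading value. -/
noncomputable def packedNeg (N : ℕ) : Bool :=
  and (Nat.ble (2 ^ 959) (Nat.mod N (2 ^ 960))) (Nat.ble (Nat.mod N (2 ^ 960)) (2 ^ 960 - 2 ^ 896))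

/-- The test that a Boolean function holds at both possible relations of an increasing pair. -/
def bothArcs (k : ArcType → ArcType → Bool) : Bool :=
  and (k .o .o) (k .f .b)

/-- The test that a relation is not an arc. -/
noncomputable def ArcType.isNone (d : ArcType) : Bool :=
  ArcType.rec true false false d

/-- The bit of a forward arc. -/
noncomputable def ArcType.bit (d : ArcType) : ℕ :=
  ArcType.rec 0 1 0 d

/-- The binary code of the relations among five ordered vertices. -/
noncomputable def arcCode (ab ac bc ad bd cd ae be ce de : ArcType) : ℕ :=
  Nat.add (Nat.mul 2 (Nat.add (Nat.mul 2 (Nat.add (Nat.mul 2 (Nat.add (Nat.mul 2 (Nat.add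
  (Nat.mul 2 (Nat.add (Nat.mul 2 (Nat.add (Nat.mul 2 (Nat.add (Nat.mul 2 (Nat.add (Nat.mul 2
  ab.bit) ac.bit)) bc.bit)) ad.bit)) bd.bit)) cd.bit)) ae.bit)) be.bit)) ce.bit)) de.bit

/-- The test that exchanging consecutive non-adjacent vertices does not increase the code. -/
noncomputable def arcCodeLocalMax (ab ac bc ad bd cd ae be ce de : ArcType) : Bool :=
  and (and (or (not ab.isNone) (Nat.ble (arcCode ab bc ac bd ad cd be ae ce de) (arcCode ab ac bc
    ad bd cd ae be ce de)))
      (or (not bc.isNone) (Nat.ble (arcCode ac ab bc ad cd bd ae ce be de) (arcCode ab ac bc ad bd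
        cd ae be ce de))))
    (and (or (not cd.isNone) (Nat.ble (arcCode ab ad bd ac bc cd ae be de ce) (arcCode ab ac bc ad
      bd cd ae be ce de)))
      (or (not de.isNone) (Nat.ble (arcCode ab ac bc ae be ce ad bd cd de) (arcCode ab ac bc ad bd
        cd ae be ce de))))

/-- The negativity test for all locally maximal transitive orders with four given relations. -/
noncomputable def acyclicCheck (ab ba ac ca bc cb ad da : ArcType) : Bool :=
  bothArcs fun bd db =>  bothArcs fun cd dc =>
  bothArcs fun ae ea =>  bothArcs fun be eb =>
  bothArcs fun ce ec =>  bothArcs fun de ed =>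
  or (not (arcCodeLocalMax ab ac bc ad bd cd ae be ce de)) <|
  bothArcs fun ag ga =>  bothArcs fun bg gb =>
  bothArcs fun cg gc =>  bothArcs fun dg gd =>
  bothArcs fun eg ge =>
  packedNeg (packedTotal ab ac ad ae ag ba bc bd be bg ca cb cd ce cg da db dc de dg ea eb ec ed eg
    ga gb gc gd ge)

theorem acyclicCheck_oooo : acyclicCheck .o .o .o .o .o .o .o .o = true := by
  decide +kernel

theorem acyclicCheck_ooof : acyclicCheck .o .o .o .o .o .o .f .b = true := by
  decide +kernel

theorem acyclicCheck_oofo : acyclicCheck .o .o .o .o .f .b .o .o = true := by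
  decide +kernel

theorem acyclicCheck_ooff : acyclicCheck .o .o .o .o .f .b .f .b = true := by
  decide +kernel

theorem acyclicCheck_ofoo : acyclicCheck .o .o .f .b .o .o .o .o = true := by
  decide +kernel

theorem acyclicCheck_ofof : acyclicCheck .o .o .f .b .o .o .f .b = true := by
  decide +kernel

theorem acyclicCheck_offo : acyclicCheck .o .o .f .b .f .b .o .o = true := by
  decide +kernel

theorem acyclicCheck_offf : acyclicCheck .o .o .f .b .f .b .f .b = true := by
  decide +kernel

theorem acyclicCheck_fooo : acyclicCheck .f .b .o .o .o .o .o .o = true := by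
  decide +kernel

theorem acyclicCheck_foof : acyclicCheck .f .b .o .o .o .o .f .b = true := by
  decide +kernel

theorem acyclicCheck_fofo : acyclicCheck .f .b .o .o .f .b .o .o = true := by
  decide +kernel

theorem acyclicCheck_foff : acyclicCheck .f .b .o .o .f .b .f .b = true := by
  decide +kernel

theorem acyclicCheck_ffoo : acyclicCheck .f .b .f .b .o .o .o .o = true := by
  decide +kernel

theorem acyclicCheck_ffof : acyclicCheck .f .b .f .b .o .o .f .b = true := by
  decide +kernel

theorem acyclicCheck_fffo : acyclicCheck .f .b .f .b .f .b .o .o = true := by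
  decide +kernel

theorem acyclicCheck_ffff : acyclicCheck .f .b .f .b .f .b .f .b = true := by
  decide +kernel

/-- The test that a Boolean function holds at all possible relations of a pair. -/
def anyArcs (k : ArcType → ArcType → Bool) : Bool :=
  and (k .o .o) (and (k .f .b) (k .b .f))

/-- The test that not both an arc leaves towards the first and an arc enters from the second of two
vertices. -/
noncomputable def noDetour (d e : ArcType) : Bool :=
  ArcType.rec true (ArcType.rec true true false e) true d

/-- The test that an additional vertex creates no closed walk of length two, three, four or six
with a directed five-cycle. -/
noncomputable def pentagonCompatible (ga gb gc gd ge : ArcType) : Bool :=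
  and (and (and (and (noDetour ga ga) (noDetour ga gb)) (and (noDetour ga gc) (and (noDetour ga
  ge) (noDetour gb ga)))) (and (and (noDetour gb gb) (noDetour gb gc)) (and (noDetour gb gd) (and
  (noDetour gc gb) (noDetour gc gc))))) (and (and (and (noDetour gc gd) (noDetour gc ge)) (and
  (noDetour gd ga) (and (noDetour gd gc) (noDetour gd gd)))) (and (and (noDetour gd ge) (noDetour
  ge ga)) (and (noDetour ge gb) (and (noDetour ge gd) (noDetour ge ge)))))

/-- The negativity test for a directed five-cycle together with an additional vertex. -/
noncomputable def pentagonCheck : Bool :=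
  anyArcs fun ga ag => anyArcs fun gb bg => anyArcs fun gc cg =>
  anyArcs fun gd dg => anyArcs fun ge eg =>
  or (not (pentagonCompatible ga gb gc gd ge)) <|
  packedNeg (packedTotal .f .o .o .b ag .b .f .o .o bg .o .b .f .o cg .o .o .b .f dg .f .o .o .b eg
    ga gb gc gd ge)

theorem pentagonCheck_eq_true : pentagonCheck = true := by
  decide +kernel

/-- The test that a Boolean function holds at all relations. -/
def allArcs (k : ArcType → Bool) : Bool :=
  and (k .o) (and (k .f) (k .b))

/-- The stored digit recording whether the relation is a forward arc. -/
noncomputable def ArcType.rootDigit (d : ArcType) : ℕ :=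
  ArcType.rec 1028567 1128567 1028567 d

/-- The test that a leaf stores the digits of the given relations to the four roots. -/
noncomputable def rootDigitsCheck (t : FlagTree) (d₀ d₁ d₂ d₃ : ArcType) : Bool :=
  FlagTree.rec false
    (fun w => and (and (Nat.beq (digit 11 w) d₀.rootDigit) (Nat.beq (digit 12 w) d₁.rootDigit))
      (and (Nat.beq (digit 13 w) d₂.rootDigit) (Nat.beq (digit 14 w) d₃.rootDigit)))
    (fun _ _ _ _ _ _ => false) t

/-- The test that all leaves of a nontrivial flag tree store the relations to the roots. -/
noncomputable def flagTreeCheck (t : FlagTree) : Bool :=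
  FlagTree.rec true (fun _ => true)
    (fun _ _ _ _ _ _ => allArcs fun d₀ => allArcs fun d₁ => allArcs fun d₂ => allArcs fun d₃ =>
      rootDigitsCheck (t.sel4 d₀ d₁ d₂ d₃) d₀ d₁ d₂ d₃) t

/-- The test that all flag trees store the relations to the roots. -/
noncomputable def baseTreeCheck : Bool :=
  allArcs fun d₀ => allArcs fun d₁ => allArcs fun d₂ => allArcs fun d₃ => allArcs fun d₄ =>
    allArcs fun d₅ => flagTreeCheck (baseTree.sel6 d₀ d₁ d₂ d₃ d₄ d₅)

theorem baseTreeCheck_eq_true : baseTreeCheck = true := by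
  decide +kernel

/-- The test that the vectors attached to a two-vertex base do not depend on the order of the
further two vertices. -/
noncomputable def pairTreeCheck : Bool :=
  allArcs fun d => allArcs fun ac => allArcs fun bc => allArcs fun ad => allArcs fun bd =>
    anyArcs fun cd dc => Nat.beq ((pairTree.sel d).sel5 ac bc ad bd cd).weight
      ((pairTree.sel d).sel5 ad bd ac bc dc).weight

theorem pairTreeCheck_eq_true : pairTreeCheck = true := by
  decide +kernel

/-- The coordinate `k` of the vector stored in a tree. -/
noncomputable def comp (k : ℕ) (t : FlagTree) : ℤ :=
  if t.weight = 0 then 0 else (digit k (t.weight - 1) : ℤ) - 1048576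

theorem abs_comp_le (k : ℕ) (t : FlagTree) : |comp k t| ≤ 2 ^ 20 := by
  unfold comp
  split_ifs
  · norm_num
  · have h : digit k (t.weight - 1) < 2097152 := Nat.mod_lt _ (by norm_num)
    rw [abs_le]
    constructor <;> omega

theorem comp_leaf (k w : ℕ) : comp k (.leaf w) = (digit k w : ℤ) - 1048576 := rfl

theorem comp_nil (k : ℕ) : comp k .nil = 0 := rfl

theorem comp_node (k : ℕ) (x y z : FlagTree) : comp k (.node x y z) = 0 := rfl

set_option exponentiation.threshold 1000 in
theorem up_eq (t : FlagTree) :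
    ∃ H : ℤ, (t.up : ℤ) = ∑ k ∈ Finset.range 15, comp k t * (2 ^ 64) ^ k + H * (2 ^ 64) ^ 15 := by
  cases t with
  | nil => exact ⟨0, by simp [comp_nil, FlagTree.up]⟩
  | node x y z => exact ⟨0, by simp [comp_node, FlagTree.up]⟩
  | leaf w =>
    refine ⟨1, ?_⟩
    simp only [comp_leaf, FlagTree.up, pack, offset, Finset.sum_range_succ, Finset.sum_range_zero,
      Nat.add_eq, Nat.mul_eq]
    push_cast
    norm_num
    ring

set_option exponentiation.threshold 1000 in
theorem down_eq (t : FlagTree) :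
    ∃ H : ℤ, (t.down : ℤ) =
      ∑ k ∈ Finset.range 15, comp k t * (2 ^ 64) ^ (14 - k) + H * (2 ^ 64) ^ 15 := by
  cases t with
  | nil => exact ⟨0, by simp [comp_nil, FlagTree.down]⟩
  | node x y z => exact ⟨0, by simp [comp_node, FlagTree.down]⟩
  | leaf w =>
    refine ⟨1, ?_⟩
    simp only [comp_leaf, FlagTree.down, pack, offset, Finset.sum_range_succ,
      Finset.sum_range_zero, Nat.add_eq, Nat.mul_eq]
    push_cast
    norm_num
    ring

set_option exponentiation.threshold 1000 in
theorem downDual_eq (t : FlagTree) :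
    ∃ H : ℤ, (t.downDual : ℤ) =
      ∑ k ∈ Finset.range 15, comp (dual k) t * (2 ^ 64) ^ (14 - k) + H * (2 ^ 64) ^ 15 := by
  cases t with
  | nil => exact ⟨0, by simp [comp_nil, FlagTree.downDual]⟩
  | node x y z => exact ⟨0, by simp [comp_node, FlagTree.downDual]⟩
  | leaf w =>
    refine ⟨1, ?_⟩
    simp only [comp_leaf, FlagTree.downDual, pack, offset, dual, Finset.sum_range_succ,
      Finset.sum_range_zero, Nat.add_eq, Nat.mul_eq]
    push_cast
    norm_num
    ring

/-- The number `N` encodes `F` as its coefficient at `(2 ^ 64) ^ 14`, modulo `(2 ^ 64) ^ 15` and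
up to lower order terms; `c` bounds the number of products involved. -/
def Encodes (c N : ℕ) (F : ℤ) : Prop :=
  |F| ≤ c * 2 ^ 48 ∧ ∃ L H : ℤ, |L| ≤ c * 2 ^ 48 * (2 ^ 64) ^ 13 ∧
    (N : ℤ) = L + F * (2 ^ 64) ^ 14 + H * (2 ^ 64) ^ 15

theorem Encodes.add {c d M N : ℕ} {F G : ℤ} (h₁ : Encodes c M F) (h₂ : Encodes d N G) :
    Encodes (c + d) (Nat.add M N) (F + G) := by
  obtain ⟨hF, L, H, hL, hM⟩ := h₁
  obtain ⟨hG, L', H', hL', hN⟩ := h₂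
  refine ⟨?_, L + L', H + H', ?_, ?_⟩
  · have := abs_add_le F G
    push_cast
    linarith
  · have := abs_add_le L L'
    push_cast
    linarith
  · simp only [Nat.add_eq]
    push_cast
    rw [hM, hN]
    ring

theorem Encodes.mono {c d N : ℕ} {F : ℤ} (h : Encodes c N F) (hcd : c ≤ d) : Encodes d N F := by
  obtain ⟨hF, L, H, hL, hN⟩ := h
  have : (c : ℤ) ≤ d := by exact_mod_cast hcd
  exact ⟨by linarith, L, H, by linarith, hN⟩

theorem encodes_zero : Encodes 1 0 0 := ⟨by norm_num, 0, 0, by norm_num, by norm_num⟩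

theorem encodes_mul {M N : ℕ} (u v : ℕ → ℤ) (hu : ∀ k, |u k| ≤ 2 ^ 20) (hv : ∀ k, |v k| ≤ 2 ^ 20)
    (hM : ∃ H : ℤ, (M : ℤ) = ∑ k ∈ Finset.range 15, u k * (2 ^ 64) ^ k + H * (2 ^ 64) ^ 15)
    (hN : ∃ H : ℤ, (N : ℤ) =
      ∑ k ∈ Finset.range 15, v k * (2 ^ 64) ^ (14 - k) + H * (2 ^ 64) ^ 15) :
    Encodes 1 (Nat.mul M N) (∑ k ∈ Finset.range 15, u k * v k) := by
  obtain ⟨H, hM⟩ := hM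
  obtain ⟨H', hN⟩ := hN
  have huv : ∀ i j, |u i * v j| ≤ 2 ^ 40 := fun i j => by
    rw [abs_mul]
    calc |u i| * |v j| ≤ 2 ^ 20 * 2 ^ 20 := 
          mul_le_mul (hu i) (hv j) (abs_nonneg _) (by norm_num)
      _ = 2 ^ 40 := by norm_num
  have hsplit : ∀ i ∈ Finset.range 15, ∀ j ∈ Finset.range 15,
      u i * (2 ^ 64) ^ i * (v j * (2 ^ 64) ^ (14 - j)) =
        (if i < j then u i * v j * (2 ^ 64) ^ (14 + i - j) else 0) +
        (if i = j then u i * v j * (2 ^ 64) ^ 14 else 0) +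
        (if j < i then u i * v j * (2 ^ 64) ^ (i - j - 1) else 0) * (2 ^ 64) ^ 15 := by
    intro i hi j hj
    rw [Finset.mem_range] at hi hj
    rcases lt_trichotomy i j with h | h | h
    · rw [if_pos h, if_neg h.ne, if_neg h.not_gt, show 14 + i - j = i + (14 - j) by omega, pow_add]
      ring
    · subst h
      rw [if_neg (lt_irrefl _), if_pos rfl, if_neg (lt_irrefl _)]
      have : (2 ^ 64 : ℤ) ^ 14 = (2 ^ 64) ^ i * (2 ^ 64) ^ (14 - i) := by
        rw [← pow_add]
        congr 1
        omega
      rw [this]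
      ring
    · rw [if_neg h.not_gt, if_neg h.ne', if_pos h]
      have : (2 ^ 64 : ℤ) ^ (i - j - 1) * (2 ^ 64) ^ 15 = (2 ^ 64) ^ i * (2 ^ 64) ^ (14 - j) := by
        rw [← pow_add, ← pow_add]
        congr 1
        omega
      rw [mul_assoc (u i * v j), this]
      ring
  refine ⟨?_, ∑ i ∈ Finset.range 15, ∑ j ∈ Finset.range 15,
      (if i < j then u i * v j * (2 ^ 64) ^ (14 + i - j) else 0),
    (∑ i ∈ Finset.range 15, ∑ j ∈ Finset.range 15,
      (if j < i then u i * v j * (2 ^ 64) ^ (i - j - 1) else 0)) + H * N +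
      (∑ k ∈ Finset.range 15, u k * (2 ^ 64) ^ k) * H', ?_, ?_⟩
  · calc |∑ k ∈ Finset.range 15, u k * v k| ≤ ∑ k ∈ Finset.range 15, |u k * v k| :=
          Finset.abs_sum_le_sum_abs _ _
      _ ≤ ∑ _k ∈ Finset.range 15, 2 ^ 40 := Finset.sum_le_sum fun k _ => huv k k
      _ ≤ _ := by simp
  · calc _ ≤ ∑ i ∈ Finset.range 15, ∑ j ∈ Finset.range 15,
          |(if i < j then u i * v j * (2 ^ 64) ^ (14 + i - j) else 0)| :=
          (Finset.abs_sum_le_sum_abs _ _).trans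
            (Finset.sum_le_sum fun i _ => Finset.abs_sum_le_sum_abs _ _)
      _ ≤ ∑ _i ∈ Finset.range 15, ∑ _j ∈ Finset.range 15, (2 ^ 40 * (2 ^ 64) ^ 13 : ℤ) := by
          refine Finset.sum_le_sum fun i _ => Finset.sum_le_sum fun j _ => ?_
          split_ifs with h
          · rw [abs_mul, abs_of_pos (a := ((2 : ℤ) ^ 64) ^ (14 + i - j)) (by positivity)]
            refine mul_le_mul (huv i j) ?_ (by positivity) (by positivity)
            exact pow_le_pow_right₀ (by norm_num) (by omega)
          · rw [abs_zero]
            positivity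
      _ ≤ _ := by
          simp only [Finset.sum_const, Finset.card_range]
          norm_num
  · have h₁ : (∑ k ∈ Finset.range 15, u k * (2 ^ 64) ^ k) *
        (∑ k ∈ Finset.range 15, v k * (2 ^ 64) ^ (14 - k)) =
        (∑ i ∈ Finset.range 15, ∑ j ∈ Finset.range 15,
          (if i < j then u i * v j * (2 ^ 64) ^ (14 + i - j) else 0)) +
        (∑ k ∈ Finset.range 15, u k * v k) * (2 ^ 64) ^ 14 +
        (∑ i ∈ Finset.range 15, ∑ j ∈ Finset.range 15,
          (if j < i then u i * v j * (2 ^ 64) ^ (i - j - 1) else 0)) * (2 ^ 64) ^ 15 := by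
      rw [Finset.sum_mul_sum]
      rw [Finset.sum_congr rfl fun i hi => Finset.sum_congr rfl (hsplit i hi)]
      simp only [Finset.sum_add_distrib, Finset.sum_mul, Finset.sum_ite_eq]
      congr 2
    rw [Nat.mul_eq, Nat.cast_mul]
    linear_combination h₁ + (N : ℤ) * hM +
      (∑ k ∈ Finset.range 15, u k * (2 ^ 64) ^ k) * hN

set_option exponentiation.threshold 1000 in
theorem Encodes.neg_of_packedNeg {c N : ℕ} {F : ℤ} (h : Encodes c N F) (hc : c ≤ 4096)
    (hN : packedNeg N = true) : F < 0 := by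
  obtain ⟨hF, L, H, hL, hN'⟩ := h
  have h₁ : 2 ^ 959 ≤ N % 2 ^ 960 ∧ N % 2 ^ 960 ≤ 2 ^ 960 - 2 ^ 896 := by
    unfold packedNeg at hN
    rw [Bool.and_eq_true] at hN
    exact ⟨Nat.le_of_ble_eq_true hN.1, Nat.le_of_ble_eq_true hN.2⟩
  have hc' : (c : ℤ) ≤ 4096 := by exact_mod_cast hc
  have hF' := abs_le.mp hF
  have hL' := abs_le.mp hL
  by_contra hneg
  norm_num at *
  omega

/-- The pairing of two vectors of a flag tree. -/
noncomputable def flagPair (t : FlagTree) (z₀ z₁ z₂ z₃ w₀ w₁ w₂ w₃ : ArcType) : ℤ :=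
  ∑ k ∈ Finset.range 15, comp k (t.sel4 z₀ z₁ z₂ z₃) * comp (dual k) (t.sel4 w₀ w₁ w₂ w₃)

/-- The inner product of the vectors stored in two trees. -/
noncomputable def pairProd (t u : FlagTree) : ℤ :=
  ∑ k ∈ Finset.range 15, comp k t * comp k u

/-- The sum over all orderings of a four-vertex base `p q r s` with further vertices `z` and
`w`. -/
noncomputable def quadSum
    (pq pr ps qp qr qs rp rq rs sp sq sr pz qz rz sz pw qw rw sw : ArcType) : ℤ :=
  (((flagPair (baseTree.sel6 pq pr qr ps qs rs) pz qz rz sz pw qw rw sw + (flagPair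
  (baseTree.sel6 pq ps qs pr qr sr) pz qz sz rz pw qw sw rw + flagPair (baseTree.sel6 pr pq rq ps
  rs qs) pz rz qz sz pw rw qw sw)) + (flagPair (baseTree.sel6 pr ps rs pq rq sq) pz rz sz qz pw
  rw sw qw + (flagPair (baseTree.sel6 ps pq sq pr sr qr) pz sz qz rz pw sw qw rw + flagPair
  (baseTree.sel6 ps pr sr pq sq rq) pz sz rz qz pw sw rw qw))) + ((flagPair (baseTree.sel6 qp qr
  pr qs ps rs) qz pz rz sz qw pw rw sw + (flagPair (baseTree.sel6 qp qs ps qr pr sr) qz pz sz rz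
  qw pw sw rw + flagPair (baseTree.sel6 qr qp rp qs rs ps) qz rz pz sz qw rw pw sw)) + (flagPair
  (baseTree.sel6 qr qs rs qp rp sp) qz rz sz pz qw rw sw pw + (flagPair (baseTree.sel6 qs qp sp
  qr sr pr) qz sz pz rz qw sw pw rw + flagPair (baseTree.sel6 qs qr sr qp sp rp) qz sz rz pz qw
  sw rw pw)))) + (((flagPair (baseTree.sel6 rp rq pq rs ps qs) rz pz qz sz rw pw qw sw +
  (flagPair (baseTree.sel6 rp rs ps rq pq sq) rz pz sz qz rw pw sw qw + flagPair (baseTree.sel6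
  rq rp qp rs qs ps) rz qz pz sz rw qw pw sw)) + (flagPair (baseTree.sel6 rq rs qs rp qp sp) rz
  qz sz pz rw qw sw pw + (flagPair (baseTree.sel6 rs rp sp rq sq pq) rz sz pz qz rw sw pw qw +
  flagPair (baseTree.sel6 rs rq sq rp sp qp) rz sz qz pz rw sw qw pw))) + ((flagPair
  (baseTree.sel6 sp sq pq sr pr qr) sz pz qz rz sw pw qw rw + (flagPair (baseTree.sel6 sp sr pr
  sq pq rq) sz pz rz qz sw pw rw qw + flagPair (baseTree.sel6 sq sp qp sr qr pr) sz qz pz rz sw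
  qw pw rw)) + (flagPair (baseTree.sel6 sq sr qr sp qp rp) sz qz rz pz sw qw rw pw + (flagPair
  (baseTree.sel6 sr sp rp sq rq pq) sz rz pz qz sw rw pw qw + flagPair (baseTree.sel6 sr sq rq sp
  rp qp) sz rz qz pz sw rw qw pw))))

/-- The sum over both orderings of a base `p q` and all splittings of the further vertices
`r s t u` into two pairs. -/
noncomputable def pairSum
    (pq qp pr qr ps qs pt qt pu qu rs rt ru st su tu : ArcType) : ℤ :=
  (pairProd ((pairTree.sel pq).sel5 pr qr ps qs rs) ((pairTree.sel pq).sel5 pt qt pu qu tu) +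
  (pairProd ((pairTree.sel pq).sel5 pr qr pt qt rt) ((pairTree.sel pq).sel5 ps qs pu qu su) +
  pairProd ((pairTree.sel pq).sel5 pr qr pu qu ru) ((pairTree.sel pq).sel5 ps qs pt qt st))) +
  (pairProd ((pairTree.sel qp).sel5 qr pr qs ps rs) ((pairTree.sel qp).sel5 qt pt qu pu tu) +
  (pairProd ((pairTree.sel qp).sel5 qr pr qt pt rt) ((pairTree.sel qp).sel5 qs ps qu pu su) +
  pairProd ((pairTree.sel qp).sel5 qr pr qu pu ru) ((pairTree.sel qp).sel5 qs ps qt pt st)))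

/-- The sum over all placements of both kinds of bases in six vertices. -/
noncomputable def totalSum
    (ab ac ad ae ag ba bc bd be bg ca cb cd ce cg da db dc de dg ea eb ec ed eg ga gb gc gd ge :
    ArcType) : ℤ :=
  (((quadSum cd ce cg dc de dg ec ed eg gc gd ge ca da ea ga cb db eb gb + (quadSum bd be bg db
  de dg eb ed eg gb gd ge ba da ea ga bc dc ec gc + quadSum bc be bg cb ce cg eb ec eg gb gc ge
  ba ca ea ga bd cd ed gd)) + ((quadSum bc bd bg cb cd cg db dc dg gb gc gd ba ca da ga be ce de
  ge + quadSum bc bd be cb cd ce db dc de eb ec ed ba ca da ea bg cg dg eg) + (quadSum ad ae ag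
  da de dg ea ed eg ga gd ge ab db eb gb ac dc ec gc + quadSum ac ae ag ca ce cg ea ec eg ga gc
  ge ab cb eb gb ad cd ed gd))) + (((quadSum ac ad ag ca cd cg da dc dg ga gc gd ab cb db gb ae
  ce de ge + quadSum ac ad ae ca cd ce da dc de ea ec ed ab cb db eb ag cg dg eg) + (quadSum ab
  ae ag ba be bg ea eb eg ga gb ge ac bc ec gc ad bd ed gd + quadSum ab ad ag ba bd bg da db dg
  ga gb gd ac bc dc gc ae be de ge)) + ((quadSum ab ad ae ba bd be da db de ea eb ed ac bc dc ec
  ag bg dg eg + quadSum ab ac ag ba bc bg ca cb cg ga gb gc ad bd cd gd ae be ce ge) + (quadSum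
  ab ac ae ba bc be ca cb ce ea eb ec ad bd cd ed ag bg cg eg + quadSum ab ac ad ba bc bd ca cb
  cd da db dc ae be ce de ag bg cg dg)))) + (((pairSum ab ba ac bc ad bd ae be ag bg cd ce cg de
  dg eg + (pairSum ac ca ab cb ad cd ae ce ag cg bd be bg de dg eg + pairSum ad da ab db ac dc ae
  de ag dg bc be bg ce cg eg)) + ((pairSum ae ea ab eb ac ec ad ed ag eg bc bd bg cd cg dg +
  pairSum ag ga ab gb ac gc ad gd ae ge bc bd be cd ce de) + (pairSum bc cb ba ca bd cd be ce bg
  cg ad ae ag de dg eg + pairSum bd db ba da bc dc be de bg dg ac ae ag ce cg eg))) + (((pairSum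
  be eb ba ea bc ec bd ed bg eg ac ad ag cd cg dg + pairSum bg gb ba ga bc gc bd gd be ge ac ad
  ae cd ce de) + (pairSum cd dc ca da cb db ce de cg dg ab ae ag be bg eg + pairSum ce ec ca ea
  cb eb cd ed cg eg ab ad ag bd bg dg)) + ((pairSum cg gc ca ga cb gb cd gd ce ge ab ad ae bd be
  de + pairSum de ed da ea db eb dc ec dg eg ab ac ag bc bg cg) + (pairSum dg gd da ga db gb dc
  gc de ge ab ac ae bc be ce + pairSum eg ge ea ga eb gb ec gc ed gd ab ac ad bc bd cd))))

theorem encodes_flagPair (t : FlagTree) (z₀ z₁ z₂ z₃ w₀ w₁ w₂ w₃ : ArcType) :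
    Encodes 1 (packedFlagPair t z₀ z₁ z₂ z₃ w₀ w₁ w₂ w₃) (flagPair t z₀ z₁ z₂ z₃ w₀ w₁ w₂ w₃) := by
  have hnil : ∀ k, ∀ u : FlagTree, u = .nil → comp k u = 0 := by
    rintro k u rfl
    rfl
  cases t with
  | nil =>
    change Encodes 1 0 _
    simpa [flagPair, hnil, FlagTree.sel4, FlagTree.sel] using encodes_zero
  | leaf w =>
    change Encodes 1 0 _
    simpa [flagPair, hnil, FlagTree.sel4, FlagTree.sel] using encodes_zero
  | node x y z =>
    exact encodes_mul _ _ (fun _ => abs_comp_le _ _) (fun _ => abs_comp_le _ _) (up_eq _)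
      (downDual_eq _)

theorem encodes_pairProd (t u : FlagTree) : Encodes 1 (Nat.mul t.up u.down) (pairProd t u) :=
  encodes_mul _ _ (fun _ => abs_comp_le _ _) (fun _ => abs_comp_le _ _) (up_eq _) (down_eq _)

theorem encodes_quadSum
    (pq pr ps qp qr qs rp rq rs sp sq sr pz qz rz sz pw qw rw sw : ArcType) :
    Encodes 24
      (packedQuad pq pr ps qp qr qs rp rq rs sp sq sr pz qz rz sz pw qw rw sw)
      (quadSum pq pr ps qp qr qs rp rq rs sp sq sr pz qz rz sz pw qw rw sw) := by
  unfold packedQuad quadSum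
  refine Encodes.mono (((((encodes_flagPair _ _ _ _ _ _ _ _ _).add ((encodes_flagPair _ _ _ _ _
    _ _ _ _).add (encodes_flagPair _ _ _ _ _ _ _ _ _))).add ((encodes_flagPair _ _ _ _ _ _ _ _
    _).add ((encodes_flagPair _ _ _ _ _ _ _ _ _).add (encodes_flagPair _ _ _ _ _ _ _ _ _)))).add
    (((encodes_flagPair _ _ _ _ _ _ _ _ _).add ((encodes_flagPair _ _ _ _ _ _ _ _ _).add
    (encodes_flagPair _ _ _ _ _ _ _ _ _))).add ((encodes_flagPair _ _ _ _ _ _ _ _ _).add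
    ((encodes_flagPair _ _ _ _ _ _ _ _ _).add (encodes_flagPair _ _ _ _ _ _ _ _ _))))).add
    ((((encodes_flagPair _ _ _ _ _ _ _ _ _).add ((encodes_flagPair _ _ _ _ _ _ _ _ _).add
    (encodes_flagPair _ _ _ _ _ _ _ _ _))).add ((encodes_flagPair _ _ _ _ _ _ _ _ _).add
    ((encodes_flagPair _ _ _ _ _ _ _ _ _).add (encodes_flagPair _ _ _ _ _ _ _ _ _)))).add
    (((encodes_flagPair _ _ _ _ _ _ _ _ _).add ((encodes_flagPair _ _ _ _ _ _ _ _ _).add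
    (encodes_flagPair _ _ _ _ _ _ _ _ _))).add ((encodes_flagPair _ _ _ _ _ _ _ _ _).add
    ((encodes_flagPair _ _ _ _ _ _ _ _ _).add (encodes_flagPair _ _ _ _ _ _ _ _ _)))))) le_rfl

theorem encodes_pairSum
    (pq qp pr qr ps qs pt qt pu qu rs rt ru st su tu : ArcType) :
    Encodes 6 (packedPair pq qp pr qr ps qs pt qt pu qu rs rt ru st su tu)
      (pairSum pq qp pr qr ps qs pt qt pu qu rs rt ru st su tu) := by
  unfold packedPair pairSum
  refine Encodes.mono (((encodes_pairProd _ _).add ((encodes_pairProd _ _).add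
    (encodes_pairProd _ _))).add ((encodes_pairProd _ _).add ((encodes_pairProd _ _).add
    (encodes_pairProd _ _)))) le_rfl

theorem encodes_totalSum
    (ab ac ad ae ag ba bc bd be bg ca cb cd ce cg da db dc de dg ea eb ec ed eg ga gb gc gd ge :
    ArcType) :
    Encodes 450
      (packedTotal
        ab ac ad ae ag ba bc bd be bg ca cb cd ce cg da db dc de dg ea eb ec ed eg ga gb gc gd ge)
      (totalSum
        ab ac ad ae ag ba bc bd be bg ca cb cd ce cg da db dc de dg ea eb ec ed eg ga gb gc gd ge)
    := by
  unfold packedTotal totalSum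
  refine Encodes.mono (((((encodes_quadSum _ _ _ _ _ _ _ _ _ _ _ _ _ _ _ _ _ _ _ _).add
    ((encodes_quadSum _ _ _ _ _ _ _ _ _ _ _ _ _ _ _ _ _ _ _ _).add (encodes_quadSum _ _ _ _ _ _ _
    _ _ _ _ _ _ _ _ _ _ _ _ _))).add (((encodes_quadSum _ _ _ _ _ _ _ _ _ _ _ _ _ _ _ _ _ _ _
    _).add (encodes_quadSum _ _ _ _ _ _ _ _ _ _ _ _ _ _ _ _ _ _ _ _)).add ((encodes_quadSum _ _ _
    _ _ _ _ _ _ _ _ _ _ _ _ _ _ _ _ _).add (encodes_quadSum _ _ _ _ _ _ _ _ _ _ _ _ _ _ _ _ _ _ _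
    _)))).add ((((encodes_quadSum _ _ _ _ _ _ _ _ _ _ _ _ _ _ _ _ _ _ _ _).add (encodes_quadSum _
    _ _ _ _ _ _ _ _ _ _ _ _ _ _ _ _ _ _ _)).add ((encodes_quadSum _ _ _ _ _ _ _ _ _ _ _ _ _ _ _ _
    _ _ _ _).add (encodes_quadSum _ _ _ _ _ _ _ _ _ _ _ _ _ _ _ _ _ _ _ _))).add
    (((encodes_quadSum _ _ _ _ _ _ _ _ _ _ _ _ _ _ _ _ _ _ _ _).add (encodes_quadSum _ _ _ _ _ _
    _ _ _ _ _ _ _ _ _ _ _ _ _ _)).add ((encodes_quadSum _ _ _ _ _ _ _ _ _ _ _ _ _ _ _ _ _ _ _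
    _).add (encodes_quadSum _ _ _ _ _ _ _ _ _ _ _ _ _ _ _ _ _ _ _ _))))).add ((((encodes_pairSum
    _ _ _ _ _ _ _ _ _ _ _ _ _ _ _ _).add ((encodes_pairSum _ _ _ _ _ _ _ _ _ _ _ _ _ _ _ _).add
    (encodes_pairSum _ _ _ _ _ _ _ _ _ _ _ _ _ _ _ _))).add (((encodes_pairSum _ _ _ _ _ _ _ _ _
    _ _ _ _ _ _ _).add (encodes_pairSum _ _ _ _ _ _ _ _ _ _ _ _ _ _ _ _)).add ((encodes_pairSum _
    _ _ _ _ _ _ _ _ _ _ _ _ _ _ _).add (encodes_pairSum _ _ _ _ _ _ _ _ _ _ _ _ _ _ _ _)))).add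
    ((((encodes_pairSum _ _ _ _ _ _ _ _ _ _ _ _ _ _ _ _).add (encodes_pairSum _ _ _ _ _ _ _ _ _ _
    _ _ _ _ _ _)).add ((encodes_pairSum _ _ _ _ _ _ _ _ _ _ _ _ _ _ _ _).add (encodes_pairSum _ _
    _ _ _ _ _ _ _ _ _ _ _ _ _ _))).add (((encodes_pairSum _ _ _ _ _ _ _ _ _ _ _ _ _ _ _ _).add
    (encodes_pairSum _ _ _ _ _ _ _ _ _ _ _ _ _ _ _ _)).add ((encodes_pairSum _ _ _ _ _ _ _ _ _ _
    _ _ _ _ _ _).add (encodes_pairSum _ _ _ _ _ _ _ _ _ _ _ _ _ _ _ _)))))) le_rfl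

theorem totalSum_neg_of_packedNeg
    {ab ac ad ae ag ba bc bd be bg ca cb cd ce cg da db dc de dg ea eb ec ed eg ga gb gc gd ge :
    ArcType}
    (h : packedNeg (packedTotal
      ab ac ad ae ag ba bc bd be bg ca cb cd ce cg da db dc de dg ea eb ec ed eg ga gb gc gd ge) =
    true) :
    totalSum
      ab ac ad ae ag ba bc bd be bg ca cb cd ce cg da db dc de dg ea eb ec ed eg ga gb gc gd ge < 0
    :=
  (encodes_totalSum _ _ _ _ _ _ _ _ _ _ _ _ _ _ _ _ _ _ _ _ _ _ _ _ _ _ _ _ _ _).neg_of_packedNeg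
  (by norm_num) h

/-- The opposite relation. -/
noncomputable def ArcType.rev (d : ArcType) : ArcType :=
  ArcType.rec .o .b .f d

/-- The pairing `flagPair` evaluated at vertices. -/
noncomputable def flagPairAt {V : Type*} (δ : V → V → ArcType) (a b c d z w : V) : ℤ :=
  flagPair (baseTree.sel6 (δ a b) (δ a c) (δ b c) (δ a d) (δ b d) (δ c d))
    (δ a z) (δ b z) (δ c z) (δ d z) (δ a w) (δ b w) (δ c w) (δ d w)

/-- The product `pairProd` evaluated at vertices. -/
noncomputable def pairProdAt {V : Type*} (δ : V → V → ArcType) (a b c d e g : V) : ℤ :=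
  pairProd ((pairTree.sel (δ a b)).sel5 (δ a c) (δ b c) (δ a d) (δ b d) (δ c d))
    ((pairTree.sel (δ a b)).sel5 (δ a e) (δ b e) (δ a g) (δ b g) (δ e g))

/-- The sum `quadSum` evaluated at vertices. -/
noncomputable def quadAt {V : Type*} (δ : V → V → ArcType) (a b c d z w : V) : ℤ :=
  quadSum
    (δ a b) (δ a c) (δ a d) (δ b a) (δ b c) (δ b d) (δ c a) (δ c b) (δ c d) (δ d a) (δ d b) (δ d
    c) (δ a z) (δ b z) (δ c z) (δ d z) (δ a w) (δ b w) (δ c w) (δ d w)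

/-- The sum `pairSum` evaluated at vertices. -/
noncomputable def pairAt {V : Type*} (δ : V → V → ArcType) (a b c d e g : V) : ℤ :=
  pairSum
    (δ a b) (δ b a) (δ a c) (δ b c) (δ a d) (δ b d) (δ a e) (δ b e) (δ a g) (δ b g) (δ c d) (δ c
    e) (δ c g) (δ d e) (δ d g) (δ e g)

/-- The sum `totalSum` evaluated at vertices. -/
noncomputable def totalAt {V : Type*} (δ : V → V → ArcType) (a b c d e g : V) : ℤ :=
  totalSum
    (δ a b) (δ a c) (δ a d) (δ a e) (δ a g) (δ b a) (δ b c) (δ b d) (δ b e) (δ b g) (δ c a) (δ c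
    b) (δ c d) (δ c e) (δ c g) (δ d a) (δ d b) (δ d c) (δ d e) (δ d g) (δ e a) (δ e b) (δ e c) (δ
    e d) (δ e g) (δ g a) (δ g b) (δ g c) (δ g d) (δ g e)

theorem quadAt_eq {V : Type*} (δ : V → V → ArcType) (a b c d z w : V) :
    quadAt δ a b c d z w =
      (((flagPairAt δ a b c d z w + (flagPairAt δ a b d c z w + flagPairAt δ a c b d z w)) +
      (flagPairAt δ a c d b z w + (flagPairAt δ a d b c z w + flagPairAt δ a d c b z w))) +
      ((flagPairAt δ b a c d z w + (flagPairAt δ b a d c z w + flagPairAt δ b c a d z w)) +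
      (flagPairAt δ b c d a z w + (flagPairAt δ b d a c z w + flagPairAt δ b d c a z w)))) +
      (((flagPairAt δ c a b d z w + (flagPairAt δ c a d b z w + flagPairAt δ c b a d z w)) +
      (flagPairAt δ c b d a z w + (flagPairAt δ c d a b z w + flagPairAt δ c d b a z w))) +
      ((flagPairAt δ d a b c z w + (flagPairAt δ d a c b z w + flagPairAt δ d b a c z w)) +
      (flagPairAt δ d b c a z w + (flagPairAt δ d c a b z w + flagPairAt δ d c b a z w)))) :=
  rfl

theorem pairAt_eq {V : Type*} (δ : V → V → ArcType) (a b c d e g : V) :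
    pairAt δ a b c d e g =
      (pairProdAt δ a b c d e g + (pairProdAt δ a b c e d g + pairProdAt δ a b c g d e)) +
      (pairProdAt δ b a c d e g + (pairProdAt δ b a c e d g + pairProdAt δ b a c g d e)) :=
  rfl

theorem totalAt_eq {V : Type*} (δ : V → V → ArcType) (a b c d e g : V) :
    totalAt δ a b c d e g =
      (((quadAt δ c d e g a b + (quadAt δ b d e g a c + quadAt δ b c e g a d)) + ((quadAt δ b c d
      g a e + quadAt δ b c d e a g) + (quadAt δ a d e g b c + quadAt δ a c e g b d))) + (((quadAt
      δ a c d g b e + quadAt δ a c d e b g) + (quadAt δ a b e g c d + quadAt δ a b d g c e)) +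
      ((quadAt δ a b d e c g + quadAt δ a b c g d e) + (quadAt δ a b c e d g + quadAt δ a b c d e
      g)))) + (((pairAt δ a b c d e g + (pairAt δ a c b d e g + pairAt δ a d b c e g)) + ((pairAt
      δ a e b c d g + pairAt δ a g b c d e) + (pairAt δ b c a d e g + pairAt δ b d a c e g))) +
      (((pairAt δ b e a c d g + pairAt δ b g a c d e) + (pairAt δ c d a b e g + pairAt δ c e a b
      d g)) + ((pairAt δ c g a b d e + pairAt δ d e a b c g) + (pairAt δ d g a b c e + pairAt δ e
      g a b c d)))) :=
  rfl

theorem quadAt_swap_first_second {V : Type*} (δ : V → V → ArcType) (a b c d z w : V) :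
    quadAt δ b a c d z w = quadAt δ a b c d z w := by
  rw [quadAt_eq, quadAt_eq]
  ring

theorem quadAt_swap_second_third {V : Type*} (δ : V → V → ArcType) (a b c d z w : V) :
    quadAt δ a c b d z w = quadAt δ a b c d z w := by
  rw [quadAt_eq, quadAt_eq]
  ring

theorem quadAt_swap_third_fourth {V : Type*} (δ : V → V → ArcType) (a b c d z w : V) :
    quadAt δ a b d c z w = quadAt δ a b c d z w := by
  rw [quadAt_eq, quadAt_eq]
  ring

theorem flagPairAt_swap {V : Type*} (δ : V → V → ArcType) (a b c d z w : V) :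
    flagPairAt δ a b c d w z = flagPairAt δ a b c d z w := by
  simp only [flagPairAt, flagPair, Finset.sum_range_succ, Finset.sum_range_zero]
  norm_num [dual]
  ring

theorem quadAt_swap_fifth_sixth {V : Type*} (δ : V → V → ArcType) (a b c d z w : V) :
    quadAt δ a b c d w z = quadAt δ a b c d z w := by
  simp only [quadAt_eq, flagPairAt_swap δ _ _ _ _ z w]

theorem allArcs_eq_true_iff {k : ArcType → Bool} : allArcs k = true ↔ ∀ d, k d = true := by
  simp only [allArcs, Bool.and_eq_true]
  refine ⟨fun h d => ?_, fun h => ⟨h _, h _, h _⟩⟩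
  cases d
  exacts [h.1, h.2.1, h.2.2]

theorem anyArcs_eq_true_iff {k : ArcType → ArcType → Bool} :
    anyArcs k = true ↔ ∀ d, k d d.rev = true := by
  simp only [anyArcs, Bool.and_eq_true]
  refine ⟨fun h d => ?_, fun h => ⟨h .o, h .f, h .b⟩⟩
  cases d
  exacts [h.1, h.2.1, h.2.2]

theorem comp_congr {t u : FlagTree} (h : t.weight = u.weight) (k : ℕ) : comp k t = comp k u := by
  simp only [comp, h]

theorem comp_pairTree_swap (k : ℕ) (d ac bc ad bd cd : ArcType) :
    comp k ((pairTree.sel d).sel5 ad bd ac bc cd.rev) =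
      comp k ((pairTree.sel d).sel5 ac bc ad bd cd) := by
  have h := pairTreeCheck_eq_true
  simp only [pairTreeCheck, allArcs_eq_true_iff, anyArcs_eq_true_iff] at h
  exact (comp_congr (Nat.eq_of_beq_eq_true (h d ac bc ad bd cd)) k).symm

theorem pairProdAt_comm {V : Type*} (δ : V → V → ArcType) (a b c d e g : V) :
    pairProdAt δ a b e g c d = pairProdAt δ a b c d e g := by
  unfold pairProdAt pairProd
  exact Finset.sum_congr rfl fun _ _ => mul_comm _ _

theorem pairProdAt_swap {V : Type*} {δ : V → V → ArcType} (hδ : ∀ u v, δ v u = (δ u v).rev)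
    (a b c d e g : V) : pairProdAt δ a b d c e g = pairProdAt δ a b c d e g := by
  unfold pairProdAt pairProd
  rw [hδ c d]
  simp only [comp_pairTree_swap]

theorem pairProdAt_swap' {V : Type*} {δ : V → V → ArcType} (hδ : ∀ u v, δ v u = (δ u v).rev)
    (a b c d e g : V) : pairProdAt δ a b c d g e = pairProdAt δ a b c d e g := by
  rw [pairProdAt_comm, pairProdAt_swap hδ, pairProdAt_comm]

theorem pairAt_swap_first_second {V : Type*} (δ : V → V → ArcType) (a b c d e g : V) :
    pairAt δ b a c d e g = pairAt δ a b c d e g := by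
  rw [pairAt_eq, pairAt_eq]
  ring

theorem pairAt_swap_third_fourth {V : Type*} {δ : V → V → ArcType}
    (hδ : ∀ u v, δ v u = (δ u v).rev) (a b c d e g : V) :
    pairAt δ a b d c e g = pairAt δ a b c d e g := by
  simp only [pairAt_eq, pairProdAt_swap hδ _ _ c d e g, pairProdAt_comm δ _ _ c e d g,
    pairProdAt_comm δ _ _ c g d e]
  ring

theorem pairAt_swap_fourth_fifth {V : Type*} {δ : V → V → ArcType}
    (hδ : ∀ u v, δ v u = (δ u v).rev) (a b c d e g : V) :
    pairAt δ a b c e d g = pairAt δ a b c d e g := by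
  simp only [pairAt_eq, pairProdAt_swap' hδ _ _ c g d e]
  ring

theorem pairAt_swap_fifth_sixth {V : Type*} {δ : V → V → ArcType}
    (hδ : ∀ u v, δ v u = (δ u v).rev) (a b c d e g : V) :
    pairAt δ a b c d g e = pairAt δ a b c d e g := by
  simp only [pairAt_eq, pairProdAt_swap' hδ _ _ c d e g]
  ring

theorem totalAt_swap_first_second {V : Type*} {δ : V → V → ArcType}
    (hδ : ∀ u v, δ v u = (δ u v).rev) (a b c d e g : V) :
    totalAt δ b a c d e g = totalAt δ a b c d e g := by
  simp only [totalAt_eq]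
  linear_combination quadAt_swap_fifth_sixth δ c d e g a b + quadAt_swap_first_second δ a b e g c d
    +
    quadAt_swap_first_second δ a b d g c e + quadAt_swap_first_second δ a b d e c g +
    quadAt_swap_first_second δ a b c g d e + quadAt_swap_first_second δ a b c e d g +
    quadAt_swap_first_second δ a b c d e g + pairAt_swap_first_second δ a b c d e g +
    pairAt_swap_third_fourth hδ c d a b e g + pairAt_swap_third_fourth hδ c e a b d g +
    pairAt_swap_third_fourth hδ c g a b d e + pairAt_swap_third_fourth hδ d e a b c g +
    pairAt_swap_third_fourth hδ d g a b c e + pairAt_swap_third_fourth hδ e g a b c d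

theorem totalAt_swap_second_third {V : Type*} {δ : V → V → ArcType}
    (hδ : ∀ u v, δ v u = (δ u v).rev) (a b c d e g : V) :
    totalAt δ a c b d e g = totalAt δ a b c d e g := by
  simp only [totalAt_eq]
  linear_combination quadAt_swap_first_second δ b c e g a d + quadAt_swap_first_second δ b c d g a
    e +
    quadAt_swap_first_second δ b c d e a g + quadAt_swap_fifth_sixth δ a d e g b c +
    quadAt_swap_second_third δ a b c g d e + quadAt_swap_second_third δ a b c e d g +
    quadAt_swap_second_third δ a b c d e g + pairAt_swap_third_fourth hδ a d b c e g +
    pairAt_swap_third_fourth hδ a e b c d g + pairAt_swap_third_fourth hδ a g b c d e +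
    pairAt_swap_first_second δ b c a d e g + pairAt_swap_fourth_fifth hδ d e a b c g +
    pairAt_swap_fourth_fifth hδ d g a b c e + pairAt_swap_fourth_fifth hδ e g a b c d

theorem totalAt_swap_third_fourth {V : Type*} {δ : V → V → ArcType}
    (hδ : ∀ u v, δ v u = (δ u v).rev) (a b c d e g : V) :
    totalAt δ a b d c e g = totalAt δ a b c d e g := by
  simp only [totalAt_eq]
  linear_combination quadAt_swap_first_second δ c d e g a b + quadAt_swap_second_third δ b c d g a
    e +
    quadAt_swap_second_third δ b c d e a g + quadAt_swap_second_third δ a c d g b e +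
    quadAt_swap_second_third δ a c d e b g + quadAt_swap_fifth_sixth δ a b e g c d +
    quadAt_swap_third_fourth δ a b c d e g + pairAt_swap_third_fourth hδ a b c d e g +
    pairAt_swap_fourth_fifth hδ a e b c d g + pairAt_swap_fourth_fifth hδ a g b c d e +
    pairAt_swap_fourth_fifth hδ b e a c d g + pairAt_swap_fourth_fifth hδ b g a c d e +
    pairAt_swap_first_second δ c d a b e g + pairAt_swap_fifth_sixth hδ e g a b c d

theorem totalAt_swap_fourth_fifth {V : Type*} {δ : V → V → ArcType}
    (hδ : ∀ u v, δ v u = (δ u v).rev) (a b c d e g : V) :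
    totalAt δ a b c e d g = totalAt δ a b c d e g := by
  simp only [totalAt_eq]
  linear_combination quadAt_swap_second_third δ c d e g a b + quadAt_swap_second_third δ b d e g a
    c +
    quadAt_swap_third_fourth δ b c d e a g + quadAt_swap_second_third δ a d e g b c +
    quadAt_swap_third_fourth δ a c d e b g + quadAt_swap_third_fourth δ a b d e c g +
    quadAt_swap_fifth_sixth δ a b c g d e + pairAt_swap_fourth_fifth hδ a b c d e g +
    pairAt_swap_fourth_fifth hδ a c b d e g + pairAt_swap_fifth_sixth hδ a g b c d e +
    pairAt_swap_fourth_fifth hδ b c a d e g + pairAt_swap_fifth_sixth hδ b g a c d e +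
    pairAt_swap_fifth_sixth hδ c g a b d e + pairAt_swap_first_second δ d e a b c g

theorem totalAt_swap_fifth_sixth {V : Type*} {δ : V → V → ArcType}
    (hδ : ∀ u v, δ v u = (δ u v).rev) (a b c d e g : V) :
    totalAt δ a b c d g e = totalAt δ a b c d e g := by
  simp only [totalAt_eq]
  linear_combination quadAt_swap_third_fourth δ c d e g a b + quadAt_swap_third_fourth δ b d e g a
    c +
    quadAt_swap_third_fourth δ b c e g a d + quadAt_swap_third_fourth δ a d e g b c +
    quadAt_swap_third_fourth δ a c e g b d + quadAt_swap_third_fourth δ a b e g c d +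
    quadAt_swap_fifth_sixth δ a b c d e g + pairAt_swap_fifth_sixth hδ a b c d e g +
    pairAt_swap_fifth_sixth hδ a c b d e g + pairAt_swap_fifth_sixth hδ a d b c e g +
    pairAt_swap_fifth_sixth hδ b c a d e g + pairAt_swap_fifth_sixth hδ b d a c e g +
    pairAt_swap_fifth_sixth hδ c d a b e g + pairAt_swap_first_second δ e g a b c d

/-- The sum `totalSum` evaluated at a tuple of six vertices. -/
noncomputable def tupleTotal {V : Type*} (δ : V → V → ArcType) (x : Fin 6 → V) : ℤ :=
  totalAt δ (x 0) (x 1) (x 2) (x 3) (x 4) (x 5)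

theorem tupleTotal_comp_perm {V : Type*} {δ : V → V → ArcType}
    (hδ : ∀ u v, δ v u = (δ u v).rev) (σ : Equiv.Perm (Fin 6)) (x : Fin 6 → V) :
    tupleTotal δ (x ∘ σ) = tupleTotal δ x := by
  have hσ : σ ∈ Submonoid.closure
      (Set.range fun i : Fin 5 => Equiv.swap i.castSucc i.succ) := by
    rw [Equiv.Perm.mclosure_swap_castSucc_succ]
    trivial
  induction hσ using Submonoid.closure_induction generalizing x with
  | mem σ h =>
    obtain ⟨i, rfl⟩ := h
    fin_cases i
    · exact totalAt_swap_first_second hδ _ _ _ _ _ _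
    · exact totalAt_swap_second_third hδ _ _ _ _ _ _
    · exact totalAt_swap_third_fourth hδ _ _ _ _ _ _
    · exact totalAt_swap_fourth_fifth hδ _ _ _ _ _ _
    · exact totalAt_swap_fifth_sixth hδ _ _ _ _ _ _
  | one => rfl
  | mul σ τ _ _ hσ hτ => exact (hτ (x ∘ σ)).trans (hσ x)

theorem sum_comp_perm {V : Type*} [Fintype V] (F : V → V → V → V → V → V → ℤ)
    (i₀ i₁ i₂ i₃ i₄ i₅ : Fin 6) (h : Function.Bijective ![i₀, i₁, i₂, i₃, i₄, i₅]) :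
    ∑ x : Fin 6 → V, F (x i₀) (x i₁) (x i₂) (x i₃) (x i₄) (x i₅) =
      ∑ x : Fin 6 → V, F (x 0) (x 1) (x 2) (x 3) (x 4) (x 5) :=
  Fintype.sum_equiv ((Equiv.ofBijective _ h).arrowCongr (Equiv.refl V)).symm _ _ fun _ => rfl

theorem sum_quadAt {V : Type*} [Fintype V] (δ : V → V → ArcType) :
    ∑ x : Fin 6 → V, quadAt δ (x 0) (x 1) (x 2) (x 3) (x 4) (x 5) =
      24 * ∑ x : Fin 6 → V, flagPairAt δ (x 0) (x 1) (x 2) (x 3) (x 4) (x 5) := by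
  simp only [quadAt_eq, Finset.sum_add_distrib]
  linear_combination
    sum_comp_perm (flagPairAt δ) 0 1 2 3 4 5 (by decide) +
    sum_comp_perm (flagPairAt δ) 0 1 3 2 4 5 (by decide) +
    sum_comp_perm (flagPairAt δ) 0 2 1 3 4 5 (by decide) +
    sum_comp_perm (flagPairAt δ) 0 2 3 1 4 5 (by decide) +
    sum_comp_perm (flagPairAt δ) 0 3 1 2 4 5 (by decide) +
    sum_comp_perm (flagPairAt δ) 0 3 2 1 4 5 (by decide) +
    sum_comp_perm (flagPairAt δ) 1 0 2 3 4 5 (by decide) +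
    sum_comp_perm (flagPairAt δ) 1 0 3 2 4 5 (by decide) +
    sum_comp_perm (flagPairAt δ) 1 2 0 3 4 5 (by decide) +
    sum_comp_perm (flagPairAt δ) 1 2 3 0 4 5 (by decide) +
    sum_comp_perm (flagPairAt δ) 1 3 0 2 4 5 (by decide) +
    sum_comp_perm (flagPairAt δ) 1 3 2 0 4 5 (by decide) +
    sum_comp_perm (flagPairAt δ) 2 0 1 3 4 5 (by decide) +
    sum_comp_perm (flagPairAt δ) 2 0 3 1 4 5 (by decide) +
    sum_comp_perm (flagPairAt δ) 2 1 0 3 4 5 (by decide) +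
    sum_comp_perm (flagPairAt δ) 2 1 3 0 4 5 (by decide) +
    sum_comp_perm (flagPairAt δ) 2 3 0 1 4 5 (by decide) +
    sum_comp_perm (flagPairAt δ) 2 3 1 0 4 5 (by decide) +
    sum_comp_perm (flagPairAt δ) 3 0 1 2 4 5 (by decide) +
    sum_comp_perm (flagPairAt δ) 3 0 2 1 4 5 (by decide) +
    sum_comp_perm (flagPairAt δ) 3 1 0 2 4 5 (by decide) +
    sum_comp_perm (flagPairAt δ) 3 1 2 0 4 5 (by decide) +
    sum_comp_perm (flagPairAt δ) 3 2 0 1 4 5 (by decide) +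
    sum_comp_perm (flagPairAt δ) 3 2 1 0 4 5 (by decide)

theorem sum_pairAt {V : Type*} [Fintype V] (δ : V → V → ArcType) :
    ∑ x : Fin 6 → V, pairAt δ (x 0) (x 1) (x 2) (x 3) (x 4) (x 5) =
      6 * ∑ x : Fin 6 → V, pairProdAt δ (x 0) (x 1) (x 2) (x 3) (x 4) (x 5) := by
  simp only [pairAt_eq, Finset.sum_add_distrib]
  linear_combination
    sum_comp_perm (pairProdAt δ) 0 1 2 3 4 5 (by decide) +
    sum_comp_perm (pairProdAt δ) 0 1 2 4 3 5 (by decide) +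
    sum_comp_perm (pairProdAt δ) 0 1 2 5 3 4 (by decide) +
    sum_comp_perm (pairProdAt δ) 1 0 2 3 4 5 (by decide) +
    sum_comp_perm (pairProdAt δ) 1 0 2 4 3 5 (by decide) +
    sum_comp_perm (pairProdAt δ) 1 0 2 5 3 4 (by decide)

theorem sum_tupleTotal {V : Type*} [Fintype V] (δ : V → V → ArcType) :
    ∑ x : Fin 6 → V, tupleTotal δ x =
      15 * ∑ x : Fin 6 → V, quadAt δ (x 0) (x 1) (x 2) (x 3) (x 4) (x 5) +
        15 * ∑ x : Fin 6 → V, pairAt δ (x 0) (x 1) (x 2) (x 3) (x 4) (x 5) := by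
  simp only [tupleTotal, totalAt_eq, Finset.sum_add_distrib]
  linear_combination
    sum_comp_perm (quadAt δ) 2 3 4 5 0 1 (by decide) +
    sum_comp_perm (quadAt δ) 1 3 4 5 0 2 (by decide) +
    sum_comp_perm (quadAt δ) 1 2 4 5 0 3 (by decide) +
    sum_comp_perm (quadAt δ) 1 2 3 5 0 4 (by decide) +
    sum_comp_perm (quadAt δ) 1 2 3 4 0 5 (by decide) +
    sum_comp_perm (quadAt δ) 0 3 4 5 1 2 (by decide) +
    sum_comp_perm (quadAt δ) 0 2 4 5 1 3 (by decide) +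
    sum_comp_perm (quadAt δ) 0 2 3 5 1 4 (by decide) +
    sum_comp_perm (quadAt δ) 0 2 3 4 1 5 (by decide) +
    sum_comp_perm (quadAt δ) 0 1 4 5 2 3 (by decide) +
    sum_comp_perm (quadAt δ) 0 1 3 5 2 4 (by decide) +
    sum_comp_perm (quadAt δ) 0 1 3 4 2 5 (by decide) +
    sum_comp_perm (quadAt δ) 0 1 2 5 3 4 (by decide) +
    sum_comp_perm (quadAt δ) 0 1 2 4 3 5 (by decide) +
    sum_comp_perm (quadAt δ) 0 1 2 3 4 5 (by decide) +
    sum_comp_perm (pairAt δ) 0 1 2 3 4 5 (by decide) +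
    sum_comp_perm (pairAt δ) 0 2 1 3 4 5 (by decide) +
    sum_comp_perm (pairAt δ) 0 3 1 2 4 5 (by decide) +
    sum_comp_perm (pairAt δ) 0 4 1 2 3 5 (by decide) +
    sum_comp_perm (pairAt δ) 0 5 1 2 3 4 (by decide) +
    sum_comp_perm (pairAt δ) 1 2 0 3 4 5 (by decide) +
    sum_comp_perm (pairAt δ) 1 3 0 2 4 5 (by decide) +
    sum_comp_perm (pairAt δ) 1 4 0 2 3 5 (by decide) +
    sum_comp_perm (pairAt δ) 1 5 0 2 3 4 (by decide) +
    sum_comp_perm (pairAt δ) 2 3 0 1 4 5 (by decide) +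
    sum_comp_perm (pairAt δ) 2 4 0 1 3 5 (by decide) +
    sum_comp_perm (pairAt δ) 2 5 0 1 3 4 (by decide) +
    sum_comp_perm (pairAt δ) 3 4 0 1 2 5 (by decide) +
    sum_comp_perm (pairAt δ) 3 5 0 1 2 4 (by decide) +
    sum_comp_perm (pairAt δ) 4 5 0 1 2 3 (by decide)

theorem sum_fin_succ {V : Type*} [Fintype V] {n : ℕ} (f : (Fin (n + 1) → V) → ℤ) :
    ∑ x, f x = ∑ a, ∑ y : Fin n → V, f (Fin.cons a y) := by
  rw [← (Fin.consEquiv fun _ => V).sum_comp f, Fintype.sum_prod_type]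
  rfl

theorem sum_fin_six {V : Type*} [Fintype V] (F : V → V → V → V → V → V → ℤ) :
    ∑ x : Fin 6 → V, F (x 0) (x 1) (x 2) (x 3) (x 4) (x 5) =
      ∑ a, ∑ b, ∑ c, ∑ d, ∑ e, ∑ g, F a b c d e g := by
  simp only [sum_fin_succ, Fintype.sum_unique]
  rfl

theorem sum_pairProdAt_nonneg {V : Type*} [Fintype V] (δ : V → V → ArcType) :
    0 ≤ ∑ x : Fin 6 → V, pairProdAt δ (x 0) (x 1) (x 2) (x 3) (x 4) (x 5) := by
  rw [sum_fin_six]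
  refine Finset.sum_nonneg fun a _ => Finset.sum_nonneg fun b _ => ?_
  have h : ∑ c, ∑ d, ∑ e, ∑ g, pairProdAt δ a b c d e g = ∑ k ∈ Finset.range 15,
      (∑ c, ∑ d, comp k ((pairTree.sel (δ a b)).sel5 (δ a c) (δ b c) (δ a d) (δ b d) (δ c d))) *
      (∑ c, ∑ d,
        comp k ((pairTree.sel (δ a b)).sel5 (δ a c) (δ b c) (δ a d) (δ b d) (δ c d))) := by
    simp only [pairProdAt, pairProd, Finset.sum_comm (t := Finset.range 15)]
    refine Finset.sum_congr rfl fun k _ => ?_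
    simp only [Finset.sum_mul]
    simp only [Finset.mul_sum]
  rw [h]
  exact Finset.sum_nonneg fun k _ => mul_self_nonneg _

/-- The integer stored for a relation of a root to a further vertex. -/
noncomputable def ArcType.rootValue (d : ArcType) : ℤ := d.rootDigit - 1048576

theorem comp_of_rootDigitsCheck {t : FlagTree} {d₀ d₁ d₂ d₃ : ArcType}
    (h : rootDigitsCheck t d₀ d₁ d₂ d₃ = true) :
    comp 11 t = d₀.rootValue ∧ comp 12 t = d₁.rootValue ∧ comp 13 t = d₂.rootValue ∧
      comp 14 t = d₃.rootValue := by
  cases t with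
  | nil => exact absurd h Bool.false_ne_true
  | node x y z => exact absurd h Bool.false_ne_true
  | leaf w =>
    simp only [rootDigitsCheck, Bool.and_eq_true, Nat.beq_eq] at h
    simp only [comp_leaf, ArcType.rootValue, h, and_self]

theorem sum_comp_eq_zero {V : Type*} [Fintype V] {δ : V → V → ArcType}
    (hδ : ∀ a, ∑ z, (δ a z).rootValue = 0) {t : FlagTree} (ht : flagTreeCheck t = true)
    (a b c d : V) {k : ℕ} (hk : 11 ≤ k) (hk' : k < 15) :
    ∑ z, comp k (t.sel4 (δ a z) (δ b z) (δ c z) (δ d z)) = 0 := by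
  cases t with
  | nil => exact Finset.sum_eq_zero fun _ _ => rfl
  | leaf w => exact Finset.sum_eq_zero fun _ _ => rfl
  | node x y z =>
    have h : ∀ d₀ d₁ d₂ d₃,
        rootDigitsCheck ((FlagTree.node x y z).sel4 d₀ d₁ d₂ d₃) d₀ d₁ d₂ d₃ = true := by
      simpa only [flagTreeCheck, allArcs_eq_true_iff] using ht
    have h' := fun d₀ d₁ d₂ d₃ => comp_of_rootDigitsCheck (h d₀ d₁ d₂ d₃)
    interval_cases k
    · simp only [h', hδ]
    · simp only [h', hδ]
    · simp only [h', hδ]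
    · simp only [h', hδ]

theorem sum_flagPairAt_nonneg {V : Type*} [Fintype V] {δ : V → V → ArcType}
    (hδ : ∀ a, ∑ z, (δ a z).rootValue = 0) :
    0 ≤ ∑ x : Fin 6 → V, flagPairAt δ (x 0) (x 1) (x 2) (x 3) (x 4) (x 5) := by
  rw [sum_fin_six]
  refine Finset.sum_nonneg fun a _ => Finset.sum_nonneg fun b _ => Finset.sum_nonneg fun c _ =>
    Finset.sum_nonneg fun d _ => ?_
  set t := baseTree.sel6 (δ a b) (δ a c) (δ b c) (δ a d) (δ b d) (δ c d) with ht
  have hcheck : flagTreeCheck t = true := by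
    have h := baseTreeCheck_eq_true
    simp only [baseTreeCheck, allArcs_eq_true_iff] at h
    exact h _ _ _ _ _ _
  have h : ∑ z, ∑ w, flagPairAt δ a b c d z w = ∑ k ∈ Finset.range 15,
      (∑ z, comp k (t.sel4 (δ a z) (δ b z) (δ c z) (δ d z))) *
      (∑ w, comp (dual k) (t.sel4 (δ a w) (δ b w) (δ c w) (δ d w))) := by
    simp only [flagPairAt, flagPair, Finset.sum_comm (t := Finset.range 15), Finset.sum_mul_sum, ht]
  rw [h]
  refine Finset.sum_nonneg fun k hk => ?_
  rw [Finset.mem_range] at hk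
  rcases lt_or_ge k 7 with h7 | h7
  · rw [dual, if_pos h7]
    exact mul_self_nonneg _
  · rcases lt_or_ge k 11 with h11 | h11
    · rw [dual, if_neg (by omega), if_pos h11, sum_comp_eq_zero hδ hcheck (k := k + 4) _ _ _ _
        (by omega) (by omega), mul_zero]
    · rw [sum_comp_eq_zero hδ hcheck (k := k) _ _ _ _ h11 hk, zero_mul]

theorem sum_tupleTotal_nonneg {V : Type*} [Fintype V] {δ : V → V → ArcType}
    (hδ : ∀ a, ∑ z, (δ a z).rootValue = 0) : 0 ≤ ∑ x : Fin 6 → V, tupleTotal δ x := by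
  rw [sum_tupleTotal, sum_quadAt, sum_pairAt]
  have h₁ := sum_flagPairAt_nonneg hδ
  have h₂ := sum_pairProdAt_nonneg δ
  positivity

open Classical in
/-- The relation of two vertices of a directed graph. -/
noncomputable def arcOf {V : Type*} (E : V → V → Prop) (u v : V) : ArcType :=
  if E u v then .f else if E v u then .b else .o

theorem arcOf_eq_f {V : Type*} {E : V → V → Prop} {u v : V} (h : E u v) : arcOf E u v = .f :=
  if_pos h

theorem arcOf_eq_o {V : Type*} {E : V → V → Prop} {u v : V} (h : ¬ E u v) (h' : ¬ E v u) :
    arcOf E u v = .o := by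
  rw [arcOf, if_neg h, if_neg h']

theorem rel_of_arcOf_eq_f {V : Type*} {E : V → V → Prop} {u v : V} (h : arcOf E u v = .f) :
    E u v := by
  unfold arcOf at h
  split_ifs at h
  assumption

theorem rel_of_arcOf_eq_b {V : Type*} {E : V → V → Prop} {u v : V} (h : arcOf E u v = .b) :
    E v u := by
  unfold arcOf at h
  split_ifs at h
  assumption

theorem arcOf_swap {V : Type*} {E : V → V → Prop} (hE : ∀ u v, E u v → ¬ E v u) (u v : V) :
    arcOf E v u = (arcOf E u v).rev := by
  unfold arcOf
  have := hE u v
  split_ifs <;> first | rfl | tauto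

theorem sum_rootValue_arcOf {n : ℕ} (E : Fin n → Fin n → Prop) (v : Fin n) :
    ∑ z, (arcOf E v z).rootValue = 100000 * (outDeg E v : ℤ) - 20009 * n := by
  classical
  have h : ∀ z, (arcOf E v z).rootValue = 100000 * (if E v z then 1 else 0) - 20009 := by
    intro z
    unfold arcOf
    split_ifs <;> rfl
  simp only [h, Finset.sum_sub_distrib, ← Finset.mul_sum, Finset.sum_boole, Finset.sum_const,
    Finset.card_univ, Fintype.card_fin, nsmul_eq_mul]
  rw [outDeg, Set.ncard_eq_toFinset_card', Set.toFinset_ofPred]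
  ring

theorem bothArcs_apply {k : ArcType → ArcType → Bool} (h : bothArcs k = true) {d : ArcType}
    (hd : d ≠ .b) : k d d.rev = true := by
  rw [bothArcs, Bool.and_eq_true] at h
  cases d
  exacts [h.1, h.2, absurd rfl hd]

theorem acyclicCheck_eq_true {ab ac bc ad : ArcType} (hab : ab ≠ .b) (hac : ac ≠ .b)
    (hbc : bc ≠ .b) (had : ad ≠ .b) :
    acyclicCheck ab ab.rev ac ac.rev bc bc.rev ad ad.rev = true := by
  cases ab <;> cases ac <;> cases bc <;> cases ad <;> first | contradiction | skip
  · exact acyclicCheck_oooo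
  · exact acyclicCheck_ooof
  · exact acyclicCheck_oofo
  · exact acyclicCheck_ooff
  · exact acyclicCheck_ofoo
  · exact acyclicCheck_ofof
  · exact acyclicCheck_offo
  · exact acyclicCheck_offf
  · exact acyclicCheck_fooo
  · exact acyclicCheck_foof
  · exact acyclicCheck_fofo
  · exact acyclicCheck_foff
  · exact acyclicCheck_ffoo
  · exact acyclicCheck_ffof
  · exact acyclicCheck_fffo
  · exact acyclicCheck_ffff

/-- The code of the first five vertices of a tuple. -/
noncomputable def tupleCode {V : Type*} (δ : V → V → ArcType) (x : Fin 6 → V) : ℕ :=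
  arcCode
    (δ (x 0) (x 1)) (δ (x 0) (x 2)) (δ (x 1) (x 2)) (δ (x 0) (x 3)) (δ (x 1) (x 3))
    (δ (x 2) (x 3)) (δ (x 0) (x 4)) (δ (x 1) (x 4)) (δ (x 2) (x 4)) (δ (x 3) (x 4))

theorem tupleTotal_neg_of_arcCodeLocalMax {V : Type*} {δ : V → V → ArcType}
    (hδ : ∀ u v, δ v u = (δ u v).rev) {x : Fin 6 → V}
    (hx : ∀ i j, i < j → δ (x i) (x j) ≠ .b)
    (hmax : arcCodeLocalMax
      (δ (x 0) (x 1)) (δ (x 0) (x 2)) (δ (x 1) (x 2)) (δ (x 0) (x 3)) (δ (x 1) (x 3))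
      (δ (x 2) (x 3)) (δ (x 0) (x 4)) (δ (x 1) (x 4)) (δ (x 2) (x 4)) (δ (x 3) (x 4)) = true) :
    tupleTotal δ x < 0 := by
  have h := acyclicCheck_eq_true (hx 0 1 (by decide)) (hx 0 2 (by decide)) (hx 1 2 (by decide))
    (hx 0 3 (by decide))
  unfold acyclicCheck at h
  replace h := bothArcs_apply h (hx 1 3 (by decide))
  replace h := bothArcs_apply h (hx 2 3 (by decide))
  replace h := bothArcs_apply h (hx 0 4 (by decide))
  replace h := bothArcs_apply h (hx 1 4 (by decide))
  replace h := bothArcs_apply h (hx 2 4 (by decide))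
  replace h := bothArcs_apply h (hx 3 4 (by decide))
  rw [hmax, Bool.not_true, Bool.false_or] at h
  replace h := bothArcs_apply h (hx 0 5 (by decide))
  replace h := bothArcs_apply h (hx 1 5 (by decide))
  replace h := bothArcs_apply h (hx 2 5 (by decide))
  replace h := bothArcs_apply h (hx 3 5 (by decide))
  replace h := bothArcs_apply h (hx 4 5 (by decide))
  unfold tupleTotal totalAt
  rw [
    hδ (x 0) (x 1), hδ (x 0) (x 2), hδ (x 0) (x 3), hδ (x 0) (x 4), hδ (x 0) (x 5),
    hδ (x 1) (x 2), hδ (x 1) (x 3), hδ (x 1) (x 4), hδ (x 1) (x 5), hδ (x 2) (x 3),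
    hδ (x 2) (x 4), hδ (x 2) (x 5), hδ (x 3) (x 4), hδ (x 3) (x 5), hδ (x 4) (x 5)]
  exact totalSum_neg_of_packedNeg h

theorem swap_castSucc_succ_lt : ∀ k : Fin 5, ∀ i j : Fin 6, i < j →
    Equiv.swap k.castSucc k.succ i < Equiv.swap k.castSucc k.succ j ∨
      i = k.castSucc ∧ j = k.succ := by
  decide

theorem not_isNone_or_ble {d : ArcType} {m n : ℕ} (h : d = .o → m ≤ n) :
    (!d.isNone || Nat.ble m n) = true := by
  cases d
  · exact Nat.ble_eq_true_of_le (h rfl)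
  · rfl
  · rfl

theorem tupleTotal_neg_of_sorted {V : Type*} {δ : V → V → ArcType}
    (hδ : ∀ u v, δ v u = (δ u v).rev) {x : Fin 6 → V}
    (hx : ∀ i j, i < j → δ (x i) (x j) ≠ .b) : tupleTotal δ x < 0 := by
  classical
  obtain ⟨σ, hσ, hmax⟩ := Finset.exists_max_image
    (Finset.univ.filter fun σ : Equiv.Perm (Fin 6) => ∀ i j, i < j → δ (x (σ i)) (x (σ j)) ≠ .b)
    (fun σ => tupleCode δ (x ∘ σ)) ⟨1, Finset.mem_filter.2 ⟨Finset.mem_univ _, hx⟩⟩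
  replace hσ := (Finset.mem_filter.1 hσ).2
  rw [← tupleTotal_comp_perm hδ σ x]
  generalize hy : x ∘ σ = y at *
  have hyσ : ∀ i, x (σ i) = y i := fun i => congrFun hy i
  simp only [hyσ] at hσ
  have hswap : ∀ k : Fin 5, δ (y k.castSucc) (y k.succ) = .o →
      tupleCode δ (y ∘ Equiv.swap k.castSucc k.succ) ≤ tupleCode δ y := by
    intro k hk
    have h := hmax (σ * Equiv.swap k.castSucc k.succ)
      (Finset.mem_filter.2 ⟨Finset.mem_univ _, fun i j hij => ?_⟩)
    · rwa [Equiv.Perm.coe_mul, ← Function.comp_assoc, hy] at h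
    · simp only [Equiv.Perm.mul_apply, hyσ]
      rcases swap_castSucc_succ_lt k i j hij with h | ⟨rfl, rfl⟩
      · exact hσ _ _ h
      · rw [Equiv.swap_apply_left, Equiv.swap_apply_right, hδ (y k.castSucc), hk]
        exact ArcType.noConfusion
  refine tupleTotal_neg_of_arcCodeLocalMax hδ hσ ?_
  unfold arcCodeLocalMax
  simp only [Bool.and_eq_true]
  refine ⟨⟨?_, ?_⟩, ?_, ?_⟩
  · refine not_isNone_or_ble fun hk => ?_
    have h : arcCode
        (δ (y 1) (y 0)) (δ (y 1) (y 2)) (δ (y 0) (y 2)) (δ (y 1) (y 3)) (δ (y 0) (y 3))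
        (δ (y 2) (y 3)) (δ (y 1) (y 4)) (δ (y 0) (y 4)) (δ (y 2) (y 4)) (δ (y 3) (y 4)) ≤
        tupleCode δ y :=
      hswap 0 hk
    have hk' : δ (y 1) (y 0) = δ (y 0) (y 1) := by
      rw [hδ (y 0), hk]
      rfl
    rwa [hk'] at h
  · refine not_isNone_or_ble fun hk => ?_
    have h : arcCode
        (δ (y 0) (y 2)) (δ (y 0) (y 1)) (δ (y 2) (y 1)) (δ (y 0) (y 3)) (δ (y 2) (y 3))
        (δ (y 1) (y 3)) (δ (y 0) (y 4)) (δ (y 2) (y 4)) (δ (y 1) (y 4)) (δ (y 3) (y 4)) ≤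
        tupleCode δ y :=
      hswap 1 hk
    have hk' : δ (y 2) (y 1) = δ (y 1) (y 2) := by
      rw [hδ (y 1), hk]
      rfl
    rwa [hk'] at h
  · refine not_isNone_or_ble fun hk => ?_
    have h : arcCode
        (δ (y 0) (y 1)) (δ (y 0) (y 3)) (δ (y 1) (y 3)) (δ (y 0) (y 2)) (δ (y 1) (y 2))
        (δ (y 3) (y 2)) (δ (y 0) (y 4)) (δ (y 1) (y 4)) (δ (y 3) (y 4)) (δ (y 2) (y 4)) ≤
        tupleCode δ y :=
      hswap 2 hk
    have hk' : δ (y 3) (y 2) = δ (y 2) (y 3) := by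
      rw [hδ (y 2), hk]
      rfl
    rwa [hk'] at h
  · refine not_isNone_or_ble fun hk => ?_
    have h : arcCode
        (δ (y 0) (y 1)) (δ (y 0) (y 2)) (δ (y 1) (y 2)) (δ (y 0) (y 4)) (δ (y 1) (y 4))
        (δ (y 2) (y 4)) (δ (y 0) (y 3)) (δ (y 1) (y 3)) (δ (y 2) (y 3)) (δ (y 4) (y 3)) ≤
        tupleCode δ y :=
      hswap 3 hk
    have hk' : δ (y 4) (y 3) = δ (y 3) (y 4) := by
      rw [hδ (y 3), hk]
      rfl
    rwa [hk'] at h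

theorem noDetour_eq_true {d e : ArcType} (h : ¬ (d = .f ∧ e = .b)) : noDetour d e = true := by
  cases d <;> cases e <;> first | rfl | exact absurd ⟨rfl, rfl⟩ h

theorem tupleTotal_neg_of_pentagon {V : Type*} {δ : V → V → ArcType}
    (hδ : ∀ u v, δ v u = (δ u v).rev) {x : Fin 6 → V}
    (h₀₁ : δ (x 0) (x 1) = .f) (h₁₂ : δ (x 1) (x 2) = .f) (h₂₃ : δ (x 2) (x 3) = .f)
    (h₃₄ : δ (x 3) (x 4) = .f) (h₄₀ : δ (x 4) (x 0) = .f) (h₀₂ : δ (x 0) (x 2) = .o)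
    (h₁₃ : δ (x 1) (x 3) = .o) (h₂₄ : δ (x 2) (x 4) = .o) (h₀₃ : δ (x 0) (x 3) = .o)
    (h₁₄ : δ (x 1) (x 4) = .o)
    (hx : ∀ i j : Fin 5, j ≠ i + 3 →
      ¬ (δ (x 5) (x i.castSucc) = .f ∧ δ (x 5) (x j.castSucc) = .b)) :
    tupleTotal δ x < 0 := by
  have h₀₄ : δ (x 0) (x 4) = .b := by
    rw [hδ (x 4), h₄₀]
    rfl
  have hcompat : pentagonCompatible (δ (x 5) (x 0)) (δ (x 5) (x 1)) (δ (x 5) (x 2))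
      (δ (x 5) (x 3)) (δ (x 5) (x 4)) = true := by
    have h := fun i j hij => noDetour_eq_true (hx i j hij)
    simp only [pentagonCompatible, Bool.and_eq_true]
    refine ⟨⟨⟨⟨h 0 0 ?_, h 0 1 ?_⟩, h 0 2 ?_, h 0 4 ?_, h 1 0 ?_⟩,
      ⟨h 1 1 ?_, h 1 2 ?_⟩, h 1 3 ?_, h 2 1 ?_, h 2 2 ?_⟩,
      ⟨⟨h 2 3 ?_, h 2 4 ?_⟩, h 3 0 ?_, h 3 2 ?_, h 3 3 ?_⟩,
      ⟨h 3 4 ?_, h 4 0 ?_⟩, h 4 1 ?_, h 4 3 ?_, h 4 4 ?_⟩ <;> decide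
  have h := pentagonCheck_eq_true
  simp only [pentagonCheck, anyArcs_eq_true_iff] at h
  replace h := h (δ (x 5) (x 0)) (δ (x 5) (x 1)) (δ (x 5) (x 2)) (δ (x 5) (x 3)) (δ (x 5) (x 4))
  rw [hcompat, Bool.not_true, Bool.false_or] at h
  unfold tupleTotal totalAt
  rw [
    hδ (x 0) (x 1), hδ (x 0) (x 2), hδ (x 0) (x 3), hδ (x 0) (x 4), hδ (x 1) (x 2),
    hδ (x 1) (x 3), hδ (x 1) (x 4), hδ (x 2) (x 3), hδ (x 2) (x 4), hδ (x 3) (x 4),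
    hδ (x 5) (x 0), hδ (x 5) (x 1), hδ (x 5) (x 2), hδ (x 5) (x 3), hδ (x 5) (x 4), h₀₁, h₁₂,
    h₂₃, h₃₄, h₀₄, h₀₂, h₁₃, h₂₄, h₀₃, h₁₄]
  exact totalSum_neg_of_packedNeg h

theorem not_diTriangle {n : ℕ} {E : Fin n → Fin n → Prop} (h₁ : ∀ a, ¬ E a a)
    (h₃ : ¬ HasDiCycle E 3) (a b c : Fin n) : E a b → E b c → ¬ E c a := by
  intro hab hbc hca
  refine h₃ ⟨(![a, b, c] : Fin 3 → Fin n), ?_, ?_⟩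
  · have : a ≠ b := by rintro rfl; exact h₁ _ hab
    have : b ≠ c := by rintro rfl; exact h₁ _ hbc
    have : c ≠ a := by rintro rfl; exact h₁ _ hca
    intro (i : Fin 3) (j : Fin 3) hij
    fin_cases i <;> fin_cases j <;> simp at hij ⊢ <;> grind
  · intro (i : Fin 3)
    fin_cases i
    exacts [hab, hbc, hca]

theorem not_diSquare {n : ℕ} {E : Fin n → Fin n → Prop} (h₁ : ∀ a, ¬ E a a)
    (h₂ : ∀ a b, E a b → ¬ E b a) (h₄ : ¬ HasDiCycle E 4) (a b c d : Fin n) :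
    E a b → E b c → E c d → ¬ E d a := by
  intro hab hbc hcd hda
  refine h₄ ⟨(![a, b, c, d] : Fin 4 → Fin n), ?_, ?_⟩
  · intro (i : Fin 4) (j : Fin 4) hij
    fin_cases i <;> fin_cases j <;> simp at hij ⊢ <;> grind
  · intro (i : Fin 4)
    fin_cases i
    exacts [hab, hbc, hcd, hda]

theorem not_diHexagon {n : ℕ} {E : Fin n → Fin n → Prop} (h₁ : ∀ a, ¬ E a a)
    (h₂ : ∀ a b, E a b → ¬ E b a) (h₃ : ∀ a b c, E a b → E b c → ¬ E c a)
    (h₆ : ¬ HasDiCycle E 6) (a b c d e g : Fin n) :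
    E a b → E b c → E c d → E d e → E e g → ¬ E g a := by
  intro hab hbc hcd hde heg hga
  refine h₆ ⟨(![a, b, c, d, e, g] : Fin 6 → Fin n), ?_, ?_⟩
  · intro (i : Fin 6) (j : Fin 6) hij
    fin_cases i <;> fin_cases j <;> simp at hij ⊢ <;> grind
  · intro (i : Fin 6)
    fin_cases i
    exacts [hab, hbc, hcd, hde, heg, hga]

theorem exists_walk_of_transGen {V : Type*} {R : V → V → Prop} {a b : V}
    (h : Relation.TransGen R a b) :
    ∃ t > 0, ∃ w : ℕ → V, w 0 = a ∧ w t = b ∧ ∀ i < t, R (w i) (w (i + 1)) := by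
  induction h using Relation.TransGen.head_induction_on with
  | single h =>
    rename_i a
    refine ⟨1, one_pos, fun k => Nat.casesOn k a fun _ => b, rfl, rfl, fun i hi => ?_⟩
    obtain rfl : i = 0 := by omega
    exact h
  | head h _ ih =>
    rename_i a c _
    obtain ⟨t, _, w, rfl, rfl, hw⟩ := ih
    refine ⟨t + 1, t.succ_pos, fun k => Nat.casesOn k a w, rfl, rfl, fun i hi => ?_⟩
    cases i with
    | zero => exact h
    | succ i => exact hw i (by omega)

/-- A directed graph in which some closed walk exists has an injective closed walk. -/
theorem exists_injOn_closedWalk {V : Type*} {R : V → V → Prop} {a : V}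
    (h : Relation.TransGen R a a) :
    ∃ t > 0, ∃ w : ℕ → V, w t = w 0 ∧ (∀ i < t, R (w i) (w (i + 1))) ∧
      ∀ i < t, ∀ j < t, w i = w j → i = j := by
  classical
  have hex : ∃ t, 0 < t ∧ ∃ w : ℕ → V, w t = w 0 ∧ ∀ i < t, R (w i) (w (i + 1)) := by
    obtain ⟨t, ht, w, h₀, h₁, hw⟩ := exists_walk_of_transGen h
    exact ⟨t, ht, w, h₁.trans h₀.symm, hw⟩
  obtain ⟨ht, w, hwt, hw⟩ := Nat.find_spec hex
  have hlt : ∀ i j, i < j → j < Nat.find hex → w i ≠ w j := fun i j hij hj hwij =>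
    Nat.find_min hex (m := j - i) (by omega) ⟨by omega, fun k => w (i + k), by
      change w (i + (j - i)) = w (i + 0)
      rw [Nat.add_sub_of_le hij.le, ← hwij, Nat.add_zero], fun k hk => hw _ (by omega)⟩
  refine ⟨_, ht, w, hwt, hw, fun i hi j hj hij => ?_⟩
  by_contra hne
  rcases Nat.lt_or_gt_of_ne hne with h | h
  · exact hlt i j h hj hij
  · exact hlt j i h hi hij.symm

theorem exists_perm_of_acyclic {k : ℕ} {R : Fin k → Fin k → Prop}
    (h : ∀ i, ¬ Relation.TransGen R i i) :
    ∃ σ : Equiv.Perm (Fin k), ∀ i j, i < j → ¬ R (σ j) (σ i) := by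
  classical
  let f : Fin k → ℕ := fun i => (Finset.univ.filter fun j => Relation.TransGen R i j).card
  have hf : ∀ i j, R i j → f j < f i := by
    intro i j hij
    refine Finset.card_lt_card (Finset.ssubset_iff_of_subset ?_ |>.2 ⟨j, ?_, ?_⟩)
    · intro l hl
      rw [Finset.mem_filter] at hl ⊢
      exact ⟨hl.1, .head hij hl.2⟩
    · exact Finset.mem_filter.2 ⟨Finset.mem_univ _, .single hij⟩
    · exact fun hj => h j (Finset.mem_filter.1 hj).2
  refine ⟨Tuple.sort fun i => OrderDual.toDual (f i), fun i j hij hR => ?_⟩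
  have h₁ := Tuple.monotone_sort (fun i => OrderDual.toDual (f i)) hij.le
  have h₂ := hf _ _ hR
  exact absurd h₁ (not_le_of_gt h₂)

theorem tupleTotal_arcOf_neg {n : ℕ} {E : Fin n → Fin n → Prop} (h₁ : ∀ a, ¬ E a a)
    (h₂ : ∀ a b, E a b → ¬ E b a) (h₃ : ∀ a b c, E a b → E b c → ¬ E c a)
    (h₄ : ∀ a b c d, E a b → E b c → E c d → ¬ E d a)
    (h₆ : ∀ a b c d e g, E a b → E b c → E c d → E d e → E e g → ¬ E g a)
    (x : Fin 6 → Fin n) : tupleTotal (arcOf E) x < 0 := by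
  have hδ := arcOf_swap h₂
  by_cases hR : ∀ i, ¬ Relation.TransGen (fun i j => E (x i) (x j)) i i
  · obtain ⟨σ, hσ⟩ := exists_perm_of_acyclic hR
    rw [← tupleTotal_comp_perm hδ σ]
    exact tupleTotal_neg_of_sorted hδ fun i j hij h => hσ i j hij (rel_of_arcOf_eq_b h)
  · push Not at hR
    obtain ⟨i, hi⟩ := hR
    obtain ⟨t, ht, w, hwt, hw, hinj⟩ := exists_injOn_closedWalk hi
    have ht₆ : t ≤ 6 := by
      have h := Fintype.card_le_of_injective (fun i : Fin t => w i)
        fun i j hij => Fin.ext (hinj i i.2 j j.2 hij)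
      simpa only [Fintype.card_fin] using h
    obtain rfl : t = 5 := by
      by_contra ht₅
      interval_cases t
      · exact h₁ _ (hwt ▸ hw 0 (by decide))
      · exact h₂ _ _ (hw 0 (by decide)) (hwt ▸ hw 1 (by decide))
      · exact h₃ _ _ _ (hw 0 (by decide)) (hw 1 (by decide)) (hwt ▸ hw 2 (by decide))
      · exact h₄ _ _ _ _ (hw 0 (by decide)) (hw 1 (by decide)) (hw 2 (by decide))
          (hwt ▸ hw 3 (by decide))
      · exact ht₅ rfl
      · exact h₆ _ _ _ _ _ _ (hw 0 (by decide)) (hw 1 (by decide)) (hw 2 (by decide))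
          (hw 3 (by decide)) (hw 4 (by decide)) (hwt ▸ hw 5 (by decide))
    obtain ⟨v, hv⟩ : ∃ v, ∀ i : Fin 5, w i ≠ v := by
      by_contra! h
      have := Fintype.card_le_of_surjective (fun i : Fin 5 => w i) h
      simp at this
    have hσ : Function.Injective (Fin.snoc (fun i : Fin 5 => w i) v : Fin 6 → Fin 6) :=
      Fin.snoc_injective_iff.2 ⟨fun i j hij => Fin.ext (hinj i i.2 j j.2 hij), by
        rintro ⟨i, hi⟩
        exact hv i hi⟩
    let σ : Equiv.Perm (Fin 6) := Equiv.ofBijective _ (Finite.injective_iff_bijective.1 hσ)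
    have hσ₅ : σ 5 = v := Fin.snoc_last (α := fun _ => Fin 6) v fun i : Fin 5 => w i
    have hσw : ∀ i : Fin 5, σ i.castSucc = w i := fun i =>
      Fin.snoc_castSucc (α := fun _ => Fin 6) v (fun i : Fin 5 => w i) i
    have e₀ := hw 0 (by decide)
    have e₁ := hw 1 (by decide)
    have e₂ := hw 2 (by decide)
    have e₃ := hw 3 (by decide)
    have e₄ := hw 4 (by decide)
    rw [hwt] at e₄
    rw [← tupleTotal_comp_perm hδ σ]
    refine tupleTotal_neg_of_pentagon hδ (arcOf_eq_f e₀) (arcOf_eq_f e₁) (arcOf_eq_f e₂)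
      (arcOf_eq_f e₃) (arcOf_eq_f e₄)
      (arcOf_eq_o (fun h => h₄ _ _ _ _ h e₂ e₃ e₄) (h₃ _ _ _ e₀ e₁))
      (arcOf_eq_o (fun h => h₄ _ _ _ _ h e₃ e₄ e₀) (h₃ _ _ _ e₁ e₂))
      (arcOf_eq_o (fun h => h₄ _ _ _ _ h e₄ e₀ e₁) (h₃ _ _ _ e₂ e₃))
      (arcOf_eq_o (fun h => h₃ _ _ _ h e₃ e₄) (h₄ _ _ _ _ e₀ e₁ e₂))
      (arcOf_eq_o (fun h => h₃ _ _ _ h e₄ e₀) (h₄ _ _ _ _ e₁ e₂ e₃)) ?_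
    rintro i j hij ⟨hi, hj⟩
    replace hi : E (x v) (x (w i)) := by
      have h := rel_of_arcOf_eq_f hi
      rwa [Function.comp_apply, Function.comp_apply, hσ₅, hσw] at h
    replace hj : E (x (w j)) (x v) := by
      have h := rel_of_arcOf_eq_b hj
      rwa [Function.comp_apply, Function.comp_apply, hσ₅, hσw] at h
    fin_cases i <;> fin_cases j <;> simp at hi hj hij <;> grind

/-- For all sufficiently large `n`, there is no oriented graph on `n` vertices in which
every vertex has outdegree exactly `0.20009 n` and which contains no directed cycle of
length `3`, `4` or `6`. -/
theorem no_regular_20009_c3_c4_c6_free :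
    ∃ n₀ : ℕ, ∀ n : ℕ, n₀ ≤ n →
      ¬ ∃ E : Fin n → Fin n → Prop, Oriented E ∧
        (∀ v, 100000 * outDeg E v = 20009 * n) ∧
        ¬ HasDiCycle E 3 ∧ ¬ HasDiCycle E 4 ∧ ¬ HasDiCycle E 6 := by
  refine ⟨1, ?_⟩
  rintro n hn ⟨E, ⟨h₁, h₂⟩, hdeg, h₃, h₄, h₆⟩
  have h₃' := not_diTriangle h₁ h₃
  have hneg := tupleTotal_arcOf_neg h₁ h₂ h₃' (not_diSquare h₁ h₂ h₄)
    (not_diHexagon h₁ h₂ h₃' h₆)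
  have : Nonempty (Fin 6 → Fin n) := ⟨fun _ => ⟨0, hn⟩⟩
  have hsum : ∑ x : Fin 6 → Fin n, tupleTotal (arcOf E) x < 0 :=
    Finset.sum_neg (fun x _ => hneg x) Finset.univ_nonempty
  refine absurd hsum (not_lt_of_ge (sum_tupleTotal_nonneg fun a => ?_))
  rw [sum_rootValue_arcOf, sub_eq_zero]
  exact_mod_cast hdeg a
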